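/- arXiv:1202.5793 — 3 statements merged into one kernel-verified Lean document; each statement's English description precedes it below -/
import Mathlib

section
/- Let W be an open set with 𝒯 ⊆ W ⊆ Ω and let p_n : W → M₂(ℂ) be a sequence of holomorphic maps with det p_n(x) = 1 for all x ∈ W, such that the maps φ_n(x) := p_n(x) x p_n(x)⁻¹ converge uniformly on compact subsets of W to a holomorphic map ψ : W → Ω. Then there exist an open neighborhood U of 𝒯 with U ⊆ W and holomorphic functions a_n, b_n : U → ℂ such that det(a_n(x)·I + b_n(x)·x) = 1 for all x ∈ U and n, and the sequence of maps x ↦ p_n(x)·(a_n(x)·I + b_n(x)·x) converges uniformly on compact subsets of U to a holomorphic map u : U → M₂(ℂ) with det u(x) = 1 for all x ∈ U. -/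
open Matrix Set

attribute [local instance] Matrix.normedAddCommGroup Matrix.normedSpace

noncomputable section

/-- The algebra of `2 × 2` complex matrices. -/
abbrev M2 : Type := Matrix (Fin 2) (Fin 2) ℂ

/-- The spectral ball: `2 × 2` complex matrices whose spectral radius is less than `1`. -/
def SpectralBall : Set M2 := {x : M2 | ∀ z ∈ spectrum ℂ x, ‖z‖ < 1}

/-- The set `𝒯` of non-cyclic matrices of the spectral ball, i.e. the scalar matrices `λ • I`
with `|λ| < 1`. -/
def NonCyclic : Set M2 := {x : M2 | ∃ l : ℂ, ‖l‖ < 1 ∧ x = l • (1 : M2)}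

/-- A family of maps, indexed by a topological space, that is jointly continuous on `U` and
whose members are all holomorphic on `U`. -/
structure HolFam {T E F : Type*} [TopologicalSpace T] [NormedAddCommGroup E] [NormedSpace ℂ E]
    [NormedAddCommGroup F] [NormedSpace ℂ F] (U : Set E) (f : T → E → F) : Prop where
  cont : ContinuousOn (Function.uncurry f) (univ ×ˢ U)
  diff : ∀ t, DifferentiableOn ℂ (f t) U

section CircleAverage

open Filter Topology Metric Real

variable {T E : Type*} [TopologicalSpace T] [NormedAddCommGroup E] [NormedSpace ℂ E]

theorem continuousAt_circleAverage_translate {V : Set E} (hV : IsOpen V) {G : T → E → ℂ}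
    (hG : ContinuousOn (Function.uncurry G) (univ ×ˢ V)) (t₀ : T) (x₀ e : E) {r : ℝ} (hr : 0 < r)
    (h : ∀ s ∈ sphere (0 : ℂ) r, x₀ + s • e ∈ V) :
    ContinuousAt (Function.uncurry fun t x => circleAverage (fun s => G t (x + s • e)) 0 r)
      (t₀, x₀) := by
  have hat : ∀ t, ∀ x ∈ V, ContinuousAt (Function.uncurry G) (t, x) := fun t x hx =>
    hG.continuousAt ((isOpen_univ.prod hV).mem_nhds ⟨mem_univ _, hx⟩)
  have hmap : Continuous fun q : (T × E) × ℂ => (q.1.1, q.1.2 + q.2 • e) := by fun_prop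
  have key : ∀ ε > 0, ∀ᶠ p : T × E in 𝓝 (t₀, x₀), ∀ s ∈ sphere (0 : ℂ) r,
      p.2 + s • e ∈ V ∧ ‖G p.1 (p.2 + s • e) - G t₀ (x₀ + s • e)‖ < ε := by
    intro ε hε
    refine (isCompact_sphere (0 : ℂ) r).eventually_forall_of_forall_eventually
      (P := fun (p : T × E) (s : ℂ) => p.2 + s • e ∈ V ∧ ‖G p.1 (p.2 + s • e) - G t₀ (x₀ + s • e)‖ < ε) ?_
    intro s hs
    refine Filter.Eventually.and ?_ ?_
    · have : ContinuousAt (fun q : (T × E) × ℂ => q.1.2 + q.2 • e) ((t₀, x₀), s) := by fun_prop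
      exact this.eventually (hV.mem_nhds (h s hs))
    · have h1 : ContinuousAt (fun q : (T × E) × ℂ => G q.1.1 (q.1.2 + q.2 • e)) ((t₀, x₀), s) :=
        ContinuousAt.comp (g := Function.uncurry G) (f := fun q : (T × E) × ℂ =>
          (q.1.1, q.1.2 + q.2 • e)) (hat t₀ _ (h s hs)) hmap.continuousAt
      have h2 : ContinuousAt (fun q : (T × E) × ℂ => G t₀ (x₀ + q.2 • e)) ((t₀, x₀), s) :=
        ContinuousAt.comp (g := Function.uncurry G) (f := fun q : (T × E) × ℂ =>
          (t₀, x₀ + q.2 • e)) (hat t₀ _ (h s hs)) (by fun_prop)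
      have h3 := (h1.sub h2).norm
      have : ∀ᶠ q : (T × E) × ℂ in 𝓝 ((t₀, x₀), s),
          ‖G q.1.1 (q.1.2 + q.2 • e) - G t₀ (x₀ + q.2 • e)‖ < ε :=
        h3.eventually (gt_mem_nhds (by simpa using hε))
      exact this
  have hint : ∀ t x, (∀ s ∈ sphere (0 : ℂ) r, x + s • e ∈ V) →
      CircleIntegrable (fun s => G t (x + s • e)) 0 r := by
    intro t x hx
    refine ContinuousOn.circleIntegrable hr.le ?_
    intro s hs
    exact (ContinuousAt.comp (g := Function.uncurry G) (f := fun s : ℂ => (t, x + s • e))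
      (hat t _ (hx s hs)) (by fun_prop)).continuousWithinAt
  rw [ContinuousAt, Metric.tendsto_nhds]
  intro ε hε
  filter_upwards [key (ε / 2) (by positivity)] with p hp
  simp only [Function.uncurry]
  rw [dist_eq_norm, ← circleAverage_fun_sub (hint _ _ fun s hs => (hp s hs).1) (hint _ _ h),
    circleAverage_def, norm_smul]
  have h1 := intervalIntegral.norm_integral_le_of_norm_le_const (a := 0) (b := 2 * π)
    (C := ε / 2) (f := fun θ => G p.1 (p.2 + circleMap 0 r θ • e) -
      G t₀ (x₀ + circleMap 0 r θ • e)) (fun θ _ => (hp _ (circleMap_mem_sphere 0 hr.le θ)).2.le)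
  have hpi := Real.pi_pos
  rw [sub_zero, abs_of_pos (by positivity)] at h1
  calc _ ≤ ‖(2 * π)⁻¹‖ * (ε / 2 * (2 * π)) := by gcongr
    _ = ε / 2 := by rw [Real.norm_of_nonneg (by positivity)]; field_simp
    _ < ε := by linarith

theorem differentiableAt_circleAverage_translate [FiniteDimensional ℂ E] {V : Set E}
    (hV : IsOpen V) {G : E → ℂ} (hG : DifferentiableOn ℂ G V) (x₀ e : E) {r : ℝ} (hr : 0 < r)
    (h : ∀ s ∈ sphere (0 : ℂ) r, x₀ + s • e ∈ V) :
    DifferentiableAt ℂ (fun x => circleAverage (fun s => G (x + s • e)) 0 r) x₀ := by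
  borelize E
  have : ProperSpace E := FiniteDimensional.proper ℂ E
  have : ProperSpace (E →L[ℂ] ℂ) := FiniteDimensional.proper ℂ _
  set K : Set E := (fun s : ℂ => x₀ + s • e) '' sphere 0 r with hK
  have hKc : IsCompact K := (isCompact_sphere _ _).image (by fun_prop)
  have hKV : K ⊆ V := by rintro _ ⟨s, hs, rfl⟩; exact h s hs
  obtain ⟨δ, hδ, hδV⟩ := hKc.exists_cthickening_subset_open hV hKV
  obtain ⟨C, hC⟩ := (hKc.cthickening (r := δ)).exists_bound_of_continuousOn
    (hG.continuousOn.mono hδV)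
  have hmem : ∀ θ : ℝ, x₀ + circleMap 0 r θ • e ∈ K := fun θ =>
    ⟨_, circleMap_mem_sphere 0 hr.le θ, rfl⟩
  have hthick : ∀ θ : ℝ, ∀ x ∈ ball x₀ (δ / 2), ball (x + circleMap 0 r θ • e) (δ / 2) ⊆
      cthickening δ K := by
    intro θ x hx z hz
    refine mem_cthickening_of_dist_le z _ δ K (hmem θ) ?_
    have h1 : dist (x + circleMap 0 r θ • e) (x₀ + circleMap 0 r θ • e) < δ / 2 := by
      simpa using hx
    have := dist_triangle z (x + circleMap 0 r θ • e) (x₀ + circleMap 0 r θ • e)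
    rw [mem_ball] at hz
    linarith
  have hself : ∀ θ : ℝ, ∀ x ∈ ball x₀ (δ / 2), x + circleMap 0 r θ • e ∈ cthickening δ K :=
    fun θ x hx => hthick θ x hx (mem_ball_self (by positivity))
  have hcont : ∀ x ∈ ball x₀ (δ / 2), Continuous fun θ => G (x + circleMap 0 r θ • e) := by
    intro x hx
    refine hG.continuousOn.comp_continuous ?_ fun θ => hδV (hself θ x hx)
    have := continuous_circleMap 0 r
    fun_prop
  have key := intervalIntegral.hasFDerivAt_integral_of_dominated_of_fderiv_le (𝕜 := ℂ)
    (μ := MeasureTheory.volume) (a := 0) (b := 2 * π) (x₀ := x₀) (s := ball x₀ (δ / 2))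
    (F := fun x θ => G (x + circleMap 0 r θ • e))
    (F' := fun x θ => fderiv ℂ G (x + circleMap 0 r θ • e))
    (bound := fun _ => (2 * C) / (δ / 2)) (ball_mem_nhds _ (by positivity))
    (by
      filter_upwards [ball_mem_nhds x₀ (half_pos hδ)] with x hx
      exact (hcont x hx).aestronglyMeasurable)
    ((hcont x₀ (mem_ball_self (by positivity))).intervalIntegrable _ _)
    (by
      have : Measurable fun θ : ℝ => fderiv ℂ G (x₀ + circleMap 0 r θ • e) := by
        refine (measurable_fderiv ℂ G).comp (Continuous.measurable ?_)
        have := continuous_circleMap 0 r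
        fun_prop
      exact this.aestronglyMeasurable)
    (by
      refine Filter.Eventually.of_forall fun θ _ x hx => ?_
      refine Complex.norm_fderiv_le_div_of_mapsTo_ball
        (hG.mono ((hthick θ x hx).trans hδV)) ?_ (by positivity)
      intro z hz
      rw [mem_closedBall, dist_eq_norm]
      have h1 := hC z (hthick θ x hx hz)
      have h2 := hC _ (hself θ x hx)
      have := norm_sub_le (G z) (G (x + circleMap 0 r θ • e))
      linarith)
    intervalIntegrable_const
    (by
      refine Filter.Eventually.of_forall fun θ _ x hx => ?_
      have h1 : HasFDerivAt G (fderiv ℂ G (x + circleMap 0 r θ • e)) (x + circleMap 0 r θ • e) :=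
        (hG.differentiableAt (hV.mem_nhds (hδV (hself θ x hx)))).hasFDerivAt
      exact (hasFDerivAt_comp_add_right (circleMap 0 r θ • e)).2 h1)
  simp only [circleAverage_def]
  exact key.differentiableAt.const_smul _

/-- A holomorphic family vanishing on a hyperplane is divisible by the equation of this
hyperplane. -/
theorem HolFam.exists_eq_mul [FiniteDimensional ℂ E] {U : Set E} (hU : IsOpen U) {f : T → E → ℂ}
    (hf : HolFam U f) (l : E →L[ℂ] ℂ) {e : E} (he : l e = 1)
    (h0 : ∀ t, ∀ x ∈ U, l x = 0 → f t x = 0) :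
    ∃ F : T → E → ℂ, HolFam U F ∧ ∀ t, ∀ x ∈ U, f t x = l x * F t x := by
  set h : T → E → ℂ → ℂ := fun t x s => f t (x + (s - l x) • e) with hh
  set F : T → E → ℂ := fun t x => dslope (h t x) 0 (l x) with hF
  set V : Set E := U ∩ {x | l x ≠ 0} with hVdef
  have hV : IsOpen V := hU.inter (isOpen_ne_fun l.continuous continuous_const)
  set G : T → E → ℂ := fun t x => f t x / l x with hG
  have hGc : ContinuousOn (Function.uncurry G) (univ ×ˢ V) := by
    refine ContinuousOn.div (hf.cont.mono (prod_mono_right inter_subset_left)) ?_ ?_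
    · exact (l.continuous.comp continuous_snd).continuousOn
    · rintro ⟨t, x⟩ ⟨-, -, hx⟩; exact hx
  have hGd : ∀ t, DifferentiableOn ℂ (G t) V := fun t => by
    simp only [hG, div_eq_mul_inv]
    exact ((hf.diff t).mono inter_subset_left).mul
      (l.differentiable.differentiableOn.inv fun x (hx : x ∈ V) => hx.2)
  have hh0 : ∀ t, ∀ x, x - l x • e ∈ U → h t x 0 = 0 := by
    intro t x hx
    simp only [hh, zero_sub, neg_smul, ← sub_eq_add_neg]
    exact h0 t _ hx (by simp [he])
  have hFV : ∀ t, ∀ x, x - l x • e ∈ U → l x ≠ 0 → F t x = G t x := by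
    intro t x hx hl
    simp only [hF, hG, dslope_of_ne _ hl, slope_def_field, hh0 t x hx]
    simp [hh]
  have hmul : ∀ t, ∀ x ∈ U, f t x = l x * G t x := by
    intro t x hx
    by_cases hl : l x = 0
    · rw [h0 t x hx hl, hl, zero_mul]
    · simp only [hG]; field_simp
  set F' : T → E → ℂ := fun t x => if l x = 0 then F t x else G t x with hF'
  have hF'G : ∀ t, ∀ x, l x ≠ 0 → F' t x = G t x := fun t x hx => by simp [hF', hx]
  have hat : ∀ t x, x ∈ U → ContinuousAt (Function.uncurry F') (t, x) ∧
      DifferentiableAt ℂ (F' t) x := by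
    intro t₀ x₀ hx₀
    by_cases hl : l x₀ = 0
    swap
    · have hxV : x₀ ∈ V := ⟨hx₀, hl⟩
      have hev : ∀ᶠ x in 𝓝 x₀, l x ≠ 0 := l.continuous.continuousAt.eventually_ne hl
      constructor
      · refine (hGc.continuousAt ((isOpen_univ.prod hV).mem_nhds ⟨mem_univ _, hxV⟩)).congr ?_
        have : ∀ᶠ p : T × E in 𝓝 (t₀, x₀), l p.2 ≠ 0 := (continuous_snd.tendsto (t₀, x₀)).eventually hev
        filter_upwards [this] with p hp
        exact (hF'G p.1 p.2 hp).symm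
      · refine ((hGd t₀).differentiableAt (hV.mem_nhds hxV)).congr_of_eventuallyEq ?_
        filter_upwards [hev] with x hx using hF'G t₀ x hx
    · -- near a point of the hyperplane, the quotient is a circle average of `G`
      have hc : ContinuousAt (fun q : E × ℂ => q.1 + q.2 • e) (x₀, 0) := by fun_prop
      have hUe : ∀ᶠ q : E × ℂ in 𝓝 (x₀, 0), q.1 + q.2 • e ∈ U :=
        hc.eventually (hU.mem_nhds (by simpa using hx₀))
      rw [nhds_prod_eq, Filter.eventually_prod_iff] at hUe
      obtain ⟨pa, hpa, pb, hpb, hab⟩ := hUe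
      obtain ⟨ρ, hρ, hρb⟩ := Metric.eventually_nhds_iff_ball.1 hpb
      set r := ρ / 2 with hr
      have hr0 : 0 < r := by positivity
      have hsmall : ∀ᶠ x in 𝓝 x₀, ‖l x‖ < r :=
        (l.continuous.norm.continuousAt (x := x₀)).eventually (gt_mem_nhds (by simpa [hl] using hr0))
      have havg : ∀ t x, pa x → ‖l x‖ < r → F' t x = circleAverage (fun s => G t (x + s • e)) 0 r := by
        intro t x hx hlx
        have hin : ∀ s ∈ ball (l x) ρ, x + (s - l x) • e ∈ U := fun s hs =>
          hab hx (hρb _ (by simpa [dist_eq_norm] using hs))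
        have hxm : x - l x • e ∈ U := by
          have := hin 0 (by simp only [mem_ball, dist_eq_norm, zero_sub, norm_neg]; linarith)
          simpa [sub_eq_add_neg] using this
        have hhd : DifferentiableOn ℂ (h t x) (ball (l x) ρ) := by
          refine (hf.diff t).comp (f := fun s : ℂ => x + (s - l x) • e) ?_ hin
          fun_prop
        have hds : DifferentiableOn ℂ (dslope (h t x) 0) (ball (l x) ρ) :=
          (Complex.differentiableOn_dslope (isOpen_ball.mem_nhds (by
            simp only [mem_ball, dist_eq_norm, zero_sub, norm_neg]; linarith))).2 hhd
        have hdc : DiffContOnCl ℂ (dslope (h t x) 0) (ball (l x) |r|) := by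
          rw [abs_of_pos hr0]
          exact hds.diffContOnCl_ball (closedBall_subset_ball (by linarith))
        have h1 : F' t x = F t x := by
          by_cases hl' : l x = 0
          · simp [hF', hl']
          · rw [hF'G t x hl', hFV t x hxm hl']
        rw [h1]
        simp only [hF]
        rw [← hdc.circleAverage, ← circleAverage_map_add_const]
        refine circleAverage_congr_sphere ?_
        intro s hs
        rw [abs_of_pos hr0, mem_sphere, dist_zero_right] at hs
        have hne : s + l x ≠ 0 := by
          intro hcon
          have : s = - l x := by linear_combination hcon
          rw [this, norm_neg] at hs
          linarith
        simp only [dslope_of_ne _ hne, slope_def_field, hh0 t x hxm]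
        simp [hh, hG, he, add_comm]
      have hx₀V : ∀ s ∈ sphere (0 : ℂ) r, x₀ + s • e ∈ V := by
        intro s hs
        rw [mem_sphere, dist_zero_right] at hs
        refine ⟨hab hpa.self_of_nhds (hρb _ (by simp; linarith)), ?_⟩
        simp only [mem_ofPred_eq, map_add, hl, map_smul, he]
        intro h
        simp at h
        simp [h] at hs
        linarith
      have hev : ∀ᶠ x in 𝓝 x₀, pa x ∧ ‖l x‖ < r := hpa.and hsmall
      constructor
      · refine (continuousAt_circleAverage_translate hV hGc t₀ x₀ e hr0 hx₀V).congr ?_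
        have : ∀ᶠ p : T × E in 𝓝 (t₀, x₀), pa p.2 ∧ ‖l p.2‖ < r := (continuous_snd.tendsto (t₀, x₀)).eventually hev
        filter_upwards [this] with p hp
        exact (havg p.1 p.2 hp.1 hp.2).symm
      · refine (differentiableAt_circleAverage_translate hV (hGd t₀) x₀ e hr0
          hx₀V).congr_of_eventuallyEq ?_
        filter_upwards [hev] with x hx using havg t₀ x hx.1 hx.2
  refine ⟨F', ⟨?_, ?_⟩, ?_⟩
  · rintro ⟨t, x⟩ ⟨-, hx⟩
    exact (hat t x hx).1.continuousWithinAt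
  · exact fun t x hx => (hat t x hx).2.differentiableWithinAt
  · intro t x hx
    by_cases hl : l x = 0
    · rw [h0 t x hx hl, hl, zero_mul]
    · rw [hF'G t x hl]; exact hmul t x hx

end CircleAverage

namespace HolFam

variable {T E F : Type*} [TopologicalSpace T] [NormedAddCommGroup E] [NormedSpace ℂ E]
  [NormedAddCommGroup F] [NormedSpace ℂ F] {U V : Set E}

theorem mono {f : T → E → F} (hf : HolFam U f) (h : V ⊆ U) : HolFam V f :=
  ⟨hf.cont.mono (prod_mono_right h), fun t => (hf.diff t).mono h⟩

theorem of_differentiableOn {g : E → F} (hg : DifferentiableOn ℂ g U) :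
    HolFam U fun _ : T => g :=
  ⟨hg.continuousOn.comp continuousOn_snd fun _ hp => hp.2, fun _ => hg⟩

theorem const (c : F) : HolFam U fun (_ : T) (_ : E) => c :=
  of_differentiableOn (differentiableOn_const c)

theorem comp {G : Type*} [NormedAddCommGroup G] [NormedSpace ℂ G] {f : T → E → F}
    (hf : HolFam U f) {V : Set G} {g : G → E} (hg : DifferentiableOn ℂ g V) (h : MapsTo g V U) :
    HolFam V fun t x => f t (g x) := by
  refine ⟨?_, fun t => (hf.diff t).comp hg h⟩
  refine hf.cont.comp (f := fun p : T × G => (p.1, g p.2)) ?_ fun p hp => ⟨mem_univ _, h hp.2⟩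
  exact continuousOn_fst.prodMk (hg.continuousOn.comp continuousOn_snd fun _ hp => hp.2)

theorem postcomp {G : Type*} [NormedAddCommGroup G] [NormedSpace ℂ G] {f : T → E → F}
    (hf : HolFam U f) {O : Set F} {g : F → G} (hg : DifferentiableOn ℂ g O)
    (h : ∀ t, MapsTo (f t) U O) : HolFam U fun t x => g (f t x) :=
  ⟨hg.continuousOn.comp hf.cont fun p hp => h p.1 hp.2, fun t => hg.comp (hf.diff t) (h t)⟩

theorem add {f g : T → E → F} (hf : HolFam U f) (hg : HolFam U g) :
    HolFam U fun t x => f t x + g t x :=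
  ⟨hf.cont.add hg.cont, fun t => (hf.diff t).add (hg.diff t)⟩

theorem sub {f g : T → E → F} (hf : HolFam U f) (hg : HolFam U g) :
    HolFam U fun t x => f t x - g t x :=
  ⟨hf.cont.sub hg.cont, fun t => (hf.diff t).sub (hg.diff t)⟩

theorem neg {f : T → E → F} (hf : HolFam U f) : HolFam U fun t x => - f t x :=
  ⟨hf.cont.neg, fun t => (hf.diff t).neg⟩

theorem mul {f g : T → E → ℂ} (hf : HolFam U f) (hg : HolFam U g) :
    HolFam U fun t x => f t x * g t x :=
  ⟨hf.cont.mul hg.cont, fun t => (hf.diff t).mul (hg.diff t)⟩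

theorem inv {f : T → E → ℂ} (hf : HolFam U f) (h : ∀ t, ∀ x ∈ U, f t x ≠ 0) :
    HolFam U fun t x => (f t x)⁻¹ :=
  ⟨hf.cont.inv₀ fun p hp => h p.1 p.2 hp.2, fun t => (hf.diff t).inv (h t)⟩

theorem sum {ι : Type*} (s : Finset ι) {f : ι → T → E → F} (hf : ∀ i, HolFam U (f i)) :
    HolFam U fun t x => ∑ i ∈ s, f i t x := by
  classical
  induction s using Finset.induction_on with
  | empty => simpa using const (U := U) (T := T) (0 : F)
  | insert i s his ih => simpa [Finset.sum_insert his] using (hf i).add ih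

theorem matrix {f : T → E → M2} (hf : ∀ i j, HolFam U fun t x => f t x i j) : HolFam U f := by
  constructor
  · exact continuousOn_pi.2 fun i => continuousOn_pi.2 fun j => (hf i j).cont
  · exact fun t => differentiableOn_pi.2 fun i => differentiableOn_pi.2 fun j => (hf i j).diff t

theorem entry {f : T → E → M2} (hf : HolFam U f) (i j : Fin 2) :
    HolFam U fun t x => f t x i j := by
  constructor
  · exact continuousOn_pi.1 (continuousOn_pi.1 hf.cont i) j
  · exact fun t => differentiableOn_pi.1 (differentiableOn_pi.1 (hf.diff t) i) j

theorem matMul {f g : T → E → M2} (hf : HolFam U f) (hg : HolFam U g) :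
    HolFam U fun t x => f t x * g t x := by
  refine matrix fun i j => ?_
  simp only [Matrix.mul_apply]
  exact sum _ fun k => (hf.entry i k).mul (hg.entry k j)

theorem smul {f : T → E → ℂ} {g : T → E → M2} (hf : HolFam U f) (hg : HolFam U g) :
    HolFam U fun t x => f t x • g t x := by
  refine matrix fun i j => ?_
  simp only [Matrix.smul_apply, smul_eq_mul]
  exact hf.mul (hg.entry i j)

theorem det {f : T → E → M2} (hf : HolFam U f) : HolFam U fun t x => (f t x).det := by
  simp only [Matrix.det_fin_two]
  exact ((hf.entry 0 0).mul (hf.entry 1 1)).sub ((hf.entry 0 1).mul (hf.entry 1 0))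

theorem adjugate {f : T → E → M2} (hf : HolFam U f) : HolFam U fun t x => (f t x).adjugate := by
  refine matrix fun i j => ?_
  simp only [Matrix.adjugate_fin_two]
  fin_cases i <;> fin_cases j <;> simp only [Fin.zero_eta, Fin.mk_one, Fin.isValue,
    Matrix.of_apply, Matrix.cons_val', Matrix.cons_val_zero, Matrix.cons_val_one,
    Matrix.cons_val_fin_one]
  · exact hf.entry 1 1
  · exact (hf.entry 0 1).neg
  · exact (hf.entry 1 0).neg
  · exact hf.entry 0 0

theorem isOpen_forall_mem [CompactSpace T] {f : T → E → F} (hf : HolFam U f) (hU : IsOpen U)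
    {O : Set F} (hO : IsOpen O) : IsOpen {x | x ∈ U ∧ ∀ t, f t x ∈ O} := by
  rw [isOpen_iff_mem_nhds]
  rintro x₀ ⟨hx, h⟩
  have h1 : ∀ᶠ x in nhds x₀, ∀ t ∈ (univ : Set T), f t x ∈ O := by
    refine isCompact_univ.eventually_forall_of_forall_eventually (P := fun x t => f t x ∈ O) ?_
    intro t _
    have hc : ContinuousAt (Function.uncurry f) (t, x₀) :=
      hf.cont.continuousAt ((isOpen_univ.prod hU).mem_nhds ⟨mem_univ _, hx⟩)
    have hs : Filter.Tendsto (Prod.swap : E × T → T × E) (nhds (x₀, t)) (nhds (t, x₀)) :=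
      continuous_swap.tendsto (x₀, t)
    exact (hc.tendsto.comp hs).eventually (hO.mem_nhds (h t))
  filter_upwards [hU.mem_nhds hx, h1] with x hx1 hx2
  exact ⟨hx1, fun t => hx2 t (mem_univ t)⟩

theorem eqOn_of_dense {f g : T → E → F} (hf : HolFam U f) (hg : HolFam U g) {D : Set T}
    (hD : Dense D) {x : E} (hx : x ∈ U) (h : ∀ t ∈ D, f t x = g t x) (t : T) : f t x = g t x := by
  have hc : ∀ {f : T → E → F}, HolFam U f → Continuous fun t => f t x := fun hf =>
    hf.cont.comp_continuous (f := fun t => (t, x)) (by fun_prop) fun t => ⟨mem_univ _, hx⟩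
  exact congrFun (Continuous.ext_on hD (hc hf) (hc hg) h) t

end HolFam

section OnePoint

open Filter Topology Metric OnePoint

variable {E F : Type*} [NormedAddCommGroup E] [NormedSpace ℂ E]
  [NormedAddCommGroup F] [NormedSpace ℂ F]

/-- The family indexed by `ℕ ∪ {∞}` made of a sequence and a limit. -/
def withLimit {X : Type*} (f : ℕ → X) (g : X) : OnePoint ℕ → X := fun t => t.elim g f

theorem HolFam.withLimit {U : Set E} (hU : IsOpen U) [LocallyCompactSpace E] {f : ℕ → E → F}
    {g : E → F} (hf : ∀ n, DifferentiableOn ℂ (f n) U) (hg : DifferentiableOn ℂ g U)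
    (h : ∀ K ⊆ U, IsCompact K → TendstoUniformlyOn f g atTop K) :
    HolFam U (withLimit f g) := by
  have hdiff : ∀ t, DifferentiableOn ℂ (_root_.withLimit f g t) U := by
    intro t
    induction t using OnePoint.rec with
    | infty => exact hg
    | coe n => exact hf n
  refine ⟨?_, hdiff⟩
  rintro ⟨t, x⟩ ⟨-, hx⟩
  refine ContinuousAt.continuousWithinAt ?_
  have hca : ∀ t, ContinuousAt (_root_.withLimit f g t) x := fun t =>
    ((hdiff t).differentiableAt (hU.mem_nhds hx)).continuousAt
  induction t using OnePoint.rec with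
  | coe n =>
    have h1 : ({(n : OnePoint ℕ)} : Set (OnePoint ℕ)) ∈ 𝓝 (n : OnePoint ℕ) := by
      rw [OnePoint.nhds_coe_eq]
      simp [nhds_discrete]
    have h2 : ∀ᶠ p : OnePoint ℕ × E in 𝓝 ((n : OnePoint ℕ), x), p.1 = n :=
      (continuous_fst.tendsto ((n : OnePoint ℕ), x)).eventually h1
    have h3 : ContinuousAt (fun p : OnePoint ℕ × E => _root_.withLimit f g n p.2) (↑n, x) :=
      ContinuousAt.comp (g := _root_.withLimit f g n) (f := Prod.snd) (hca n) continuousAt_snd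
    refine h3.congr ?_
    filter_upwards [h2] with p hp
    simp [Function.uncurry, hp]
  | infty =>
    obtain ⟨K, hK, hKU, hKc⟩ := local_compact_nhds (hU.mem_nhds hx)
    rw [ContinuousAt, Metric.tendsto_nhds]
    intro ε hε
    have h1 := Metric.tendstoUniformlyOn_iff.1 (h K hKU hKc) (ε / 2) (by positivity)
    obtain ⟨N, hN⟩ := eventually_atTop.1 h1
    have h2 : ∀ᶠ t : OnePoint ℕ in 𝓝 ∞, ∀ y ∈ K,
        dist (g y) (_root_.withLimit f g t y) < ε / 2 := by
      rw [OnePoint.nhds_infty_eq, eventually_sup]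
      constructor
      · rw [eventually_map, coclosedCompact_eq_cocompact, Filter.cocompact_eq_cofinite,
          Nat.cofinite_eq_atTop]
        exact eventually_atTop.2 ⟨N, hN⟩
      · simp only [eventually_pure]
        intro y hy
        simp [_root_.withLimit, hε]
    have h3 : ∀ᶠ y in 𝓝 x, y ∈ K ∧ dist (g y) (g x) < ε / 2 :=
      (show ∀ᶠ y in 𝓝 x, y ∈ K from hK).and
        ((hca ∞).eventually (ball_mem_nhds _ (by positivity)))
    rw [nhds_prod_eq]
    filter_upwards [h2.prod_mk h3] with p hp
    have h4 := hp.1 _ hp.2.1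
    rw [dist_comm] at h4
    calc dist (_root_.withLimit f g p.1 p.2) (g x) ≤ _ := dist_triangle _ (g p.2) _
      _ < ε := by linarith [hp.2.2]

theorem tendstoUniformlyOn_of_continuousOn {E F : Type*} [TopologicalSpace E]
    [PseudoMetricSpace F] {U : Set E} (hU : IsOpen U) {f : OnePoint ℕ → E → F}
    (hf : ContinuousOn (Function.uncurry f) (univ ×ˢ U)) {K : Set E} (hKU : K ⊆ U)
    (hK : IsCompact K) : TendstoUniformlyOn (fun n : ℕ => f n) (f ∞) atTop K := by
  rw [Metric.tendstoUniformlyOn_iff]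
  intro ε hε
  have hca : ∀ t, ∀ x ∈ U, ContinuousAt (Function.uncurry f) (t, x) := fun t x hx =>
    hf.continuousAt ((isOpen_univ.prod hU).mem_nhds ⟨mem_univ _, hx⟩)
  have h1 : ∀ᶠ t in 𝓝 (∞ : OnePoint ℕ), ∀ x ∈ K, dist (f ∞ x) (f t x) < ε := by
    refine hK.eventually_forall_of_forall_eventually
      (P := fun (t : OnePoint ℕ) x => dist (f ∞ x) (f t x) < ε) ?_
    intro x hx
    have h2 : ContinuousAt (fun p : OnePoint ℕ × E => f ∞ p.2) (∞, x) :=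
      ContinuousAt.comp (g := Function.uncurry f) (f := fun p : OnePoint ℕ × E => (∞, p.2))
        (hca ∞ x (hKU hx)) (by fun_prop)
    exact (h2.dist (hca ∞ x (hKU hx))).eventually (gt_mem_nhds (by simpa [Function.uncurry] using hε))
  have h2 : Tendsto (fun n : ℕ => (n : OnePoint ℕ)) atTop (𝓝 ∞) := by
    have := OnePoint.tendsto_coe_infty (X := ℕ)
    rwa [coclosedCompact_eq_cocompact, Filter.cocompact_eq_cofinite, Nat.cofinite_eq_atTop] at this
  exact h2.eventually h1

end OnePoint

section Signs

open Filter Topology Metric OnePoint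

theorem norm_sub_mul_add_le {a₁ a₂ b₁ b₂ : ℂ} {η : ℝ} (h₁ : ‖a₁ * a₁ - b₁ * b₁‖ ≤ η)
    (h₂ : ‖a₂ * a₂ - b₂ * b₂‖ ≤ η) (h₁₂ : ‖a₁ * a₂ - b₁ * b₂‖ ≤ η) :
    ‖a₁ - b₁‖ * ‖a₂ + b₂‖ ≤ 3 * η := by
  have hη : 0 ≤ η := (norm_nonneg _).trans h₁
  have hc : ‖a₁ * b₂ - b₁ * a₂‖ ^ 2 ≤ 2 * η ^ 2 := by
    calc ‖a₁ * b₂ - b₁ * a₂‖ ^ 2 = ‖(a₁ * a₂ - b₁ * b₂) ^ 2 -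
          (a₁ * a₁ - b₁ * b₁) * (a₂ * a₂ - b₂ * b₂)‖ := by rw [← norm_pow]; congr 1; ring
      _ ≤ ‖a₁ * a₂ - b₁ * b₂‖ ^ 2 + ‖a₁ * a₁ - b₁ * b₁‖ * ‖a₂ * a₂ - b₂ * b₂‖ := by
          refine (norm_sub_le _ _).trans ?_
          rw [norm_pow, norm_mul]
      _ ≤ η ^ 2 + η * η := by gcongr
      _ = 2 * η ^ 2 := by ring
  have hc' : ‖a₁ * b₂ - b₁ * a₂‖ ≤ 2 * η :=
    abs_le_of_sq_le_sq' (by nlinarith) (by positivity) |>.2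
  calc ‖a₁ - b₁‖ * ‖a₂ + b₂‖ = ‖(a₁ * a₂ - b₁ * b₂) + (a₁ * b₂ - b₁ * a₂)‖ := by
        rw [← norm_mul]; congr 1; ring
    _ ≤ η + 2 * η := (norm_add_le _ _).trans (add_le_add h₁₂ hc')
    _ = 3 * η := by ring

theorem norm_sub_mul_norm_add_le {a b : M2} {η : ℝ}
    (h : ∀ i j k l, ‖a i j * a k l - b i j * b k l‖ ≤ η) : ‖a - b‖ * ‖a + b‖ ≤ 3 * η := by
  have hη : 0 ≤ η := (norm_nonneg _).trans (h 0 0 0 0)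
  have h1 : ∀ i j, ‖a i j - b i j‖ * ‖a + b‖ ≤ 3 * η := by
    intro i j
    rcases (norm_nonneg (a i j - b i j)).eq_or_lt with h0 | h0
    · rw [← h0, zero_mul]; positivity
    · rw [mul_comm, ← le_div_iff₀ h0, Matrix.norm_le_iff (by positivity)]
      intro k l
      rw [le_div_iff₀ h0, mul_comm]
      exact norm_sub_mul_add_le (h i j i j) (h k l k l) (h i j k l)
  rcases (norm_nonneg (a + b)).eq_or_lt with h0 | h0
  · rw [← h0, mul_zero]; positivity
  · rw [← le_div_iff₀ h0, Matrix.norm_le_iff (by positivity)]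
    intro i j
    rw [le_div_iff₀ h0]
    exact h1 i j

theorem half_le_norm_of_det_eq_one {a : M2} (h : a.det = 1) : 1 / 2 ≤ ‖a‖ := by
  have h1 : (1 : ℝ) ≤ ‖a‖ * ‖a‖ + ‖a‖ * ‖a‖ := by
    calc (1 : ℝ) = ‖a 0 0 * a 1 1 - a 0 1 * a 1 0‖ := by rw [← Matrix.det_fin_two, h, norm_one]
      _ ≤ ‖a 0 0‖ * ‖a 1 1‖ + ‖a 0 1‖ * ‖a 1 0‖ := by
          rw [← norm_mul, ← norm_mul]; exact norm_sub_le _ _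
      _ ≤ _ := by gcongr <;> exact Matrix.norm_entry_le_entrywise_sup_norm a
  nlinarith [norm_nonneg a]

theorem one_le_norm_sub_add_norm_add {a b : M2} (h : a.det = 1) :
    1 ≤ ‖a - b‖ + ‖a + b‖ := by
  have h1 : ‖(2 : ℂ) • a‖ ≤ ‖a - b‖ + ‖a + b‖ := by
    have : (2 : ℂ) • a = (a - b) + (a + b) := by rw [two_smul]; abel
    rw [this]; exact norm_add_le _ _
  rw [norm_smul] at h1
  have := half_le_norm_of_det_eq_one h
  norm_num at h1
  linarith

theorem norm_sub_le_of_norm_sub_le {a b : M2} {η : ℝ} (ha : a.det = 1)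
    (h : ∀ i j k l, ‖a i j * a k l - b i j * b k l‖ ≤ η) (hle : ‖a - b‖ ≤ ‖a + b‖) :
    ‖a - b‖ ≤ 6 * η := by
  have h1 := norm_sub_mul_norm_add_le h
  have h2 := one_le_norm_sub_add_norm_add (b := b) ha
  nlinarith [norm_nonneg (a - b)]

theorem norm_sub_ne_norm_add {a b : M2} {η : ℝ} (hη : η ≤ 1 / 100) (ha : a.det = 1)
    (h : ∀ i j k l, ‖a i j * a k l - b i j * b k l‖ ≤ η) : ‖a + b‖ - ‖a - b‖ ≠ 0 := by
  have h1 := norm_sub_mul_norm_add_le h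
  have h2 := one_le_norm_sub_add_norm_add (b := b) ha
  intro h3
  nlinarith [norm_nonneg (a - b)]

theorem norm_sub_le_on_of_isPreconnected {K : Set ℂ} (hK : IsPreconnected K) {A B : ℂ → M2}
    (hA : ContinuousOn A K) (hB : ContinuousOn B K) (hdet : ∀ z ∈ K, (A z).det = 1) {η : ℝ}
    (hη : η ≤ 1 / 100)
    (h : ∀ z ∈ K, ∀ i j k l, ‖A z i j * A z k l - B z i j * B z k l‖ ≤ η) {z₀ : ℂ} (hz₀ : z₀ ∈ K)
    (h₀ : ‖A z₀ - B z₀‖ ≤ ‖A z₀ + B z₀‖) {z : ℂ} (hz : z ∈ K) : ‖A z - B z‖ ≤ 6 * η := by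
  refine norm_sub_le_of_norm_sub_le (hdet z hz) (h z hz) ?_
  by_contra! hlt
  have hc : ContinuousOn (fun z => ‖A z + B z‖ - ‖A z - B z‖) K :=
    (hA.add hB).norm.sub (hA.sub hB).norm
  obtain ⟨w, hw, hw0⟩ := hK.intermediate_value hz hz₀ hc
    (show (0 : ℝ) ∈ _ from ⟨by linarith, by linarith⟩)
  exact norm_sub_ne_norm_add hη (hdet w hw) (h w hw) hw0

/-- A sequence of holomorphic maps from the disc to `SL₂(ℂ)` which converges locally uniformly in
`PSL₂(ℂ)` converges locally uniformly in `SL₂(ℂ)` up to signs. -/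
theorem exists_signs_holFam {q : ℕ → ℂ → M2} (hq : ∀ n, DifferentiableOn ℂ (q n) (ball 0 1))
    (hdet : ∀ n, ∀ z ∈ ball (0 : ℂ) 1, (q n z).det = 1)
    {P : Fin 2 → Fin 2 → Fin 2 → Fin 2 → OnePoint ℕ → ℂ → ℂ}
    (hP : ∀ i j k l, ContinuousOn (Function.uncurry (P i j k l)) (univ ×ˢ ball 0 1))
    (hPq : ∀ i j k l, ∀ n : ℕ, ∀ z ∈ ball (0 : ℂ) 1, P i j k l n z = q n z i j * q n z k l) :
    ∃ ε : ℕ → ℂ, (∀ n, ε n = 1 ∨ ε n = -1) ∧ ∃ Q : OnePoint ℕ → ℂ → M2,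
      HolFam (ball 0 1) Q ∧ ∀ n : ℕ, ∀ z, Q n z = ε n • q n z := by
  have h0mem : (0 : ℂ) ∈ ball (0 : ℂ) 1 := mem_ball_self one_pos
  have hcauchy : ∀ K ⊆ ball (0 : ℂ) 1, IsCompact K → ∀ η > 0, ∃ N, ∀ m ≥ N, ∀ n ≥ N, ∀ z ∈ K,
      ∀ i j k l, ‖q m z i j * q m z k l - q n z i j * q n z k l‖ ≤ η := by
    intro K hK hKc η hη
    have h1 : ∀ i j k l, ∃ N, ∀ m ≥ N, ∀ n ≥ N, ∀ z ∈ K,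
        ‖q m z i j * q m z k l - q n z i j * q n z k l‖ ≤ η := by
      intro i j k l
      have := (tendstoUniformlyOn_of_continuousOn isOpen_ball (hP i j k l) hK
        hKc).uniformCauchySeqOn
      obtain ⟨N, hN⟩ := Metric.uniformCauchySeqOn_iff.1 this η hη
      refine ⟨N, fun m hm n hn z hz => ?_⟩
      have := (hN m hm n hn z hz).le
      rwa [hPq i j k l m z (hK hz), hPq i j k l n z (hK hz), dist_eq_norm] at this
    choose N hN using h1
    refine ⟨∑ i, ∑ j, ∑ k, ∑ l, N i j k l, fun m hm n hn z hz i j k l => ?_⟩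
    have hle : N i j k l ≤ ∑ i, ∑ j, ∑ k, ∑ l, N i j k l :=
      calc N i j k l ≤ ∑ l, N i j k l :=
            Finset.single_le_sum (f := fun l => N i j k l) (fun _ _ => Nat.zero_le _)
              (Finset.mem_univ l)
        _ ≤ ∑ k, ∑ l, N i j k l :=
            Finset.single_le_sum (f := fun k => ∑ l, N i j k l) (fun _ _ => Nat.zero_le _)
              (Finset.mem_univ k)
        _ ≤ ∑ j, ∑ k, ∑ l, N i j k l :=
            Finset.single_le_sum (f := fun j => ∑ k, ∑ l, N i j k l) (fun _ _ => Nat.zero_le _)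
              (Finset.mem_univ j)
        _ ≤ _ :=
            Finset.single_le_sum (f := fun i => ∑ j, ∑ k, ∑ l, N i j k l)
              (fun _ _ => Nat.zero_le _) (Finset.mem_univ i)
    exact hN i j k l m (hle.trans hm) n (hle.trans hn) z hz
  obtain ⟨N₀, hN₀⟩ := hcauchy {0} (by simp) isCompact_singleton (1 / 100) (by norm_num)
  classical
  set ε : ℕ → ℂ := fun n => if ‖q n 0 - q N₀ 0‖ ≤ ‖q n 0 + q N₀ 0‖ then 1 else -1 with hε
  have hε1 : ∀ n, ε n = 1 ∨ ε n = -1 := fun n => by simp only [hε]; split_ifs <;> simp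
  have hεsq : ∀ n, ε n * ε n = 1 := fun n => by rcases hε1 n with h | h <;> simp [h]
  set f : ℕ → ℂ → M2 := fun n z => ε n • q n z with hf
  have hfd : ∀ n, DifferentiableOn ℂ (f n) (ball 0 1) := fun n => (hq n).const_smul (ε n)
  have hfdet : ∀ n, ∀ z ∈ ball (0 : ℂ) 1, (f n z).det = 1 := by
    intro n z hz
    simp only [hf, Matrix.det_smul, hdet n z hz, Fintype.card_fin, mul_one, pow_two, hεsq]
  have hfq : ∀ n z i j k l, f n z i j * f n z k l = q n z i j * q n z k l := by
    intro n z i j k l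
    simp only [hf, Matrix.smul_apply, smul_eq_mul]
    linear_combination (q n z i j * q n z k l) * hεsq n
  have hnear : ∀ n ≥ N₀, ‖f n 0 - q N₀ 0‖ ≤ 6 * (1 / 100) := by
    intro n hn
    refine norm_sub_le_of_norm_sub_le (hfdet n 0 h0mem) ?_ ?_
    · intro i j k l
      rw [hfq]
      exact hN₀ n hn N₀ le_rfl 0 rfl i j k l
    · simp only [hf, hε]
      split_ifs with h
      · simpa using h
      · rw [neg_one_smul, ← norm_neg, neg_sub, sub_neg_eq_add, ← norm_neg (-q n 0 + q N₀ 0),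
          neg_add, neg_neg, ← sub_eq_add_neg, add_comm]
        exact (not_le.1 h).le
  have hpos : ∀ m ≥ N₀, ∀ n ≥ N₀, ‖f m 0 - f n 0‖ ≤ ‖f m 0 + f n 0‖ := by
    intro m hm n hn
    have h1 : ‖f m 0 - f n 0‖ ≤ ‖f m 0 - q N₀ 0‖ + ‖f n 0 - q N₀ 0‖ := by
      rw [← sub_sub_sub_cancel_right (f m 0) (f n 0) (q N₀ 0)]
      exact norm_sub_le _ _
    have h2 := one_le_norm_sub_add_norm_add (b := f n 0) (hfdet m 0 h0mem)
    linarith [hnear m hm, hnear n hn]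
  have hball : ∀ r ∈ Ioo (0 : ℝ) 1, UniformCauchySeqOn f atTop (closedBall 0 r) := by
    intro r hr
    refine Metric.uniformCauchySeqOn_iff.2 ?_
    intro δ hδ
    have hsub : closedBall (0 : ℂ) r ⊆ ball 0 1 := closedBall_subset_ball hr.2
    obtain ⟨N, hN⟩ := hcauchy (closedBall 0 r) hsub (isCompact_closedBall _ _)
      (min (1 / 100) (δ / 12)) (by positivity)
    refine ⟨max N N₀, fun m hm n hn z hz => ?_⟩
    rw [dist_eq_norm]
    have := norm_sub_le_on_of_isPreconnected (K := closedBall (0 : ℂ) r)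
      (convex_closedBall 0 r).isPreconnected
      ((hfd m).continuousOn.mono hsub) ((hfd n).continuousOn.mono hsub)
      (fun z hz => hfdet m z (hsub hz)) (min_le_left (1 / 100) (δ / 12))
      (fun z hz i j k l => by
        rw [hfq, hfq]
        exact hN m (le_of_max_le_left hm) n (le_of_max_le_left hn) z hz i j k l)
      (mem_closedBall_self hr.1.le) (hpos m (le_of_max_le_right hm) n (le_of_max_le_right hn)) hz
    have h3 := min_le_right (1 / 100 : ℝ) (δ / 12)
    linarith
  have hex : ∀ z, ∃ w, z ∈ ball (0 : ℂ) 1 → Tendsto (fun n => f n z) atTop (𝓝 w) := by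
    intro z
    by_cases hz : z ∈ ball (0 : ℂ) 1
    · obtain ⟨r, hr1, hr2⟩ := exists_between (show max ‖z‖ 0 < 1 by
        simpa using mem_ball_zero_iff.1 hz)
      have hr0 : 0 < r := (le_max_right _ _).trans_lt hr1
      obtain ⟨w, hw⟩ := cauchySeq_tendsto_of_complete ((hball r ⟨hr0, hr2⟩).cauchySeq
        (x := z) (by simpa using (le_max_left _ _).trans hr1.le))
      exact ⟨w, fun _ => hw⟩
    · exact ⟨0, fun h => absurd h hz⟩
  choose g hg using hex
  have hunif : ∀ K ⊆ ball (0 : ℂ) 1, IsCompact K → TendstoUniformlyOn f g atTop K := by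
    intro K hK hKc
    obtain ⟨r, hr, hKr⟩ := exists_pos_lt_subset_ball one_pos hKc.isClosed hK
    exact ((hball r hr).tendstoUniformlyOn_of_tendsto fun z hz =>
      hg z (closedBall_subset_ball hr.2 hz)).mono (hKr.trans ball_subset_closedBall)
  have hgd : DifferentiableOn ℂ g (ball 0 1) :=
    ((tendstoLocallyUniformlyOn_iff_forall_isCompact isOpen_ball).2 hunif).differentiableOn
      (Filter.Eventually.of_forall hfd) isOpen_ball
  exact ⟨ε, hε1, withLimit f g, HolFam.withLimit isOpen_ball hfd hgd hunif, fun n z => rfl⟩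

end Signs

section Coordinates

/-- The matrix entry `x ↦ x i j` as a continuous linear form. -/
def entryL (i j : Fin 2) : M2 →L[ℂ] ℂ :=
  LinearMap.toContinuousLinearMap (Matrix.entryLinearMap ℂ ℂ i j)

@[simp] theorem entryL_apply (i j : Fin 2) (x : M2) : entryL i j x = x i j := rfl

/-- Half of the trace. -/
def halfTr : M2 →L[ℂ] ℂ := (1 / 2 : ℂ) • (entryL 0 0 + entryL 1 1)

theorem halfTr_apply (x : M2) : halfTr x = (x 0 0 + x 1 1) / 2 := by
  simp [halfTr]; ring

/-- The standard basis of `𝔰𝔩₂(ℂ)`. -/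
def slBasis : Fin 3 → M2 := ![!![1, 0; 0, -1], !![0, 1; 0, 0], !![0, 0; 1, 0]]

/-- The coordinates of the traceless part of a matrix in the basis `slBasis`. -/
def slCoord : Fin 3 → M2 →L[ℂ] ℂ :=
  ![(1 / 2 : ℂ) • (entryL 0 0 - entryL 1 1), entryL 0 1, entryL 1 0]

theorem slCoord_zero (x : M2) : slCoord 0 x = (x 0 0 - x 1 1) / 2 := by
  simp [slCoord]; ring

theorem slCoord_one (x : M2) : slCoord 1 x = x 0 1 := rfl

theorem slCoord_two (x : M2) : slCoord 2 x = x 1 0 := rfl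

theorem slCoord_slBasis (i j : Fin 3) : slCoord i (slBasis j) = if i = j then 1 else 0 := by
  fin_cases i <;> fin_cases j <;> norm_num [slCoord, slBasis]

theorem slCoord_one_matrix (i : Fin 3) : slCoord i (1 : M2) = 0 := by
  fin_cases i <;> simp [slCoord]

theorem halfTr_slBasis (j : Fin 3) : halfTr (slBasis j) = 0 := by
  fin_cases j <;> simp [halfTr, slBasis]

theorem halfTr_one : halfTr (1 : M2) = 1 := by
  simp [halfTr]; norm_num

theorem eq_halfTr_add_sum (x : M2) :
    x = halfTr x • (1 : M2) + ∑ j, slCoord j x • slBasis j := by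
  ext i j
  fin_cases i <;> fin_cases j <;>
    simp [Fin.sum_univ_three, halfTr_apply, slCoord_zero, slCoord_one, slCoord_two, slBasis] <;>
    ring

/-- Projection onto the matrices with `slCoord 0 = 0`. -/
def proj₁ (x : M2) : M2 := x - slCoord 0 x • slBasis 0

/-- Projection onto the matrices with `slCoord 0 = slCoord 1 = 0`. -/
def proj₂ (x : M2) : M2 := proj₁ x - slCoord 1 x • slBasis 1

/-- Projection onto the scalar matrices. -/
def scalarPart (x : M2) : M2 := halfTr x • (1 : M2)

theorem proj₂_sub (x : M2) : proj₂ x - slCoord 2 x • slBasis 2 = scalarPart x := by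
  have := eq_halfTr_add_sum x
  rw [Fin.sum_univ_three] at this
  simp only [proj₂, proj₁, scalarPart]
  nth_rewrite 1 [this]
  abel

theorem differentiable_proj₁ : Differentiable ℂ proj₁ := by
  unfold proj₁; fun_prop

theorem differentiable_proj₂ : Differentiable ℂ proj₂ := by
  unfold proj₂ proj₁; fun_prop

theorem differentiable_scalarPart : Differentiable ℂ scalarPart := by
  unfold scalarPart; fun_prop

theorem slCoord_proj₁ (i : Fin 3) (x : M2) :
    slCoord i (proj₁ x) = if i = 0 then 0 else slCoord i x := by
  simp only [proj₁, map_sub, map_smul, slCoord_slBasis]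
  split_ifs with h <;> simp [h]

theorem slCoord_proj₂ (i : Fin 3) (x : M2) :
    slCoord i (proj₂ x) = if i = 2 then slCoord 2 x else 0 := by
  simp only [proj₂, map_sub, map_smul, slCoord_slBasis, slCoord_proj₁]
  fin_cases i <;> simp

theorem halfTr_proj₁ (x : M2) : halfTr (proj₁ x) = halfTr x := by
  simp [proj₁, halfTr_slBasis]

theorem halfTr_proj₂ (x : M2) : halfTr (proj₂ x) = halfTr x := by
  simp [proj₂, halfTr_slBasis, halfTr_proj₁]

theorem slCoord_scalarPart (i : Fin 3) (x : M2) : slCoord i (scalarPart x) = 0 := by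
  simp [scalarPart, slCoord_one_matrix]

theorem proj₁_eq_self {x : M2} (h : slCoord 0 x = 0) : proj₁ x = x := by simp [proj₁, h]

theorem proj₂_eq_self {x : M2} (h : slCoord 0 x = 0) (h' : slCoord 1 x = 0) : proj₂ x = x := by
  simp [proj₂, proj₁, h, h']

theorem eq_of_coords {x y : M2} (h : halfTr x = halfTr y) (h' : ∀ i, slCoord i x = slCoord i y) :
    x = y := by
  rw [eq_halfTr_add_sum x, eq_halfTr_add_sum y, h]
  simp [h']

/-- An open set of matrices stable under the successive projections onto the scalar matrices. -/
structure ProjStable (U : Set M2) : Prop where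
  isOpen : IsOpen U
  mapsTo₁ : MapsTo proj₁ U U
  mapsTo₂ : MapsTo proj₂ U U
  mapsTo₃ : MapsTo scalarPart U U

theorem exists_projStable {W : Set M2} (hW : IsOpen W) :
    ∃ U ⊆ W, ProjStable U ∧ ∀ l : ℂ, l • (1 : M2) ∈ W → l • (1 : M2) ∈ U := by
  have h1 := differentiable_proj₁.continuous
  have h2 := differentiable_proj₂.continuous
  have h3 := differentiable_scalarPart.continuous
  have e11 : ∀ x, proj₁ (proj₁ x) = proj₁ x := fun x =>
    proj₁_eq_self (by simp [slCoord_proj₁])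
  have e12 : ∀ x, proj₁ (proj₂ x) = proj₂ x := fun x =>
    proj₁_eq_self (by simp [slCoord_proj₂])
  have e13 : ∀ x, proj₁ (scalarPart x) = scalarPart x := fun x =>
    proj₁_eq_self (slCoord_scalarPart _ _)
  have e22 : ∀ x, proj₂ (proj₂ x) = proj₂ x := fun x =>
    proj₂_eq_self (by simp [slCoord_proj₂]) (by simp [slCoord_proj₂])
  have e23 : ∀ x, proj₂ (scalarPart x) = scalarPart x := fun x =>
    proj₂_eq_self (slCoord_scalarPart _ _) (slCoord_scalarPart _ _)
  have e21 : ∀ x, proj₂ (proj₁ x) = proj₂ x := fun x =>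
    eq_of_coords (by simp [halfTr_proj₁, halfTr_proj₂])
      fun i => by simp [slCoord_proj₂, slCoord_proj₁]
  have e31 : ∀ x, scalarPart (proj₁ x) = scalarPart x := fun x => by
    simp [scalarPart, halfTr_proj₁]
  have e32 : ∀ x, scalarPart (proj₂ x) = scalarPart x := fun x => by
    simp [scalarPart, halfTr_proj₂]
  have e33 : ∀ x, scalarPart (scalarPart x) = scalarPart x := fun x => by
    simp [scalarPart, halfTr_one]
  refine ⟨W ∩ (proj₁ ⁻¹' W ∩ (proj₂ ⁻¹' W ∩ scalarPart ⁻¹' W)), inter_subset_left, ⟨?_, ?_, ?_, ?_⟩,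
    ?_⟩
  · exact hW.inter ((hW.preimage h1).inter ((hW.preimage h2).inter (hW.preimage h3)))
  · rintro x ⟨-, hx1, hx2, hx3⟩
    simp only [mem_inter_iff, mem_preimage, e11, e21, e31] at *
    exact ⟨hx1, hx1, hx2, hx3⟩
  · rintro x ⟨-, hx1, hx2, hx3⟩
    simp only [mem_inter_iff, mem_preimage, e12, e22, e32] at *
    exact ⟨hx2, hx2, hx2, hx3⟩
  · rintro x ⟨-, hx1, hx2, hx3⟩
    simp only [mem_inter_iff, mem_preimage, e13, e23, e33] at *
    exact ⟨hx3, hx3, hx3, hx3⟩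
  · intro l hl
    have e0 : scalarPart (l • (1 : M2)) = l • 1 := by simp [scalarPart, halfTr_one]
    rw [← e0] at hl ⊢
    simp only [mem_inter_iff, mem_preimage, e13, e23, e33]
    exact ⟨hl, hl, hl, hl⟩

theorem eq_zero_of_eq_zero_on_line {U : Set M2} (hU : IsOpen U) {f : M2 → ℂ}
    (hf : ContinuousOn f U) {x : M2} (hx : x ∈ U) (e : M2)
    (h : ∀ s : ℂ, s ≠ 0 → x + s • e ∈ U → f (x + s • e) = 0) : f x = 0 := by
  have hline : Continuous fun s : ℂ => x + s • e := by fun_prop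
  have hx0 : x + (0 : ℂ) • e = x := by simp
  have hc : Filter.Tendsto (fun s : ℂ => f (x + s • e)) (nhdsWithin 0 {0}ᶜ) (nhds (f x)) := by
    have h1 : ContinuousAt f (x + (0 : ℂ) • e) := by
      rw [hx0]; exact hf.continuousAt (hU.mem_nhds hx)
    have h2 := (ContinuousAt.comp (f := fun s : ℂ => x + s • e) h1 hline.continuousAt).tendsto
    simp only [Function.comp_def, hx0] at h2
    exact h2.mono_left nhdsWithin_le_nhds
  have hev : ∀ᶠ s : ℂ in nhdsWithin 0 {0}ᶜ, f (x + s • e) = 0 := by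
    have h1 : ∀ᶠ s : ℂ in nhds 0, x + s • e ∈ U :=
      hline.continuousAt.eventually (hU.mem_nhds (by simpa using hx))
    filter_upwards [nhdsWithin_le_nhds h1, self_mem_nhdsWithin] with s hs hs0
    exact h s hs0 hs
  exact tendsto_nhds_unique hc (Filter.Tendsto.congr' (hev.mono fun s hs => hs.symm)
    tendsto_const_nhds)

theorem slCoord_add_smul (i j : Fin 3) (x : M2) (s : ℂ) :
    slCoord i (x + s • slBasis j) = slCoord i x + if i = j then s else 0 := by
  simp [slCoord_slBasis]

variable {T : Type*} [TopologicalSpace T] {U : Set M2}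

theorem HolFam.coord (i : Fin 3) : HolFam U fun (_ : T) x => slCoord i x :=
  HolFam.of_differentiableOn (slCoord i).differentiable.differentiableOn

theorem HolFam.exists_eq_slCoord_mul (hU : IsOpen U) {f : T → M2 → ℂ} (hf : HolFam U f)
    (i : Fin 3) (h0 : ∀ t, ∀ x ∈ U, slCoord i x = 0 → f t x = 0) :
    ∃ F : T → M2 → ℂ, HolFam U F ∧ ∀ t, ∀ x ∈ U, f t x = slCoord i x * F t x :=
  hf.exists_eq_mul hU (slCoord i) (e := slBasis i) ((slCoord_slBasis i i).trans (if_pos rfl)) h0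

/-- Expansion along the traceless coordinates. -/
theorem HolFam.exists_eq_sum (hU : ProjStable U) {f : T → M2 → ℂ} (hf : HolFam U f) :
    ∃ G : Fin 3 → T → M2 → ℂ, (∀ j, HolFam U (G j)) ∧
      (∀ t, ∀ x ∈ U, f t x = f t (scalarPart x) + ∑ j, slCoord j x * G j t x) ∧
      ∀ t, ∀ x ∈ U, f t x - f t (proj₂ x) =
        slCoord 0 x * G 0 t x + slCoord 1 x * G 1 t x := by
  have hf1 := hf.comp differentiable_proj₁.differentiableOn hU.mapsTo₁
  have hf2 := hf.comp differentiable_proj₂.differentiableOn hU.mapsTo₂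
  have hf3 := hf.comp differentiable_scalarPart.differentiableOn hU.mapsTo₃
  obtain ⟨A, hA, hA'⟩ := (hf.sub hf1).exists_eq_slCoord_mul hU.isOpen 0 fun t x _ h => by simp [proj₁_eq_self h]
  obtain ⟨B, hB, hB'⟩ := (hf1.sub hf2).exists_eq_slCoord_mul hU.isOpen 1 fun t x _ h => by simp [proj₂, h]
  obtain ⟨C, hC, hC'⟩ := (hf2.sub hf3).exists_eq_slCoord_mul hU.isOpen 2 fun t x _ h => by simp [← proj₂_sub, h]
  refine ⟨![A, B, C], ?_, fun t x hx => ?_, fun t x hx => ?_⟩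
  · intro j
    fin_cases j
    exacts [hA, hB, hC]
  · simp only [Fin.sum_univ_three]
    show f t x = f t (scalarPart x) + (slCoord 0 x * A t x + slCoord 1 x * B t x +
      slCoord 2 x * C t x)
    linear_combination hA' t x hx + hB' t x hx + hC' t x hx
  · show _ = slCoord 0 x * A t x + slCoord 1 x * B t x
    linear_combination hA' t x hx + hB' t x hx

/-- Exactness of the Koszul complex: a vector field orthogonal to the coordinate vector field and
vanishing on scalar matrices is the cross product of the coordinate vector field with some `v`. -/
theorem HolFam.exists_cross_eq (hU : ProjStable U) {w : Fin 3 → T → M2 → ℂ}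
    (hw : ∀ i, HolFam U (w i)) {N : Fin 3 → Fin 3 → T → M2 → ℂ} (hN : ∀ i j, HolFam U (N i j))
    (hwN : ∀ i t, ∀ x ∈ U, w i t x = ∑ j, slCoord j x * N i j t x)
    (hN0 : ∀ i j t, ∀ l : ℂ, l • (1 : M2) ∈ U → N i j t (l • 1) = 0)
    (horth : ∀ t, ∀ x ∈ U, ∑ i, slCoord i x * w i t x = 0) :
    ∃ v : Fin 3 → T → M2 → ℂ, (∀ i, HolFam U (v i)) ∧
      (∀ i t, ∀ l : ℂ, l • (1 : M2) ∈ U → v i t (l • 1) = 0) ∧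
      ∀ t, ∀ x ∈ U,
        slCoord 1 x * v 2 t x - slCoord 2 x * v 1 t x = w 0 t x ∧
        slCoord 2 x * v 0 t x - slCoord 0 x * v 2 t x = w 1 t x ∧
        slCoord 0 x * v 1 t x - slCoord 1 x * v 0 t x = w 2 t x := by
  simp only [Fin.sum_univ_three] at hwN horth
  obtain ⟨G, hG, -, hG'⟩ := (hw 2).exists_eq_sum hU
  have hw3 : ∀ t, ∀ x ∈ U,
      w 2 t x = slCoord 0 x * G 0 t x + slCoord 1 x * G 1 t x := by
    intro t x hx
    rw [← hG' t x hx, eq_comm, sub_eq_self]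
    have h1 := horth t _ (hU.mapsTo₂ hx)
    have h2 := hwN 2 t _ (hU.mapsTo₂ hx)
    simp [slCoord_proj₂] at h1 h2
    rcases h1 with h1 | h1
    · simpa [h1] using h2
    · exact h1
  have hX : HolFam U fun t x => w 0 t x + slCoord 2 x * G 0 t x :=
    (hw 0).add ((HolFam.coord 2).mul (hG 0))
  have hXeq : ∀ t, ∀ x ∈ U, slCoord 0 x * (w 0 t x + slCoord 2 x * G 0 t x) +
      slCoord 1 x * (w 1 t x + slCoord 2 x * G 1 t x) = 0 := by
    intro t x hx
    linear_combination horth t x hx - slCoord 2 x * hw3 t x hx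
  obtain ⟨C, hC, hC'⟩ := hX.exists_eq_slCoord_mul hU.isOpen 1 (by
      intro t x hx h
      by_cases h0 : slCoord 0 x = 0
      · refine eq_zero_of_eq_zero_on_line hU.isOpen (hX.diff t).continuousOn hx (slBasis 0) ?_
        intro s hs hxs
        have := hXeq t _ hxs
        simp only [slCoord_add_smul, h, h0] at this ⊢
        simpa [hs] using this
      · simpa [h, h0] using hXeq t x hx)
  have hY : HolFam U fun t x => w 1 t x + slCoord 2 x * G 1 t x + slCoord 0 x * C t x :=
    ((hw 1).add ((HolFam.coord 2).mul (hG 1))).add ((HolFam.coord 0).mul hC)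
  have hYeq : ∀ t, ∀ x ∈ U,
      w 1 t x + slCoord 2 x * G 1 t x + slCoord 0 x * C t x = 0 := by
    have hY' : ∀ t, ∀ x ∈ U, slCoord 1 x *
        (w 1 t x + slCoord 2 x * G 1 t x + slCoord 0 x * C t x) = 0 := by
      intro t x hx
      linear_combination hXeq t x hx - slCoord 0 x * hC' t x hx
    intro t x hx
    by_cases h1 : slCoord 1 x = 0
    · refine eq_zero_of_eq_zero_on_line hU.isOpen (hY.diff t).continuousOn hx (slBasis 1) ?_
      intro s hs hxs
      have := hY' t _ hxs
      refine (mul_eq_zero.1 this).resolve_left ?_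
      simpa [slCoord_add_smul, h1] using hs
    · exact (mul_eq_zero.1 (hY' t x hx)).resolve_left h1
  have hline : ∀ {A B : T → M2 → ℂ}, HolFam U A → HolFam U B → ∀ (j : Fin 3) (t : T) (l : ℂ),
      l • (1 : M2) ∈ U → B t (l • 1) = 0 →
      (∀ s : ℂ, l • (1 : M2) + s • slBasis j ∈ U →
        s * A t (l • 1 + s • slBasis j) = s * B t (l • 1 + s • slBasis j)) → A t (l • 1) = 0 := by
    intro A B hA hB j t l hl h0 h
    have := eq_zero_of_eq_zero_on_line hU.isOpen ((hA.sub hB).diff t).continuousOn hl (slBasis j)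
      fun s hs hxs => sub_eq_zero.2 (mul_left_cancel₀ hs (h s hxs))
    simpa [h0] using this
  refine ⟨![fun t x => - G 1 t x, G 0, C], ?_, ?_, fun t x hx => ⟨?_, ?_, ?_⟩⟩
  · intro i
    fin_cases i
    exacts [(hG 1).neg, hG 0, hC]
  · intro i t l hl
    fin_cases i
    · show - G 1 t _ = 0
      rw [neg_eq_zero]
      refine hline (hG 1) (hN 2 1) 1 t l hl (hN0 _ _ _ _ hl) fun s hs => ?_
      have h1 := hw3 t _ hs
      rw [hwN 2 t _ hs] at h1
      simpa [slCoord_add_smul, slCoord_one_matrix] using h1.symm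
    · refine hline (hG 0) (hN 2 0) 0 t l hl (hN0 _ _ _ _ hl) fun s hs => ?_
      have h1 := hw3 t _ hs
      rw [hwN 2 t _ hs] at h1
      simpa [slCoord_add_smul, slCoord_one_matrix] using h1.symm
    · refine hline hC (hN 0 1) 1 t l hl (hN0 _ _ _ _ hl) fun s hs => ?_
      have h1 := hC' t _ hs
      rw [hwN 0 t _ hs] at h1
      simpa [slCoord_add_smul, slCoord_one_matrix] using h1.symm
  · show slCoord 1 x * C t x - slCoord 2 x * G 0 t x = w 0 t x
    linear_combination - hC' t x hx
  · show slCoord 2 x * (- G 1 t x) - slCoord 0 x * C t x = w 1 t x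
    linear_combination - hYeq t x hx
  · show slCoord 0 x * G 0 t x - slCoord 1 x * (- G 1 t x) = w 2 t x
    linear_combination - hw3 t x hx

end Coordinates

section Conjugation

theorem cross_mulVec_of_cross_eq {M : Fin 3 → Fin 3 → ℂ} {D : ℂ} (hD : D ≠ 0)
    (hM : D = M 0 0 * M 1 1 * M 2 2 - M 0 0 * M 1 2 * M 2 1 - M 0 1 * M 1 0 * M 2 2 +
      M 0 1 * M 1 2 * M 2 0 + M 0 2 * M 1 0 * M 2 1 - M 0 2 * M 1 1 * M 2 0)
    {y v e : Fin 3 → ℂ}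
    (h0 : y 1 * v 2 - y 2 * v 1 = ∑ k, M k 0 * e k)
    (h1 : y 2 * v 0 - y 0 * v 2 = ∑ k, M k 1 * e k)
    (h2 : y 0 * v 1 - y 1 * v 0 = ∑ k, M k 2 * e k) {s u : Fin 3 → ℂ}
    (hs : ∀ i, s i = ∑ j, M i j * y j) (hu : ∀ i, u i = (∑ j, M i j * v j) * D⁻¹) :
    s 1 * u 2 - s 2 * u 1 = e 0 ∧ s 2 * u 0 - s 0 * u 2 = e 1 ∧ s 0 * u 1 - s 1 * u 0 = e 2 := by
  simp only [Fin.sum_univ_three] at *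
  simp only [hs, hu]
  refine ⟨?_, ?_, ?_⟩ <;> field_simp
  · rw [hM]
    linear_combination (M 1 1 * M 2 2 - M 1 2 * M 2 1) * h0 - (M 1 0 * M 2 2 - M 1 2 * M 2 0) * h1 +
      (M 1 0 * M 2 1 - M 1 1 * M 2 0) * h2
  · rw [hM]
    linear_combination -(M 0 1 * M 2 2 - M 0 2 * M 2 1) * h0 +
      (M 0 0 * M 2 2 - M 0 2 * M 2 0) * h1 - (M 0 0 * M 2 1 - M 0 1 * M 2 0) * h2
  · rw [hM]
    linear_combination (M 0 1 * M 1 2 - M 0 2 * M 1 1) * h0 - (M 0 0 * M 1 2 - M 0 2 * M 1 0) * h1 +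
      (M 0 0 * M 1 1 - M 0 1 * M 1 0) * h2

theorem mul_one_add_eq_of_cross {x z : M2} (hlam : halfTr z = halfTr x) {s d v : Fin 3 → ℂ}
    (hs : ∀ i, s i = slCoord i z + slCoord i x) (hd : ∀ i, d i = slCoord i z - slCoord i x)
    (h0 : s 1 * v 2 - s 2 * v 1 = -2 * d 0) (h1 : s 2 * v 0 - s 0 * v 2 = - d 2)
    (h2 : s 0 * v 1 - s 1 * v 0 = - d 1) :
    z * !![1 + v 0, v 1; v 2, 1 - v 0] = !![1 + v 0, v 1; v 2, 1 - v 0] * x := by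
  have ht : 2 * d 0 * v 0 + d 2 * v 1 + d 1 * v 2 = 0 := by
    linear_combination v 0 * h0 + v 1 * h1 + v 2 * h2
  simp only [hs, hd, slCoord_zero, slCoord_one, slCoord_two] at h0 h1 h2 ht
  rw [halfTr_apply, halfTr_apply] at hlam
  ext i j
  fin_cases i <;> fin_cases j <;> simp [Matrix.mul_apply, Fin.sum_univ_two]
  · linear_combination (1 + v 0) * hlam + h0 / 2 + ht / 2
  · linear_combination v 1 * hlam + h2
  · linear_combination v 2 * hlam + h1
  · linear_combination (1 - v 0) * hlam - h0 / 2 + ht / 2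

variable {T : Type*} [TopologicalSpace T] {U : Set M2}

set_option maxHeartbeats 1000000 in
/-- A holomorphic family of matrices with the characteristic polynomial of `x`, agreeing with `x`
to first order along the scalar matrices, is holomorphically conjugate to `x` near these. -/
theorem HolFam.exists_conj [CompactSpace T] (hU : ProjStable U) {Z : T → M2 → M2}
    {N : Fin 3 → Fin 3 → T → M2 → ℂ} (hN : ∀ i j, HolFam U (N i j))
    (hN0 : ∀ i j t, ∀ l : ℂ, l • (1 : M2) ∈ U → N i j t (l • 1) = 0)
    (htr : ∀ t, ∀ x ∈ U, halfTr (Z t x) = halfTr x) (hdet : ∀ t, ∀ x ∈ U, (Z t x).det = x.det)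
    (hZ : ∀ i t, ∀ x ∈ U, slCoord i (Z t x) = slCoord i x + ∑ j, slCoord j x * N i j t x) :
    ∃ V ⊆ U, IsOpen V ∧ (∀ l : ℂ, l • (1 : M2) ∈ U → l • (1 : M2) ∈ V) ∧ ∃ g : T → M2 → M2,
      HolFam V g ∧ (∀ t, ∀ x ∈ V, (g t x).det = 1) ∧ ∀ t, ∀ x ∈ V, Z t x * g t x = g t x * x := by
  set M : Fin 3 → Fin 3 → T → M2 → ℂ := fun i j t x => (if i = j then 2 else 0) + N i j t x with hMdef
  have hM : ∀ i j, HolFam U (M i j) := fun i j => (HolFam.const _).add (hN i j)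
  set R : Fin 3 → Fin 3 → T → M2 → ℂ :=
    ![fun j t x => -2 * N 0 j t x, fun j t x => - N 2 j t x, fun j t x => - N 1 j t x] with hR
  have hRhol : ∀ i j, HolFam U (R i j) := by
    intro i j
    fin_cases i
    exacts [(HolFam.const _).mul (hN 0 j), (hN 2 j).neg, (hN 1 j).neg]
  have hR0 : ∀ i j t, ∀ l : ℂ, l • (1 : M2) ∈ U → R i j t (l • 1) = 0 := by
    intro i j t l hl
    fin_cases i <;> simp [hR, hN0 _ _ _ _ hl]
  have hdet' : ∀ t, ∀ x ∈ U, slCoord 0 (Z t x) ^ 2 + slCoord 1 (Z t x) * slCoord 2 (Z t x) =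
      slCoord 0 x ^ 2 + slCoord 1 x * slCoord 2 x := by
    intro t x hx
    have h1 := hdet t x hx
    have h2 := htr t x hx
    rw [Matrix.det_fin_two, Matrix.det_fin_two] at h1
    simp only [halfTr_apply, slCoord_zero, slCoord_one, slCoord_two] at h2 ⊢
    linear_combination ((Z t x 0 0 + Z t x 1 1) / 2 + (x 0 0 + x 1 1) / 2) * h2 - h1
  obtain ⟨v, hv, hv0, hcross⟩ := HolFam.exists_cross_eq hU
    (w := fun i t x => ∑ k, M k i t x * ∑ j, slCoord j x * R k j t x)
    (N := fun i j t x => ∑ k, M k i t x * R k j t x)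
    (fun i => HolFam.sum _ fun k => (hM k i).mul
      (HolFam.sum _ fun j => (HolFam.coord j).mul (hRhol k j)))
    (fun i j => HolFam.sum _ fun k => (hM k i).mul (hRhol k j))
    (by intro i t x hx; simp only [Fin.sum_univ_three]; ring)
    (by intro i j t l hl; simp [hR0 _ _ _ _ hl])
    (by
      intro t x hx
      have h := hdet' t x hx
      rw [hZ 0 t x hx, hZ 1 t x hx, hZ 2 t x hx] at h
      simp [Fin.sum_univ_three, hMdef, hR] at h ⊢
      linear_combination -2 * h)
  set D : T → M2 → ℂ := fun t x => M 0 0 t x * M 1 1 t x * M 2 2 t x -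
    M 0 0 t x * M 1 2 t x * M 2 1 t x - M 0 1 t x * M 1 0 t x * M 2 2 t x +
    M 0 1 t x * M 1 2 t x * M 2 0 t x + M 0 2 t x * M 1 0 t x * M 2 1 t x -
    M 0 2 t x * M 1 1 t x * M 2 0 t x with hDdef
  have hD : HolFam U D :=
    (((((((hM 0 0).mul (hM 1 1)).mul (hM 2 2)).sub (((hM 0 0).mul (hM 1 2)).mul (hM 2 1))).sub
      (((hM 0 1).mul (hM 1 0)).mul (hM 2 2))).add (((hM 0 1).mul (hM 1 2)).mul (hM 2 0))).add
      (((hM 0 2).mul (hM 1 0)).mul (hM 2 1))).sub (((hM 0 2).mul (hM 1 1)).mul (hM 2 0))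
  set V₁ : Set M2 := {x | x ∈ U ∧ ∀ t, D t x ∈ ({0}ᶜ : Set ℂ)} with hV₁
  have hV₁o : IsOpen V₁ := hD.isOpen_forall_mem hU.isOpen isOpen_compl_singleton
  have hV₁U : V₁ ⊆ U := fun x hx => hx.1
  have hV₁s : ∀ l : ℂ, l • (1 : M2) ∈ U → l • (1 : M2) ∈ V₁ := by
    intro l hl
    refine ⟨hl, fun t => ?_⟩
    simp [hDdef, hMdef, hN0 _ _ _ _ hl]
  set u : Fin 3 → T → M2 → ℂ := fun i t x => (∑ j, M i j t x * v j t x) * (D t x)⁻¹ with hudef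
  have hu : ∀ i, HolFam V₁ (u i) := fun i =>
    ((HolFam.sum _ fun j => (hM i j).mul (hv j)).mono hV₁U).mul
      ((hD.mono hV₁U).inv fun t x hx => hx.2 t)
  have hu0 : ∀ i t, ∀ l : ℂ, l • (1 : M2) ∈ U → u i t (l • 1) = 0 := by
    intro i t l hl
    simp [hudef, hv0 _ _ _ hl]
  set g₀ : T → M2 → M2 := fun t x => !![1 + u 0 t x, u 1 t x; u 2 t x, 1 - u 0 t x] with hg₀def
  have hg₀ : HolFam V₁ g₀ := by
    refine HolFam.matrix fun i j => ?_
    fin_cases i <;> fin_cases j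
    exacts [(HolFam.const 1).add (hu 0), hu 1, hu 2, (HolFam.const 1).sub (hu 0)]
  have hconj : ∀ t, ∀ x ∈ V₁, Z t x * g₀ t x = g₀ t x * x := by
    intro t x hx
    have hc := hcross t x hx.1
    obtain ⟨h0, h1, h2⟩ := cross_mulVec_of_cross_eq (M := fun i j => M i j t x) (hx.2 t) rfl
      (y := fun i => slCoord i x) (v := fun i => v i t x)
      (e := fun k => ∑ j, slCoord j x * R k j t x) hc.1 hc.2.1 hc.2.2
      (s := fun i => slCoord i (Z t x) + slCoord i x) (u := fun i => u i t x)
      (by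
        intro i
        simp only [hZ i t x hx.1, hMdef, Fin.sum_univ_three]
        fin_cases i <;> simp <;> ring)
      (fun i => rfl)
    refine mul_one_add_eq_of_cross (htr t x hx.1) (s := fun i => slCoord i (Z t x) + slCoord i x)
      (d := fun i => slCoord i (Z t x) - slCoord i x) (v := fun i => u i t x)
      (fun i => rfl) (fun i => rfl) ?_ ?_ ?_
    · rw [h0, hZ 0 t x hx.1]
      simp [hR, Fin.sum_univ_three]; ring
    · rw [h1, hZ 2 t x hx.1]
      simp [hR]
    · rw [h2, hZ 1 t x hx.1]
      simp [hR]
  set V : Set M2 := {x | x ∈ V₁ ∧ ∀ t, (g₀ t x).det ∈ Complex.slitPlane} with hV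
  have hVV₁ : V ⊆ V₁ := fun x hx => hx.1
  have hr : HolFam V fun t x => Complex.exp (-(Complex.log (g₀ t x).det) / 2) :=
    (hg₀.det.mono hVV₁).postcomp (O := Complex.slitPlane)
      (g := fun w => Complex.exp (-(Complex.log w) / 2))
      (fun w hw => ((Complex.differentiableAt_log hw).neg.div_const 2).cexp.differentiableWithinAt)
      (fun t x hx => hx.2 t)
  refine ⟨V, hVV₁.trans hV₁U, hg₀.det.isOpen_forall_mem hV₁o Complex.isOpen_slitPlane, ?_,
    fun t x => Complex.exp (-(Complex.log (g₀ t x).det) / 2) • g₀ t x,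
    hr.smul (hg₀.mono hVV₁), ?_, ?_⟩
  · intro l hl
    refine ⟨hV₁s l hl, fun t => ?_⟩
    simp [hg₀def, hu0 _ _ _ hl, Matrix.det_fin_two]
  · intro t x hx
    rw [Matrix.det_smul, Fintype.card_fin, ← Complex.exp_nat_mul]
    have h1 : ((2 : ℕ) : ℂ) * (-(Complex.log (g₀ t x).det) / 2) = -Complex.log (g₀ t x).det := by
      push_cast; ring
    have h2 := Complex.slitPlane_ne_zero (hx.2 t)
    rw [h1, Complex.exp_neg, Complex.exp_log h2, inv_mul_cancel₀ h2]
  · intro t x hx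
    rw [Matrix.mul_smul, Matrix.smul_mul, hconj t x hx.1]

/-- A holomorphic map commuting with `x` at every point `x` is of the form `a(x) + b(x) x`. -/
theorem exists_eq_add_smul_of_commute (hU : IsOpen U) {k : M2 → M2} (hk : DifferentiableOn ℂ k U)
    (hcomm : ∀ x ∈ U, k x * x = x * k x) :
    ∃ a b : M2 → ℂ, DifferentiableOn ℂ a U ∧ DifferentiableOn ℂ b U ∧
      ∀ x ∈ U, k x = a x • (1 : M2) + b x • x := by
  have hk' : HolFam U fun (_ : Unit) => k := HolFam.of_differentiableOn hk
  have hc : ∀ i, DifferentiableOn ℂ (fun x => slCoord i (k x)) U := fun i =>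
    (slCoord i).differentiable.comp_differentiableOn hk
  have hrel : ∀ x ∈ U, slCoord 0 (k x) * slCoord 1 x = slCoord 1 (k x) * slCoord 0 x ∧
      slCoord 0 (k x) * slCoord 2 x = slCoord 2 (k x) * slCoord 0 x := by
    intro x hx
    have h := hcomm x hx
    have h01 := congrFun (congrFun h 0) 1
    have h10 := congrFun (congrFun h 1) 0
    simp only [Matrix.mul_apply, Fin.sum_univ_two] at h01 h10
    simp only [slCoord_zero, slCoord_one, slCoord_two]
    constructor
    · linear_combination h01 / 2
    · linear_combination -h10 / 2
  obtain ⟨b, hb, hb'⟩ := (HolFam.of_differentiableOn (T := Unit) (hc 0)).exists_eq_slCoord_mul hU 0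
    (by
      intro _ x hx h0
      by_cases h1 : slCoord 1 x = 0
      · refine eq_zero_of_eq_zero_on_line hU (hc 0).continuousOn hx (slBasis 1) fun s hs hxs => ?_
        have := (hrel _ hxs).1
        simpa [slCoord_add_smul, h0, h1, hs] using this
      · have := (hrel x hx).1
        simpa [h0, h1] using this)
  have hbd : DifferentiableOn ℂ (b ()) U := hb.diff ()
  have hcoord : ∀ i, ∀ x ∈ U, slCoord i (k x) = b () x * slCoord i x := by
    intro i x hx
    have hd : DifferentiableOn ℂ (fun x => slCoord i (k x) - b () x * slCoord i x) U :=
      (hc i).sub (hbd.mul (slCoord i).differentiable.differentiableOn)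
    have key : ∀ x ∈ U, slCoord 0 x * (slCoord i (k x) - b () x * slCoord i x) = 0 := by
      intro x hx
      have h0 := hb' () x hx
      obtain ⟨h1, h2⟩ := hrel x hx
      fin_cases i <;> simp only [Fin.zero_eta, Fin.mk_one, Fin.reduceFinMk]
      · linear_combination slCoord 0 x * h0
      · linear_combination slCoord 1 x * h0 - h1
      · linear_combination slCoord 2 x * h0 - h2
    by_cases h0 : slCoord 0 x = 0
    · refine sub_eq_zero.1
        (eq_zero_of_eq_zero_on_line hU hd.continuousOn hx (slBasis 0) fun s hs hxs => ?_)
      refine (mul_eq_zero.1 (key _ hxs)).resolve_left ?_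
      simpa [slCoord_add_smul, h0] using hs
    · exact sub_eq_zero.1 ((mul_eq_zero.1 (key x hx)).resolve_left h0)
  refine ⟨fun x => halfTr (k x) - b () x * halfTr x, b (), ?_, hbd, fun x hx => ?_⟩
  · exact (halfTr.differentiable.comp_differentiableOn hk).sub
      (hbd.mul halfTr.differentiable.differentiableOn)
  · refine eq_of_coords ?_ fun i => ?_
    · simp [halfTr_one]
    · simp [slCoord_one_matrix, hcoord i x hx]

end Conjugation

section Assembly

open Filter Topology Metric

theorem adjugate_mul_of_det_eq_one {q : M2} (h : q.det = 1) : q.adjugate * q = 1 := by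
  rw [Matrix.adjugate_mul, h, one_smul]

theorem mul_adjugate_of_det_eq_one {q : M2} (h : q.det = 1) : q * q.adjugate = 1 := by
  rw [Matrix.mul_adjugate, h, one_smul]

theorem halfTr_eq_trace (x : M2) : halfTr x = x.trace / 2 := by
  rw [halfTr_apply, Matrix.trace_fin_two]

theorem halfTr_conj {q : M2} (h : q.det = 1) (x : M2) : halfTr (q.adjugate * x * q) = halfTr x := by
  rw [halfTr_eq_trace, halfTr_eq_trace, Matrix.mul_assoc, Matrix.trace_mul_comm, Matrix.mul_assoc,
    mul_adjugate_of_det_eq_one h, Matrix.mul_one]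

theorem halfTr_conj' {q : M2} (h : q.det = 1) (x : M2) :
    halfTr (q * x * q.adjugate) = halfTr x := by
  rw [halfTr_eq_trace, halfTr_eq_trace, Matrix.mul_assoc, Matrix.trace_mul_comm, Matrix.mul_assoc,
    adjugate_mul_of_det_eq_one h, Matrix.mul_one]

theorem det_adjugate_of_det_eq_one {q : M2} (h : q.det = 1) : q.adjugate.det = 1 := by
  rw [Matrix.det_adjugate, h, one_pow]

theorem mul_eq_conj_slBasis {q : M2} (h : q.det = 1) (i j k l : Fin 2) :
    q i j * q k l = (-1) ^ (k + l : ℕ) *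
      (![![(1 / 2 : ℂ) • (1 + q * slBasis 0 * q.adjugate), q * slBasis 1 * q.adjugate],
        ![q * slBasis 2 * q.adjugate, (1 / 2 : ℂ) • (1 - q * slBasis 0 * q.adjugate)]]
          j (1 - l) : M2) i (1 - k) := by
  rw [Matrix.det_fin_two] at h
  fin_cases i <;> fin_cases j <;> fin_cases k <;> fin_cases l <;>
    simp [slBasis, Matrix.adjugate_fin_two, Matrix.mul_apply, Fin.sum_univ_two] <;>
    first
    | ring1
    | linear_combination h / 2
    | linear_combination -h / 2

theorem norm_lt_one_of_smul_one_mem {l : ℂ} (h : l • (1 : M2) ∈ SpectralBall) : ‖l‖ < 1 := by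
  refine h l ?_
  rw [← Algebra.algebraMap_eq_smul_one, spectrum.scalar_eq]
  rfl

variable {U : Set M2}

theorem HolFam.slCoord_comp {T : Type*} [TopologicalSpace T] {f : T → M2 → M2} (hf : HolFam U f)
    (i : Fin 3) : HolFam U fun t x => slCoord i (f t x) :=
  hf.postcomp (O := univ) (slCoord i).differentiable.differentiableOn fun _ _ _ => mem_univ _

theorem HolFam.halfTr_comp {T : Type*} [TopologicalSpace T] {f : T → M2 → M2} (hf : HolFam U f) :
    HolFam U fun t x => halfTr (f t x) :=
  hf.postcomp (O := univ) halfTr.differentiable.differentiableOn fun _ _ _ => mem_univ _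

theorem HolFam.eqOn_of_forall_coe {F : Type*} [NormedAddCommGroup F] [NormedSpace ℂ F]
    {E : Type*} [NormedAddCommGroup E] [NormedSpace ℂ E] {U : Set E}
    {f g : OnePoint ℕ → E → F} (hf : HolFam U f) (hg : HolFam U g) {x : E} (hx : x ∈ U)
    (h : ∀ n : ℕ, f n x = g n x) (t : OnePoint ℕ) : f t x = g t x :=
  hf.eqOn_of_dense hg (OnePoint.denseRange_coe (X := ℕ)) hx (by rintro _ ⟨n, rfl⟩; exact h n) t

variable {p : ℕ → M2 → M2} {φ : OnePoint ℕ → M2 → M2}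

/-- First order expansion along the scalar matrices of a convergent sequence of conjugations. -/
theorem exists_expansion_of_conj (hU : ProjStable U) (hp : ∀ n, DifferentiableOn ℂ (p n) U)
    (hpdet : ∀ n, ∀ x ∈ U, (p n x).det = 1) (hφ : HolFam U φ)
    (hφp : ∀ n : ℕ, ∀ x ∈ U, φ n x = p n x * x * (p n x).adjugate) :
    ∃ G : Fin 3 → OnePoint ℕ → M2 → M2, (∀ j, HolFam U (G j)) ∧
      (∀ t, ∀ x ∈ U, φ t x = scalarPart x + ∑ j, slCoord j x • G j t x) ∧
      ∀ j, ∀ n : ℕ, ∀ l : ℂ, l • (1 : M2) ∈ U →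
        G j n (l • 1) = p n (l • 1) * slBasis j * (p n (l • 1)).adjugate := by
  have hscal : ∀ n, ∀ x ∈ U, ∀ l : ℂ, p n x * (l • (1 : M2)) * (p n x).adjugate = l • 1 := by
    intro n x hx l
    rw [Matrix.mul_smul, Matrix.mul_one, Matrix.smul_mul,
      mul_adjugate_of_det_eq_one (hpdet n x hx)]
  have hφs : ∀ t, ∀ x ∈ U, φ t (scalarPart x) = scalarPart x := fun t x hx =>
    hφ.eqOn_of_forall_coe (HolFam.of_differentiableOn (g := fun x => x) differentiableOn_id)
      (hU.mapsTo₃ hx)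
      (fun n => (hφp n _ (hU.mapsTo₃ hx)).trans (hscal n _ (hU.mapsTo₃ hx) _)) t
  choose G hG hGeq _ using fun k l => (hφ.entry k l).exists_eq_sum hU
  have hsum : ∀ t, ∀ x ∈ U, φ t x = scalarPart x +
      ∑ j, slCoord j x • (Matrix.of fun k l => G k l j t x : M2) := by
    intro t x hx
    ext k l
    rw [hGeq k l t x hx, hφs t x hx]
    simp [Fin.sum_univ_three]
  have hGhol : ∀ j, HolFam U fun t x => (Matrix.of fun k l => G k l j t x : M2) :=
    fun j => HolFam.matrix fun k l => hG k l j
  refine ⟨fun j t x => Matrix.of fun k l => G k l j t x, hGhol, hsum, ?_⟩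
  intro j n l hl
  have hpn : HolFam U fun (_ : OnePoint ℕ) => p n := HolFam.of_differentiableOn (hp n)
  have hdiff := (hGhol j).sub ((hpn.matMul (HolFam.const (slBasis j))).matMul hpn.adjugate)
  ext a b
  refine sub_eq_zero.1 (eq_zero_of_eq_zero_on_line hU.isOpen
    ((hdiff.entry a b).diff n).continuousOn hl (slBasis j) fun s hs hxs => ?_)
  have h1 := hsum n _ hxs
  rw [hφp n _ hxs] at h1
  have h2 : scalarPart (l • (1 : M2) + s • slBasis j) = l • 1 := by
    simp [scalarPart, halfTr_one, halfTr_slBasis]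
  have h3 : ∀ i, slCoord i (l • (1 : M2) + s • slBasis j) = if i = j then s else 0 := fun i => by
    simp [slCoord_add_smul, slCoord_one_matrix]
  set x := l • (1 : M2) + s • slBasis j with hx
  rw [h2] at h1
  nth_rewrite 2 [hx] at h1
  rw [Matrix.mul_add, Matrix.add_mul, hscal n x hxs] at h1
  simp only [h3, ite_smul, zero_smul, Finset.sum_ite_eq', Finset.mem_univ, if_true,
    Matrix.mul_smul, Matrix.smul_mul] at h1
  have h4 := smul_right_injective M2 hs (add_left_cancel h1)
  exact sub_eq_zero.2 (congrFun (congrFun h4.symm a) b)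

/-- Along the scalar matrices, the conjugating sequence converges up to signs. -/
theorem exists_signs_of_expansion (hU1 : ∀ l ∈ ball (0 : ℂ) 1, l • (1 : M2) ∈ U)
    (hp : ∀ n, DifferentiableOn ℂ (p n) U) (hpdet : ∀ n, ∀ x ∈ U, (p n x).det = 1)
    {G : Fin 3 → OnePoint ℕ → M2 → M2} (hG : ∀ j, HolFam U (G j))
    (hGp : ∀ j, ∀ n : ℕ, ∀ l : ℂ, l • (1 : M2) ∈ U →
        G j n (l • 1) = p n (l • 1) * slBasis j * (p n (l • 1)).adjugate) :
    ∃ ε : ℕ → ℂ, (∀ n, ε n = 1 ∨ ε n = -1) ∧ ∃ Q : OnePoint ℕ → ℂ → M2,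
      HolFam (ball 0 1) Q ∧ ∀ n : ℕ, ∀ z, Q n z = ε n • p n (z • 1) := by
  have hline : DifferentiableOn ℂ (fun z : ℂ => z • (1 : M2)) (ball 0 1) :=
    (differentiable_id.smul_const (1 : M2)).differentiableOn
  have hGl : ∀ j, HolFam (ball 0 1) fun t (z : ℂ) => G j t (z • 1) := fun j =>
    (hG j).comp hline hU1
  set B : Fin 2 → Fin 2 → OnePoint ℕ → ℂ → M2 :=
    ![![fun t z => (1 / 2 : ℂ) • (1 + G 0 t (z • 1)), fun t z => G 1 t (z • 1)],
      ![fun t z => G 2 t (z • 1), fun t z => (1 / 2 : ℂ) • (1 - G 0 t (z • 1))]] with hB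
  have hBhol : ∀ j m, HolFam (ball 0 1) (B j m) := by
    intro j m
    fin_cases j <;> fin_cases m
    exacts [(HolFam.const _).smul ((HolFam.const _).add (hGl 0)), hGl 1, hGl 2,
      (HolFam.const _).smul ((HolFam.const _).sub (hGl 0))]
  refine exists_signs_holFam (q := fun n z => p n (z • 1)) (fun n => (hp n).comp hline hU1)
    (fun n z hz => hpdet n _ (hU1 z hz))
    (P := fun i j k l t z => (-1) ^ (k + l : ℕ) * B j (1 - l) t z i (1 - k))
    (fun i j k l => ((HolFam.const _).mul ((hBhol j (1 - l)).entry i (1 - k))).cont) ?_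
  intro i j k l n z hz
  rw [mul_eq_conj_slBasis (hpdet n _ (hU1 z hz)) i j k l]
  simp only [← hGp _ n z (hU1 z hz)]
  congr 1
  fin_cases j <;> fin_cases l <;> rfl

/-- Convergent conjugations can be realized by a convergent sequence of conjugating maps. -/
theorem exists_convergent_conjugators (hU : ProjStable U)
    (hU1 : ∀ l : ℂ, l • (1 : M2) ∈ U ↔ ‖l‖ < 1) (hp : ∀ n, DifferentiableOn ℂ (p n) U)
    (hpdet : ∀ n, ∀ x ∈ U, (p n x).det = 1) (hφ : HolFam U φ)
    (hφp : ∀ n : ℕ, ∀ x ∈ U, φ n x = p n x * x * (p n x).adjugate) :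
    ∃ V ⊆ U, IsOpen V ∧ (∀ l : ℂ, l • (1 : M2) ∈ U → l • (1 : M2) ∈ V) ∧
      ∃ h : OnePoint ℕ → M2 → M2, HolFam V h ∧ (∀ t, ∀ x ∈ V, (h t x).det = 1) ∧
        ∀ t, ∀ x ∈ V, φ t x * h t x = h t x * x := by
  obtain ⟨G, hG, hGsum, hGp⟩ := exists_expansion_of_conj hU hp hpdet hφ hφp
  obtain ⟨ε, hε, Q, hQ, hQp⟩ := exists_signs_of_expansion
    (fun l hl => (hU1 l).2 (mem_ball_zero_iff.1 hl)) hp hpdet hG hGp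
  have hεsq : ∀ n, ε n * ε n = 1 := fun n => by rcases hε n with h | h <;> simp [h]
  have hQdet : ∀ t, ∀ z ∈ ball (0 : ℂ) 1, (Q t z).det = 1 := fun t z hz =>
    hQ.det.eqOn_of_forall_coe (HolFam.const 1) hz (fun n => by
      rw [hQp, Matrix.det_smul, hpdet n _ ((hU1 z).2 (mem_ball_zero_iff.1 hz)), Fintype.card_fin,
        mul_one, pow_two, hεsq]) t
  have hmaps : MapsTo halfTr U (ball (0 : ℂ) 1) := fun x hx =>
    mem_ball_zero_iff.2 ((hU1 _).1 (hU.mapsTo₃ hx))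
  set R : OnePoint ℕ → M2 → M2 := fun t x => Q t (halfTr x) with hRdef
  have hR : HolFam U R := hQ.comp halfTr.differentiable.differentiableOn hmaps
  have hRdet : ∀ t, ∀ x ∈ U, (R t x).det = 1 := fun t x hx => hQdet t _ (hmaps hx)
  have hφtr : ∀ t, ∀ x ∈ U, halfTr (φ t x) = halfTr x := fun t x hx =>
    hφ.halfTr_comp.eqOn_of_forall_coe
      (HolFam.of_differentiableOn halfTr.differentiable.differentiableOn) hx
      (fun n => by rw [hφp n x hx, halfTr_conj' (hpdet n x hx)]) t
  have hφdet : ∀ t, ∀ x ∈ U, (φ t x).det = x.det := fun t x hx =>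
    hφ.det.eqOn_of_forall_coe
      (HolFam.of_differentiableOn (g := fun x => x) differentiableOn_id).det hx
      (fun n => by
        rw [hφp n x hx, Matrix.det_mul, Matrix.det_mul, hpdet n x hx,
          det_adjugate_of_det_eq_one (hpdet n x hx), one_mul, mul_one]) t
  have hconj : ∀ j, HolFam U fun t x => (R t x).adjugate * G j t x * R t x := fun j =>
    (hR.adjugate.matMul (hG j)).matMul hR
  have hN : ∀ i j, HolFam U fun t x =>
      slCoord i ((R t x).adjugate * G j t x * R t x) - slCoord i (slBasis j) := fun i j =>
    ((hconj j).slCoord_comp i).sub (HolFam.const _)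
  obtain ⟨V, hVU, hVo, hVs, g, hg, hgdet, hgconj⟩ := HolFam.exists_conj hU
    (Z := fun t x => (R t x).adjugate * φ t x * R t x) hN
    (by
      intro i j t l hl
      refine (hN i j).eqOn_of_forall_coe (HolFam.const 0) hl (fun n => ?_) t
      have h1 : R n (l • 1) = ε n • p n (l • 1) := by
        simp only [hRdef, map_smul, halfTr_one, smul_eq_mul, mul_one, hQp]
      have h2 := adjugate_mul_of_det_eq_one (hRdet n _ hl)
      have h3 : (p n (l • 1)).adjugate * R n (l • 1) = ε n • 1 := by
        rw [h1, Matrix.mul_smul, adjugate_mul_of_det_eq_one (hpdet n _ hl)]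
      have h4 : (R n (l • 1)).adjugate * p n (l • 1) = ε n • 1 := by
        calc (R n (l • 1)).adjugate * p n (l • 1)
            = ε n • ((R n (l • 1)).adjugate * (ε n • p n (l • 1))) := by
              rw [Matrix.mul_smul, smul_smul, hεsq, one_smul]
          _ = ε n • 1 := by rw [← h1, h2]
      have h5 : (R n (l • 1)).adjugate * G j n (l • 1) * R n (l • 1) = slBasis j := by
        rw [hGp j n l hl]
        calc (R n (l • 1)).adjugate * (p n (l • 1) * slBasis j * (p n (l • 1)).adjugate) *
              R n (l • 1) = ((R n (l • 1)).adjugate * p n (l • 1)) * slBasis j *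
              ((p n (l • 1)).adjugate * R n (l • 1)) := by simp only [Matrix.mul_assoc]
          _ = slBasis j := by
              rw [h3, h4, Matrix.smul_mul, Matrix.mul_smul, Matrix.one_mul, Matrix.mul_one,
                smul_smul, hεsq, one_smul]
      exact sub_eq_zero.2 (by rw [h5]))
    (fun t x hx => by rw [halfTr_conj (hRdet t x hx), hφtr t x hx])
    (fun t x hx => by
      rw [Matrix.det_mul, Matrix.det_mul, hRdet t x hx,
        det_adjugate_of_det_eq_one (hRdet t x hx), one_mul, mul_one, hφdet t x hx])
    (by
      intro i t x hx
      have h1 : (R t x).adjugate * φ t x * R t x = scalarPart x +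
          ∑ j, slCoord j x • ((R t x).adjugate * G j t x * R t x) := by
        rw [hGsum t x hx, Matrix.mul_add, Matrix.add_mul]
        congr 1
        · rw [scalarPart, Matrix.mul_smul, Matrix.smul_mul, Matrix.mul_one,
            adjugate_mul_of_det_eq_one (hRdet t x hx)]
        · simp only [Matrix.mul_sum, Matrix.sum_mul, Matrix.mul_smul, Matrix.smul_mul]
      have h2 := congrArg (slCoord i) (eq_halfTr_add_sum x)
      simp only [map_add, map_smul, map_sum, slCoord_one_matrix, smul_eq_mul, mul_zero,
        zero_add] at h2
      rw [h1]
      simp only [map_add, map_smul, map_sum, slCoord_scalarPart, smul_eq_mul, zero_add, mul_sub,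
        Finset.sum_sub_distrib]
      rw [← h2]
      ring)
  refine ⟨V, hVU, hVo, hVs, fun t x => R t x * g t x, (hR.mono hVU).matMul hg, ?_, ?_⟩
  · intro t x hx
    rw [Matrix.det_mul, hRdet t x (hVU hx), hgdet t x hx, one_mul]
  · intro t x hx
    have h1 := congrArg (fun y => R t x * y) (hgconj t x hx)
    simp only [← Matrix.mul_assoc, mul_adjugate_of_det_eq_one (hRdet t x (hVU hx)),
      Matrix.one_mul] at h1
    rw [← Matrix.mul_assoc, h1]

end Assembly

/-- If the conjugations `x ↦ pₙ(x) x pₙ(x)⁻¹` (with `det pₙ = 1`) converge locally uniformly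
on a neighborhood `W` of `𝒯`, then on a possibly smaller neighborhood `U` of `𝒯` the maps `pₙ`
can be corrected by factors `aₙ(x)·I + bₙ(x)·x` of determinant one so that
`pₙ(x)(aₙ(x)·I + bₙ(x)·x)` converges locally uniformly. -/
theorem limit_of_conjugations_correction
    (W : Set M2) (hWopen : IsOpen W) (hTW : NonCyclic ⊆ W) (hWΩ : W ⊆ SpectralBall)
    (p : ℕ → M2 → M2)
    (hp : ∀ n, DifferentiableOn ℂ (p n) W)
    (hpdet : ∀ n, ∀ x ∈ W, (p n x).det = 1)
    (ψ : M2 → M2) (hψ : DifferentiableOn ℂ ψ W) (hψΩ : MapsTo ψ W SpectralBall)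
    (hconv : ∀ K ⊆ W, IsCompact K →
      TendstoUniformlyOn (fun n x => p n x * x * (p n x)⁻¹) ψ Filter.atTop K) :
    ∃ U : Set M2, IsOpen U ∧ NonCyclic ⊆ U ∧ U ⊆ W ∧
      ∃ a b : ℕ → M2 → ℂ,
        (∀ n, DifferentiableOn ℂ (a n) U) ∧ (∀ n, DifferentiableOn ℂ (b n) U) ∧
        (∀ n, ∀ x ∈ U, (a n x • (1 : M2) + b n x • x).det = 1) ∧
        ∃ u : M2 → M2, DifferentiableOn ℂ u U ∧ (∀ x ∈ U, (u x).det = 1) ∧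
          ∀ K ⊆ U, IsCompact K →
            TendstoUniformlyOn (fun n x => p n x * (a n x • (1 : M2) + b n x • x)) u
              Filter.atTop K := by
  have hadj : ∀ n, ∀ x ∈ W, (p n x)⁻¹ = (p n x).adjugate := fun n x hx => by
    rw [Matrix.inv_def, hpdet n x hx, Ring.inverse_one, one_smul]
  obtain ⟨U, hUW, hU, hUs⟩ := exists_projStable hWopen
  have hp' : ∀ n, DifferentiableOn ℂ (p n) U := fun n => (hp n).mono hUW
  have hpdet' : ∀ n, ∀ x ∈ U, (p n x).det = 1 := fun n x hx => hpdet n x (hUW hx)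
  have hU1 : ∀ l : ℂ, l • (1 : M2) ∈ U ↔ ‖l‖ < 1 := fun l =>
    ⟨fun h => norm_lt_one_of_smul_one_mem (hWΩ (hUW h)), fun h => hUs l (hTW ⟨l, h, rfl⟩)⟩
  have hpfam : ∀ n, HolFam U fun _ : Unit => p n := fun n => HolFam.of_differentiableOn (hp' n)
  have hidfam : HolFam U fun (_ : Unit) (x : M2) => x :=
    HolFam.of_differentiableOn differentiableOn_id
  have hφd : ∀ n, DifferentiableOn ℂ (fun x => p n x * x * (p n x)⁻¹) U := fun n =>
    ((((hpfam n).matMul hidfam).matMul (hpfam n).adjugate).diff ()).congr fun x hx => by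
      rw [hadj n x (hUW hx)]
  have hφ : HolFam U (withLimit (fun n x => p n x * x * (p n x)⁻¹) ψ) :=
    HolFam.withLimit hU.isOpen hφd (hψ.mono hUW) fun K hK hKc => hconv K (hK.trans hUW) hKc
  obtain ⟨V, hVU, hVo, hVs, h, hh, hhdet, hhconj⟩ :=
    exists_convergent_conjugators hU hU1 hp' hpdet' hφ fun n x hx => by
      rw [← hadj n x (hUW hx)]; rfl
  have hcomm : ∀ n : ℕ, ∀ x ∈ V, (p n x).adjugate * h n x * x = x * ((p n x).adjugate * h n x) := by
    intro n x hx
    have h1 : p n x * x * (p n x)⁻¹ * h n x = h n x * x := hhconj n x hx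
    rw [hadj n x (hUW (hVU hx))] at h1
    rw [Matrix.mul_assoc, ← h1]
    simp only [← Matrix.mul_assoc, adjugate_mul_of_det_eq_one (hpdet' n x (hVU hx)),
      Matrix.one_mul]
  have hkd : ∀ n : ℕ, DifferentiableOn ℂ (fun x => (p n x).adjugate * h n x) V := fun n =>
    (((hpfam n).mono hVU).adjugate.matMul
      (HolFam.of_differentiableOn (T := Unit) (hh.diff n))).diff ()
  choose a b ha hb hab using fun n => exists_eq_add_smul_of_commute hVo (hkd n) (hcomm n)
  refine ⟨V, hVo, ?_, hVU.trans hUW, a, b, ha, hb, ?_, h OnePoint.infty, hh.diff _, hhdet _, ?_⟩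
  · rintro _ ⟨l, hl, rfl⟩
    exact hVs l ((hU1 l).2 hl)
  · intro n x hx
    rw [← hab n x hx, Matrix.det_mul, det_adjugate_of_det_eq_one (hpdet' n x (hVU hx)),
      hhdet n x hx, one_mul]
  · intro K hK hKc
    refine (tendstoUniformlyOn_of_continuousOn hVo hh.cont hK hKc).congr
      (Filter.Eventually.of_forall fun n x hx => ?_)
    have h1 : p n x * (a n x • (1 : M2) + b n x • x) = h n x := by
      rw [← hab n x (hK hx), ← Matrix.mul_assoc,
        mul_adjugate_of_det_eq_one (hpdet' n x (hVU (hK hx))), Matrix.one_mul]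
    exact h1.symm
end
end

section
/- Let W be an open set with 𝒯 ⊆ W ⊆ Ω and let p_n : W → M₂(ℂ) be a sequence of holomorphic maps with det p_n(x) = 1 for all x ∈ W, such that the maps φ_n(x) := p_n(x) x p_n(x)⁻¹ converge uniformly on compact subsets of W to a holomorphic map ψ : W → Ω. Then ψ is a holomorphic conjugation in a neighborhood of 𝒯: there exist an open neighborhood U of 𝒯 with U ⊆ W and a holomorphic map u : U → GL₂(ℂ) such that ψ(x) = u(x) · x · u(x)⁻¹ for all x ∈ U. -/
open Matrix Set

attribute [local instance] Matrix.normedAddCommGroup Matrix.normedSpace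

noncomputable section

open Filter Metric Topology MeasureTheory

section Division

variable {E : Type*} [NormedAddCommGroup E] [NormedSpace ℂ E] [FiniteDimensional ℂ E]

/-- Circle averages in a fixed direction of a holomorphic function are holomorphic in the center,
even if the function is only holomorphic near the circle. -/
lemma differentiableAt_circleAverage_line {h : E → ℂ} {O : Set E} (hO : IsOpen O)
    (hh : DifferentiableOn ℂ h O) (e x₀ : E) (r : ℝ)
    (hx₀ : ∀ ζ ∈ sphere (0 : ℂ) |r|, x₀ + ζ • e ∈ O) :
    DifferentiableAt ℂ (fun x => Real.circleAverage (fun ζ => h (x + ζ • e)) 0 r) x₀ := by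
  borelize E
  have : ProperSpace E := FiniteDimensional.proper ℂ E
  set S : Set E := (fun ζ : ℂ => x₀ + ζ • e) '' sphere 0 |r| with hS
  have hScomp : IsCompact S := (isCompact_sphere 0 |r|).image (by fun_prop)
  have hSO : S ⊆ O := by
    rintro _ ⟨ζ, hζ, rfl⟩
    exact hx₀ ζ hζ
  obtain ⟨δ, hδ, hδO⟩ := hScomp.exists_cthickening_subset_open hO hSO
  have hK : IsCompact (cthickening δ S) := hScomp.cthickening
  obtain ⟨C, hC⟩ := hK.exists_bound_of_continuousOn (hh.continuousOn.mono hδO)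
  have hmem : ∀ θ : ℝ, x₀ + circleMap 0 r θ • e ∈ S := fun θ =>
    ⟨_, circleMap_mem_sphere' 0 r θ, rfl⟩
  have hball : ∀ θ : ℝ, ball (x₀ + circleMap 0 r θ • e) δ ⊆ cthickening δ S := fun θ y hy =>
    mem_cthickening_of_dist_le y _ δ S (hmem θ) (mem_ball.1 hy).le
  have hadd : ∀ (θ : ℝ), ∀ x ∈ ball x₀ δ,
      x + circleMap 0 r θ • e ∈ ball (x₀ + circleMap 0 r θ • e) δ := by
    intro θ x hx
    simpa [mem_ball, dist_eq_norm] using hx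
  have hcont : ∀ x ∈ ball x₀ δ, Continuous fun θ : ℝ => h (x + circleMap 0 r θ • e) := by
    intro x hx
    exact hh.continuousOn.comp_continuous (by fun_prop)
      fun θ => hδO (hball θ (hadd θ x hx))
  have key := hasFDerivAt_integral_of_dominated_loc_of_lip' (𝕜 := ℂ)
    (μ := volume.restrict (Ioc 0 (2 * Real.pi))) (s := ball x₀ δ)
    (F := fun x θ => h (x + circleMap 0 r θ • e))
    (F' := fun θ => fderiv ℂ h (x₀ + circleMap 0 r θ • e))
    (bound := fun _ => (2 * C) / δ) (x₀ := x₀) (ball_mem_nhds x₀ hδ)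
    (fun x hx => (hcont x hx).aestronglyMeasurable)
    (((hcont x₀ (mem_ball_self hδ)).integrableOn_Icc).mono_set Ioc_subset_Icc_self)
    (by
      apply Measurable.aestronglyMeasurable
      exact (measurable_fderiv ℂ h).comp
        (by fun_prop : Continuous fun θ : ℝ => x₀ + circleMap 0 r θ • e).measurable)
    (by
      refine Eventually.of_forall fun θ x hx => ?_
      have hmaps : MapsTo h (ball (x₀ + circleMap 0 r θ • e) δ)
          (closedBall (h (x₀ + circleMap 0 r θ • e)) (2 * C)) := by
        intro y hy
        rw [mem_closedBall, dist_eq_norm]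
        calc _ ≤ ‖h y‖ + ‖h (x₀ + circleMap 0 r θ • e)‖ := norm_sub_le _ _
          _ ≤ C + C := add_le_add (hC _ (hball θ hy)) (hC _ (hball θ (mem_ball_self hδ)))
          _ = 2 * C := by ring
      have := Complex.dist_le_div_mul_dist_of_mapsTo_ball
        (hh.mono ((hball θ).trans hδO)) hmaps (hadd θ x hx)
      simpa [dist_eq_norm] using this)
    (integrable_const _)
    (by
      refine Eventually.of_forall fun θ => ?_
      have h1 : HasFDerivAt h (fderiv ℂ h (x₀ + circleMap 0 r θ • e))
          (x₀ + circleMap 0 r θ • e) :=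
        (hh.differentiableAt (hO.mem_nhds (hSO (hmem θ)))).hasFDerivAt
      simpa using! h1.comp x₀ ((hasFDerivAt_id x₀).add_const (circleMap 0 r θ • e)))
  have h2 := key.2.differentiableAt
  have h3 : (fun x => Real.circleAverage (fun ζ => h (x + ζ • e)) 0 r) =
      fun x => ((2 * Real.pi : ℝ)⁻¹ : ℂ) •
        ∫ θ in Ioc 0 (2 * Real.pi), h (x + circleMap 0 r θ • e) := by
    funext x
    rw [Real.circleAverage_def, intervalIntegral.integral_of_le Real.two_pi_pos.le]
    simp
  rw [h3]
  exact h2.fun_const_smul _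

/-- Removable singularities along a complex hyperplane, for functions that are holomorphic
on complex lines transverse to the hyperplane. -/
lemma differentiableOn_of_line_of_off_hyperplane {h : E → ℂ} {D : Set E} (hD : IsOpen D)
    {ℓ : E →L[ℂ] ℂ} {e : E} (he : ℓ e = 1)
    (hoff : ∀ x ∈ D, ℓ x ≠ 0 → DifferentiableAt ℂ h x)
    (hline : ∀ x ∈ D, DifferentiableAt ℂ (fun t : ℂ => h (x + t • e)) 0) :
    DifferentiableOn ℂ h D := by
  intro x₀ hx₀
  by_cases h0 : ℓ x₀ = 0
  swap
  · exact (hoff x₀ hx₀ h0).differentiableWithinAt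
  have he0 : e ≠ 0 := by rintro rfl; simp at he
  have hen : 0 < ‖e‖ := norm_pos_iff.2 he0
  obtain ⟨ρ, hρ, hρD⟩ := Metric.isOpen_iff.1 hD x₀ hx₀
  set r : ℝ := ρ / 4 / ‖e‖ with hr
  have hrpos : 0 < r := by positivity
  have hre : r * ‖e‖ = ρ / 4 := by rw [hr]; field_simp
  have hin : ∀ x ∈ ball x₀ (ρ / 2), ∀ ζ ∈ closedBall (0 : ℂ) r, x + ζ • e ∈ D := by
    intro x hx ζ hζ
    apply hρD
    rw [mem_ball, dist_eq_norm] at hx ⊢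
    rw [mem_closedBall_zero_iff] at hζ
    calc ‖x + ζ • e - x₀‖ = ‖(x - x₀) + ζ • e‖ := by congr 1; abel
      _ ≤ ‖x - x₀‖ + ‖ζ • e‖ := norm_add_le _ _
      _ = ‖x - x₀‖ + ‖ζ‖ * ‖e‖ := by rw [norm_smul]
      _ ≤ ‖x - x₀‖ + r * ‖e‖ := by gcongr
      _ < ρ := by rw [hre]; linarith
  have hmean : ∀ x ∈ ball x₀ (ρ / 2),
      Real.circleAverage (fun ζ => h (x + ζ • e)) 0 r = h x := by
    intro x hx
    have hd : ∀ ζ ∈ closedBall (0 : ℂ) r, DifferentiableAt ℂ (fun t : ℂ => h (x + t • e)) ζ := by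
      intro ζ hζ
      have h1 := hline _ (hin x hx ζ hζ)
      have h2 : DifferentiableAt ℂ
          ((fun t : ℂ => h (x + ζ • e + t • e)) ∘ fun t : ℂ => t - ζ) ζ :=
        DifferentiableAt.comp ζ (by simpa using h1) (by fun_prop)
      convert h2 using 2 with t
      simp [sub_smul]
    have hdc : DiffContOnCl ℂ (fun t : ℂ => h (x + t • e)) (ball 0 |r|) := by
      apply DifferentiableOn.diffContOnCl
      rw [abs_of_pos hrpos, closure_ball _ hrpos.ne']
      exact fun ζ hζ => (hd ζ hζ).differentiableWithinAt
    have := hdc.circleAverage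
    simpa using this
  have hda := differentiableAt_circleAverage_line (h := h) (O := D ∩ {x | ℓ x ≠ 0})
    (hD.inter (isOpen_ne_fun ℓ.continuous continuous_const))
    (fun x hx => (hoff x hx.1 hx.2).differentiableWithinAt) e x₀ r (by
      intro ζ hζ
      rw [abs_of_pos hrpos] at hζ
      refine ⟨hin x₀ (mem_ball_self (by positivity)) ζ (sphere_subset_closedBall hζ), ?_⟩
      have : ζ ≠ 0 := ne_of_mem_sphere hζ hrpos.ne'
      simpa [h0, he] using this)
  apply DifferentiableAt.differentiableWithinAt
  refine hda.congr_of_eventuallyEq ?_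
  filter_upwards [ball_mem_nhds x₀ (half_pos hρ)] with x hx
  exact (hmean x hx).symm

/-- A holomorphic function vanishing on a hyperplane is holomorphically divisible by the linear
form that defines it. -/
lemma exists_eq_mul_of_vanish {g : E → ℂ} {D : Set E} (hD : IsOpen D)
    (hg : DifferentiableOn ℂ g D) {ℓ : E →L[ℂ] ℂ} {e : E} (he : ℓ e = 1)
    (hv : ∀ x ∈ D, ℓ x = 0 → g x = 0) :
    ∃ h : E → ℂ, DifferentiableOn ℂ h D ∧ ∀ x ∈ D, g x = ℓ x * h x := by
  classical
  let h : E → ℂ := fun x => if ℓ x = 0 then fderiv ℂ g x e else g x / ℓ x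
  have hoff : ∀ x ∈ D, ℓ x ≠ 0 → DifferentiableAt ℂ h x := by
    intro x hx hx0
    have h1 : DifferentiableAt ℂ (fun x => g x / ℓ x) x := by
      simp only [div_eq_mul_inv]
      exact (hg.differentiableAt (hD.mem_nhds hx)).mul (ℓ.differentiableAt.inv hx0)
    refine h1.congr_of_eventuallyEq ?_
    filter_upwards [(isOpen_ne_fun ℓ.continuous continuous_const).mem_nhds hx0] with y hy
    exact if_neg hy
  refine ⟨h, differentiableOn_of_line_of_off_hyperplane hD he hoff ?_, ?_⟩
  · intro x hx
    by_cases hx0 : ℓ x = 0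
    · let L : ℂ → E := fun t => x + t • e
      have hL : HasDerivAt L e 0 := by
        have h2 := ((hasDerivAt_id (0 : ℂ)).smul_const e).const_add x
        rwa [one_smul] at h2
      have hLD : L ⁻¹' D ∈ 𝓝 (0 : ℂ) :=
        hL.continuousAt.preimage_mem_nhds (hD.mem_nhds (by simpa [L] using hx))
      have hgL : DifferentiableOn ℂ (g ∘ L) (L ⁻¹' D) :=
        hg.comp (by fun_prop) (mapsTo_preimage L D)
      have h1 : DifferentiableAt ℂ (dslope (g ∘ L) 0) 0 :=
        ((Complex.differentiableOn_dslope hLD).2 hgL).differentiableAt hLD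
      have hg0 : g x = 0 := hv x hx hx0
      have hgd : HasFDerivAt g (fderiv ℂ g x) (L 0) := by
        simpa [L] using (hg.differentiableAt (hD.mem_nhds hx)).hasFDerivAt
      convert h1 using 2 with t
      rcases eq_or_ne t 0 with rfl | ht
      · simp [dslope_same, h, hx0, (hgd.comp_hasDerivAt 0 hL).deriv]
      · simp [dslope_of_ne _ ht, slope_def_field, h, hx0, he, ht, L, hg0]
    · have h1 := hoff x hx hx0
      exact DifferentiableAt.comp (g := h) (f := fun t : ℂ => x + t • e) (0 : ℂ)
        (by simpa using h1) (by fun_prop)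
  · intro x hx
    by_cases hx0 : ℓ x = 0
    · simp [hx0, hv x hx hx0]
    · simp only [h, if_neg hx0]
      field_simp

end Division

section Koszul

variable {E : Type*} [NormedAddCommGroup E] [NormedSpace ℂ E]

/-- Division by a coordinate of the difference between a function and its restriction to the
coordinate hyperplane. -/
lemma exists_eq_restrict_add_mul [FiniteDimensional ℂ E] {g : E → ℂ} {D : Set E} (hD : IsOpen D)
    (hg : DifferentiableOn ℂ g D) {ℓ : E →L[ℂ] ℂ} {e : E} (he : ℓ e = 1)
    (hDe : ∀ x ∈ D, x - ℓ x • e ∈ D) :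
    ∃ h : E → ℂ, DifferentiableOn ℂ h D ∧ ∀ x ∈ D, g x = g (x - ℓ x • e) + ℓ x * h x := by
  have hr : DifferentiableOn ℂ (fun x => g (x - ℓ x • e)) D :=
    hg.comp (f := fun x => x - ℓ x • e)
      (by fun_prop) hDe
  obtain ⟨h, hh, hgh⟩ := exists_eq_mul_of_vanish hD (hg.sub hr) he (by
    intro x _ hx
    simp [hx])
  refine ⟨h, hh, fun x hx => ?_⟩
  rw [← hgh x hx]
  simp

/-- A continuous function vanishes at a point if it vanishes nearby on a punctured line. -/
lemma eq_zero_of_line_mul_eq_zero {F : E → ℂ} {D : Set E} (hD : IsOpen D)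
    (hF : ContinuousOn F D) {ℓ : E →L[ℂ] ℂ} {e : E} (he : ℓ e = 1) {w : E} (hw : w ∈ D)
    (h : ∀ t : ℂ, w + t • e ∈ D → ℓ (w + t • e) * F (w + t • e) = 0) : F w = 0 := by
  by_cases hw0 : ℓ w = 0
  swap
  · have h0 := h 0 (by simpa using hw)
    simp only [zero_smul, add_zero] at h0
    exact (mul_eq_zero.1 h0).resolve_left hw0
  have hL : Tendsto (fun t : ℂ => w + t • e) (𝓝[≠] 0) (𝓝 w) := by
    have : Tendsto (fun t : ℂ => w + t • e) (𝓝 0) (𝓝 (w + (0 : ℂ) • e)) :=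
      Continuous.tendsto (by fun_prop) 0
    rw [zero_smul, add_zero] at this
    exact this.mono_left nhdsWithin_le_nhds
  have h1 : Tendsto (fun t : ℂ => F (w + t • e)) (𝓝[≠] 0) (𝓝 (F w)) :=
    (hF.continuousAt (hD.mem_nhds hw)).tendsto.comp hL
  refine tendsto_nhds_unique_of_eventuallyEq h1 tendsto_const_nhds ?_
  filter_upwards [hL.eventually (hD.mem_nhds hw), self_mem_nhdsWithin] with t ht ht0
  have := h t ht
  simp only [map_add, map_smul, hw0, he, smul_eq_mul, mul_one, zero_add] at this
  exact (mul_eq_zero.1 this).resolve_left ht0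

variable {D : Set E} {ℓ : Fin 3 → E →L[ℂ] ℂ} {e : Fin 3 → E}

/-- A holomorphic function vanishing where three coordinates vanish is a holomorphic combination
of these coordinates. -/
lemma exists_eq_sum_coord_mul [FiniteDimensional ℂ E] {g : E → ℂ} (hD : IsOpen D)
    (hg : DifferentiableOn ℂ g D)
    (he : ∀ i j, ℓ i (e j) = if i = j then 1 else 0)
    (hDe : ∀ i, ∀ x ∈ D, x - ℓ i x • e i ∈ D)
    (hv : ∀ x ∈ D, (∀ i, ℓ i x = 0) → g x = 0) :
    ∃ h : Fin 3 → E → ℂ, (∀ i, DifferentiableOn ℂ (h i) D) ∧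
      ∀ x ∈ D, g x = h 0 x * ℓ 0 x + h 1 x * ℓ 1 x + h 2 x * ℓ 2 x := by
  have hr : ∀ (i : Fin 3) (k : E → ℂ), DifferentiableOn ℂ k D →
      DifferentiableOn ℂ (fun x => k (x - ℓ i x • e i)) D := fun i k hk =>
    hk.comp (f := fun x => x - ℓ i x • e i)
      (by fun_prop) (hDe i)
  obtain ⟨h₀, hd₀, h₀e⟩ := exists_eq_restrict_add_mul hD hg (by simp [he]) (hDe 0)
  obtain ⟨h₁, hd₁, h₁e⟩ := exists_eq_restrict_add_mul hD (hr 0 _ hg) (by simp [he]) (hDe 1)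
  obtain ⟨h₂, hd₂, h₂e⟩ :=
    exists_eq_restrict_add_mul hD (hr 1 _ (hr 0 _ hg)) (by simp [he]) (hDe 2)
  refine ⟨![h₀, h₁, h₂], ?_, fun x hx => ?_⟩
  · intro i
    fin_cases i <;> assumption
  · have h3 := hv _ (hDe 0 _ (hDe 1 _ (hDe 2 x hx))) (by
      intro i
      fin_cases i <;> simp [he])
    rw [h₀e x hx, h₁e x hx, h₂e x hx, h3]
    simp
    ring

/-- Exactness of the Koszul complex of three coordinates in the middle: a holomorphic vector
field orthogonal to the radial one is a cross product with it. -/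
lemma exists_eq_cross_coord [FiniteDimensional ℂ E] {f : Fin 3 → E → ℂ} (hD : IsOpen D)
    (hf : ∀ i, DifferentiableOn ℂ (f i) D)
    (he : ∀ i j, ℓ i (e j) = if i = j then 1 else 0)
    (hDe : ∀ i, ∀ x ∈ D, x - ℓ i x • e i ∈ D)
    (hv : ∀ x ∈ D, f 0 x * ℓ 0 x + f 1 x * ℓ 1 x + f 2 x * ℓ 2 x = 0) :
    ∃ v : Fin 3 → E → ℂ, (∀ i, DifferentiableOn ℂ (v i) D) ∧ ∀ x ∈ D,
      f 0 x = v 1 x * ℓ 2 x - v 2 x * ℓ 1 x ∧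
      f 1 x = v 2 x * ℓ 0 x - v 0 x * ℓ 2 x ∧
      f 2 x = v 0 x * ℓ 1 x - v 1 x * ℓ 0 x := by
  have hr : ∀ (i : Fin 3) (k : E → ℂ), DifferentiableOn ℂ k D →
      DifferentiableOn ℂ (fun x => k (x - ℓ i x • e i)) D := fun i k hk =>
    hk.comp (f := fun x => x - ℓ i x • e i)
      (by fun_prop) (hDe i)
  obtain ⟨A, hA, hAe⟩ := exists_eq_restrict_add_mul hD (hf 2) (by simp [he]) (hDe 0)
  obtain ⟨B, hB, hBe⟩ := exists_eq_restrict_add_mul hD (hr 0 _ (hf 2)) (by simp [he]) (hDe 1)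
  have h2 : ∀ x ∈ D, f 2 x = ℓ 0 x * A x + ℓ 1 x * B x := by
    intro x hx
    have h0 : f 2 (x - ℓ 1 x • e 1 - ℓ 0 (x - ℓ 1 x • e 1) • e 0) = 0 := by
      refine eq_zero_of_line_mul_eq_zero hD (hf 2).continuousOn (ℓ := ℓ 2) (e := e 2)
        (by simp [he]) (hDe 0 _ (hDe 1 _ hx)) fun t ht => ?_
      have := hv _ ht
      simp only [map_add, map_sub, map_smul, he, smul_eq_mul] at this ⊢
      simp at this ⊢
      tauto
    rw [hAe x hx, hBe x hx, h0]
    ring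
  have hF1 : DifferentiableOn ℂ (fun x => f 1 x + B x * ℓ 2 x) D :=
    (hf 1).add (hB.mul (ℓ 2).differentiable.differentiableOn)
  obtain ⟨C, hC, hCe⟩ := exists_eq_restrict_add_mul hD hF1 (by simp [he]) (hDe 0)
  have h1 : ∀ x ∈ D, f 1 x + B x * ℓ 2 x = ℓ 0 x * C x := by
    intro x hx
    have h0 : (fun x => f 1 x + B x * ℓ 2 x) (x - ℓ 0 x • e 0) = 0 := by
      refine eq_zero_of_line_mul_eq_zero hD hF1.continuousOn (ℓ := ℓ 1) (e := e 1)
        (by simp [he]) (hDe 0 _ hx) fun t ht => ?_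
      have h3 := hv _ ht
      have h4 := h2 _ ht
      have h5 : ℓ 0 (x - ℓ 0 x • e 0 + t • e 1) = 0 := by simp [he]
      rw [h4, h5] at h3
      linear_combination h3
    have h3 := hCe x hx
    simp only at h0 h3
    rw [h3, h0, zero_add]
  have h0 : ∀ x ∈ D, f 0 x + A x * ℓ 2 x + C x * ℓ 1 x = 0 := by
    intro x hx
    refine eq_zero_of_line_mul_eq_zero (F := fun x => f 0 x + A x * ℓ 2 x + C x * ℓ 1 x) hD
      (((hf 0).add (hA.mul (ℓ 2).differentiable.differentiableOn)).add
        (hC.mul (ℓ 1).differentiable.differentiableOn)).continuousOn (ℓ := ℓ 0) (e := e 0)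
      (by simp [he]) hx fun t ht => ?_
    linear_combination hv _ ht - ℓ 2 (x + t • e 0) * h2 _ ht - ℓ 1 (x + t • e 0) * h1 _ ht
  refine ⟨![B, -A, C], ?_, fun x hx => ⟨?_, ?_, ?_⟩⟩
  · intro i
    fin_cases i
    exacts [hB, hA.neg, hC]
  · simp
    linear_combination h0 x hx
  · simp
    linear_combination h1 x hx
  · simp
    linear_combination h2 x hx

end Koszul

section Intertwiner

variable {E : Type*} [NormedAddCommGroup E] [NormedSpace ℂ E]

/-- The derivative at `0` of `t ↦ t * G t` is `G 0` as soon as `G` is continuous. -/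
lemma hasDerivAt_id_smul_zero {F : Type*} [NormedAddCommGroup F] [NormedSpace ℂ F] {G : ℂ → F}
    (hG : ContinuousAt G 0) : HasDerivAt (fun t => t • G t) (G 0) 0 := by
  rw [hasDerivAt_iff_tendsto_slope]
  refine (hG.tendsto.mono_left nhdsWithin_le_nhds).congr' ?_
  filter_upwards [self_mem_nhdsWithin] with t ht
  have : t ≠ 0 := ht
  simp [slope_def_module, smul_smul, this]

/-- If `f (x + t • e) = t * G (x + t • e)` with `G` continuous at `x`, then the derivative of `f`
at `x` in direction `e` is `G x`. -/
lemma eq_of_line_eq_mul {f G : E → ℂ} {x e : E} {c : ℂ} (hG : ContinuousAt G x)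
    (hf : HasDerivAt (fun t : ℂ => f (x + t • e)) c 0)
    (h : ∀ᶠ t in 𝓝 (0 : ℂ), f (x + t • e) = t * G (x + t • e)) : G x = c := by
  have hc : ContinuousAt (fun t : ℂ => G (x + t • e)) 0 :=
    ContinuousAt.comp (g := G) (f := fun t : ℂ => x + t • e) (by simpa using hG) (by fun_prop)
  have h1 := (hasDerivAt_id_smul_zero hc).congr_of_eventuallyEq h
  simpa using h1.unique hf

/-- A holomorphic map `η` to traceless matrices that preserves the determinant and is tangent to
the coordinate map `ℓ` where `ℓ` vanishes is holomorphically conjugate to `ℓ` near that set. -/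
lemma exists_intertwiner [FiniteDimensional ℂ E] {D : Set E} {ℓ : Fin 3 → E →L[ℂ] ℂ}
    {e : Fin 3 → E} {η : Fin 3 → E → ℂ} (hD : IsOpen D)
    (hη : ∀ i, DifferentiableOn ℂ (η i) D)
    (he : ∀ i j, ℓ i (e j) = if i = j then 1 else 0)
    (hDe : ∀ i, ∀ x ∈ D, x - ℓ i x • e i ∈ D)
    (hQ : ∀ x ∈ D, η 0 x ^ 2 + η 1 x * η 2 x = ℓ 0 x ^ 2 + ℓ 1 x * ℓ 2 x)
    (hz : ∀ x ∈ D, (∀ i, ℓ i x = 0) → ∀ i, η i x = 0)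
    (hder : ∀ x ∈ D, (∀ i, ℓ i x = 0) → ∀ i j,
      HasDerivAt (fun t : ℂ => η i (x + t • e j)) (if i = j then 1 else 0) 0) :
    ∃ (d : E → ℂ) (s : Fin 3 → E → ℂ), DifferentiableOn ℂ d D ∧
      (∀ i, DifferentiableOn ℂ (s i) D) ∧
      (∀ x ∈ D, (∀ i, ℓ i x = 0) → d x = 1 ∧ ∀ i, s i x = 0) ∧
      ∀ x ∈ D, d x ≠ 0 →
        !![η 0 x, η 1 x; η 2 x, -η 0 x] * !![d x + s 0 x, s 1 x; s 2 x, d x - s 0 x] =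
        !![d x + s 0 x, s 1 x; s 2 x, d x - s 0 x] * !![ℓ 0 x, ℓ 1 x; ℓ 2 x, -ℓ 0 x] := by
  have hlin : ∀ x ∈ D, ∀ j, ∀ᶠ t in 𝓝 (0 : ℂ), x + t • e j ∈ D := by
    intro x hx j
    have hc : ContinuousAt (fun t : ℂ => x + t • e j) 0 := by fun_prop
    exact hc.eventually (hD.mem_nhds (by simpa using hx))
  choose M hM hMe using fun i =>
    exists_eq_sum_coord_mul hD (hη i) he hDe (fun x hx h => hz x hx h i)
  have hM1 : ∀ x ∈ D, (∀ i, ℓ i x = 0) → ∀ i j, M i j x = if i = j then 1 else 0 := by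
    intro x hx h i j
    refine eq_of_line_eq_mul ((hM i j).continuousOn.continuousAt (hD.mem_nhds hx))
      (hder x hx h i j) ?_
    filter_upwards [hlin x hx j] with t ht
    rw [hMe i _ ht]
    fin_cases j <;> simp [he, h] <;> ring
  let N : Fin 3 → Fin 3 → E → ℂ := fun i j x => (M i j x + if i = j then 1 else 0) / 2
  have hN : ∀ i j, DifferentiableOn ℂ (N i j) D := fun i j => by
    simp only [N, div_eq_mul_inv]
    exact ((hM i j).add_const _).mul_const _
  have hN1 : ∀ x ∈ D, (∀ i, ℓ i x = 0) → ∀ i j, N i j x = if i = j then 1 else 0 := by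
    intro x hx h i j
    simp only [N, hM1 x hx h i j]
    split_ifs <;> norm_num
  have hNz : ∀ x ∈ D, ∀ i, (η i x + ℓ i x) / 2 =
      N i 0 x * ℓ 0 x + N i 1 x * ℓ 1 x + N i 2 x * ℓ 2 x := by
    intro x hx i
    rw [hMe i x hx]
    fin_cases i <;> simp [N] <;> ring
  let q : Fin 3 → E → ℂ := ![fun x => η 0 x - ℓ 0 x, fun x => (η 2 x - ℓ 2 x) / 2,
    fun x => (η 1 x - ℓ 1 x) / 2]
  have hq : ∀ i, DifferentiableOn ℂ (q i) D := by
    have := fun i => (hη i).sub (ℓ i).differentiable.differentiableOn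
    intro i
    fin_cases i
    · exact this 0
    · simpa [q, div_eq_mul_inv] using! (this 2).mul_const (2⁻¹ : ℂ)
    · simpa [q, div_eq_mul_inv] using! (this 1).mul_const (2⁻¹ : ℂ)
  have hqd : ∀ x ∈ D, (∀ i, ℓ i x = 0) → ∀ i j,
      HasDerivAt (fun t : ℂ => q i (x + t • e j)) 0 0 := by
    intro x hx h i j
    have h1 : ∀ i, HasDerivAt (fun t : ℂ => η i (x + t • e j) - ℓ i (x + t • e j)) 0 0 := by
      intro i
      have h2 : HasDerivAt (fun t : ℂ => ℓ i (x + t • e j)) (if i = j then 1 else 0) 0 := by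
        simp only [map_add, map_smul, he, h, zero_add, smul_eq_mul]
        simpa using! (hasDerivAt_id (0 : ℂ)).mul_const (if i = j then (1 : ℂ) else 0)
      simpa using! (hder x hx h i j).sub h2
    fin_cases i
    · exact h1 0
    · simpa only [zero_div] using! (h1 2).div_const 2
    · simpa only [zero_div] using! (h1 1).div_const 2
  have hq0 : ∀ x ∈ D, (∀ i, ℓ i x = 0) → ∀ i, q i x = 0 := by
    intro x hx h i
    fin_cases i <;> simp [q, h, hz x hx h]
  let f : Fin 3 → E → ℂ := fun i x => N 0 i x * q 0 x + N 1 i x * q 1 x + N 2 i x * q 2 x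
  have hf : ∀ i, DifferentiableOn ℂ (f i) D := fun i =>
    (((hN 0 i).mul (hq 0)).add ((hN 1 i).mul (hq 1))).add ((hN 2 i).mul (hq 2))
  have hfd : ∀ x ∈ D, (∀ i, ℓ i x = 0) → ∀ i j,
      HasDerivAt (fun t : ℂ => f i (x + t • e j)) 0 0 := by
    intro x hx h i j
    have h1 : ∀ a, HasDerivAt (fun t : ℂ => N a i (x + t • e j) * q a (x + t • e j)) 0 0 := by
      intro a
      have h2 : DifferentiableAt ℂ (fun t : ℂ => N a i (x + t • e j)) 0 :=
        DifferentiableAt.comp (g := N a i) (f := fun t : ℂ => x + t • e j) 0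
          (by simpa using (hN a i).differentiableAt (hD.mem_nhds hx)) (by fun_prop)
      have h3 := h2.hasDerivAt.mul (hqd x hx h a j)
      simpa [hq0 x hx h a] using! h3
    simpa using! ((h1 0).add (h1 1)).add (h1 2)
  have hfe : ∀ x ∈ D, f 0 x * ℓ 0 x + f 1 x * ℓ 1 x + f 2 x * ℓ 2 x = 0 := by
    intro x hx
    have h0 := hNz x hx 0
    have h1 := hNz x hx 1
    have h2 := hNz x hx 2
    simp only [f, q, Matrix.cons_val_zero, Matrix.cons_val_one, Matrix.cons_val]
    linear_combination (1 / 2 : ℂ) * hQ x hx - (η 0 x - ℓ 0 x) * h0 -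
      (η 2 x - ℓ 2 x) / 2 * h1 - (η 1 x - ℓ 1 x) / 2 * h2
  obtain ⟨v, hv, hvf⟩ := exists_eq_cross_coord hD hf he hDe hfe
  have hv0 : ∀ x ∈ D, (∀ i, ℓ i x = 0) → ∀ i, v i x = 0 := by
    intro x hx h
    have key : ∀ i j (G : E → ℂ), DifferentiableOn ℂ G D →
        (∀ t : ℂ, x + t • e j ∈ D → f i (x + t • e j) = t * G (x + t • e j)) → G x = 0 := by
      intro i j G hG hfG
      refine eq_of_line_eq_mul (hG.continuousOn.continuousAt (hD.mem_nhds hx))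
        (hfd x hx h i j) ?_
      filter_upwards [hlin x hx j] with t ht using hfG t ht
    have k0 := key 1 2 (fun x => -v 0 x) (hv 0).neg fun t ht => by
      rw [(hvf _ ht).2.1]
      simp [he, h]
      ring
    have k1 := key 0 2 (v 1) (hv 1) fun t ht => by
      rw [(hvf _ ht).1]
      simp [he, h]
      ring
    have k2 := key 0 1 (fun x => -v 2 x) (hv 2).neg fun t ht => by
      rw [(hvf _ ht).1]
      simp [he, h]
      ring
    intro i
    fin_cases i
    exacts [neg_eq_zero.1 k0, k1, neg_eq_zero.1 k2]
  let d : E → ℂ := fun x => N 0 0 x * (N 1 1 x * N 2 2 x - N 1 2 x * N 2 1 x) -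
    N 0 1 x * (N 1 0 x * N 2 2 x - N 1 2 x * N 2 0 x) +
    N 0 2 x * (N 1 0 x * N 2 1 x - N 1 1 x * N 2 0 x)
  let s : Fin 3 → E → ℂ := fun i x => N i 0 x * v 0 x + N i 1 x * v 1 x + N i 2 x * v 2 x
  have hc : ∀ x ∈ D,
      d x * q 0 x = s 1 x * ((η 2 x + ℓ 2 x) / 2) - s 2 x * ((η 1 x + ℓ 1 x) / 2) ∧
      d x * q 1 x = s 2 x * ((η 0 x + ℓ 0 x) / 2) - s 0 x * ((η 2 x + ℓ 2 x) / 2) ∧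
      d x * q 2 x = s 0 x * ((η 1 x + ℓ 1 x) / 2) - s 1 x * ((η 0 x + ℓ 0 x) / 2) := by
    intro x hx
    obtain ⟨e0, e1, e2⟩ := hvf x hx
    simp only [hNz x hx]
    simp only [f] at e0 e1 e2
    simp only [d, s]
    refine ⟨?_, ?_, ?_⟩
    · linear_combination (N 1 1 x * N 2 2 x - N 1 2 x * N 2 1 x) * e0 -
        (N 1 0 x * N 2 2 x - N 1 2 x * N 2 0 x) * e1 +
        (N 1 0 x * N 2 1 x - N 1 1 x * N 2 0 x) * e2
    · linear_combination (N 2 1 x * N 0 2 x - N 2 2 x * N 0 1 x) * e0 -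
        (N 2 0 x * N 0 2 x - N 2 2 x * N 0 0 x) * e1 +
        (N 2 0 x * N 0 1 x - N 2 1 x * N 0 0 x) * e2
    · linear_combination (N 0 1 x * N 1 2 x - N 0 2 x * N 1 1 x) * e0 -
        (N 0 0 x * N 1 2 x - N 0 2 x * N 1 0 x) * e1 +
        (N 0 0 x * N 1 1 x - N 0 1 x * N 1 0 x) * e2
  refine ⟨d, s, ?_, ?_, ?_, ?_⟩
  · have h2 : ∀ a b a' b', DifferentiableOn ℂ
        (fun x => N a b x * N a' b' x) D := fun a b a' b' => (hN a b).mul (hN a' b')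
    exact (((hN 0 0).mul ((h2 1 1 2 2).sub (h2 1 2 2 1))).sub
      ((hN 0 1).mul ((h2 1 0 2 2).sub (h2 1 2 2 0)))).add
      ((hN 0 2).mul ((h2 1 0 2 1).sub (h2 1 1 2 0)))
  · exact fun i =>
      (((hN i 0).mul (hv 0)).add ((hN i 1).mul (hv 1))).add ((hN i 2).mul (hv 2))
  · intro x hx h
    refine ⟨?_, fun i => ?_⟩
    · simp [d, hN1 x hx h]
    · simp [s, hv0 x hx h]
  · intro x hx hd
    obtain ⟨c0, c1, c2⟩ := hc x hx
    have horth : s 0 x * q 0 x + s 1 x * q 1 x + s 2 x * q 2 x = 0 := by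
      refine (mul_eq_zero.1 ?_).resolve_left hd
      linear_combination s 0 x * c0 + s 1 x * c1 + s 2 x * c2
    simp only [q, Matrix.cons_val_zero, Matrix.cons_val_one, Matrix.cons_val] at c0 c1 c2 horth
    ext i j
    fin_cases i <;> fin_cases j <;> simp [Matrix.mul_apply, Fin.sum_univ_two]
    · linear_combination c0 + horth
    · linear_combination 2 * c2
    · linear_combination 2 * c1
    · linear_combination -c0 + horth

end Intertwiner

section Montel

/-- A locally eventually bounded family of holomorphic functions of one variable converges along
any ultrafilter to a holomorphic function. -/
lemma exists_differentiableOn_tendsto_ultrafilter {ι : Type*} {B : Set ℂ} (hB : IsOpen B)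
    (L : Ultrafilter ι) {f : ι → ℂ → ℂ} (hf : ∀ n, DifferentiableOn ℂ (f n) B)
    (hbd : ∀ z ∈ B, ∃ ρ > 0, ∃ C, ∀ᶠ n in L, ∀ w ∈ ball z ρ, ‖f n w‖ ≤ C) :
    ∃ a : ℂ → ℂ, DifferentiableOn ℂ a B ∧ ∀ z ∈ B, Tendsto (fun n => f n z) L (𝓝 (a z)) := by
  have hlim : ∀ z, ∃ y, z ∈ B → Tendsto (fun n => f n z) L (𝓝 y) := by
    intro z
    by_cases hz : z ∈ B
    · obtain ⟨ρ, hρ, C, hC⟩ := hbd z hz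
      obtain ⟨y, -, hy⟩ := isCompact_iff_ultrafilter_le_nhds.1 (isCompact_closedBall (0 : ℂ) C)
        (L.map fun n => f n z) (by
          rw [le_principal_iff, Ultrafilter.coe_map, mem_map]
          filter_upwards [hC] with n hn
          simpa using hn z (mem_ball_self hρ))
      exact ⟨y, fun _ => hy⟩
    · exact ⟨0, fun h => absurd h hz⟩
  choose a ha using hlim
  refine ⟨a, ?_, ha⟩
  refine TendstoLocallyUniformlyOn.differentiableOn (F := f) (φ := (L : Filter ι)) ?_
    (Eventually.of_forall hf) hB
  rw [Metric.tendstoLocallyUniformlyOn_iff]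
  intro ε hε z hz
  obtain ⟨ρ₁, hρ₁, C, hC⟩ := hbd z hz
  obtain ⟨ρ₂, hρ₂, hball⟩ := Metric.isOpen_iff.1 hB z hz
  let ρ := min ρ₁ ρ₂
  have hρ : 0 < ρ := lt_min hρ₁ hρ₂
  let K := (2 * |C| + 1) / ρ
  have hK : 0 < K := by positivity
  have hBρ : ball z ρ ⊆ B := (ball_subset_ball (min_le_right _ _)).trans hball
  have hlip : ∀ᶠ n in (L : Filter ι), ∀ w ∈ ball z ρ,
      dist (f n w) (f n z) ≤ K * dist w z := by
    filter_upwards [hC] with n hn w hw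
    refine Complex.dist_le_div_mul_dist_of_mapsTo_ball ((hf n).mono hBρ) ?_ hw
    intro y hy
    have h1 := hn y (ball_subset_ball (min_le_left _ _) hy)
    have h2 := hn z (mem_ball_self hρ₁)
    have h3 := norm_sub_le (f n y) (f n z)
    have h4 := le_abs_self C
    simp only [mem_closedBall, dist_eq_norm]
    linarith
  have hlipa : ∀ w ∈ ball z ρ, dist (a w) (a z) ≤ K * dist w z := by
    intro w hw
    refine le_of_tendsto ((ha w (hBρ hw)).dist (ha z hz)) ?_
    filter_upwards [hlip] with n hn using hn w hw
  let δ := min ρ (ε / (3 * K))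
  have hδ : 0 < δ := lt_min hρ (by positivity)
  refine ⟨ball z δ, mem_nhdsWithin_of_mem_nhds (ball_mem_nhds z hδ), ?_⟩
  filter_upwards [hlip, (ha z hz).eventually (ball_mem_nhds (a z) (by positivity : 0 < ε / 3))]
    with n hn hnz w hw
  have hw1 : w ∈ ball z ρ := ball_subset_ball (min_le_left _ _) hw
  have hw2 : K * dist w z < ε / 3 := by
    have : dist w z < ε / (3 * K) := lt_of_lt_of_le hw (min_le_right _ _)
    calc K * dist w z < K * (ε / (3 * K)) := by gcongr
      _ = ε / 3 := by field_simp
  have h1 := hlipa w hw1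
  have h2 := hn w hw1
  have h3 := dist_triangle4 (a w) (a z) (f n z) (f n w)
  have h4 : dist (a z) (f n z) < ε / 3 := by rwa [dist_comm]
  rw [dist_comm (f n z)] at h3
  linarith

end Montel

section MatrixCalculus

variable {E : Type*} [NormedAddCommGroup E] [NormedSpace ℂ E]

lemma differentiableOn_matrix_iff {f : E → M2} {s : Set E} :
    DifferentiableOn ℂ f s ↔ ∀ i j, DifferentiableOn ℂ (fun x => f x i j) s := by
  have h := differentiableOn_pi (𝕜 := ℂ) (s := s) (Φ := fun x i => f x i)
  have h2 := fun i => differentiableOn_pi (𝕜 := ℂ) (s := s) (Φ := fun x j => f x i j)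
  exact h.trans (forall_congr' h2)

lemma differentiableOn_matrix_mul {f g : E → M2} {s : Set E} (hf : DifferentiableOn ℂ f s)
    (hg : DifferentiableOn ℂ g s) : DifferentiableOn ℂ (fun x => f x * g x) s := by
  rw [differentiableOn_matrix_iff] at *
  intro i j
  simp only [Matrix.mul_apply, Fin.sum_univ_two]
  exact ((hf i 0).mul (hg 0 j)).add ((hf i 1).mul (hg 1 j))

lemma differentiableOn_matrix_adjugate {f : E → M2} {s : Set E} (hf : DifferentiableOn ℂ f s) :
    DifferentiableOn ℂ (fun x => (f x).adjugate) s := by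
  rw [differentiableOn_matrix_iff] at *
  intro i j
  simp only [Matrix.adjugate_fin_two]
  fin_cases i <;> fin_cases j
  exacts [hf 1 1, (hf 0 1).neg, (hf 1 0).neg, hf 0 0]

lemma inv_eq_adjugate_of_det_eq_one {a : M2} (ha : a.det = 1) : a⁻¹ = a.adjugate := by
  simp [Matrix.inv_def, ha]

end MatrixCalculus

section Derivatives

variable {E F : Type*} [NormedAddCommGroup E] [NormedSpace ℂ E] [NormedAddCommGroup F]
  [NormedSpace ℂ F]

/-- A Cauchy estimate on the ball of half the radius. -/
lemma norm_fderiv_le_of_norm_le_on_closedBall {g : E → F} {x₀ x : E} {ρ C : ℝ} (hρ : 0 < ρ)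
    (hg : DifferentiableOn ℂ g (closedBall x₀ (2 * ρ)))
    (hgC : ∀ y ∈ closedBall x₀ (2 * ρ), ‖g y‖ ≤ C) (hx : x ∈ ball x₀ ρ) :
    ‖fderiv ℂ g x‖ ≤ 2 * C / ρ := by
  have hsub : ball x ρ ⊆ closedBall x₀ (2 * ρ) := by
    intro y hy
    have := dist_triangle y x x₀
    simp only [mem_ball, mem_closedBall] at *
    linarith
  refine Complex.norm_fderiv_le_div_of_mapsTo_ball (hg.mono hsub) ?_ hρ
  intro y hy
  have h1 := hgC y (hsub hy)
  have h2 := hgC x (hsub (mem_ball_self hρ))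
  have h3 := norm_sub_le (g y) (g x)
  simp only [mem_closedBall, dist_eq_norm]
  linarith

variable [ProperSpace E] {W : Set E} {φ : ℕ → E → F} {ψ : E → F}

lemma eventually_norm_fderiv_le (hW : IsOpen W) (hφ : ∀ n, DifferentiableOn ℂ (φ n) W)
    (hψ : DifferentiableOn ℂ ψ W)
    (hconv : ∀ K ⊆ W, IsCompact K → TendstoUniformlyOn φ ψ atTop K) {x₀ : E} (hx₀ : x₀ ∈ W) :
    ∃ ρ > 0, ∃ C, ball x₀ ρ ⊆ W ∧ ∀ᶠ n in atTop, ∀ x ∈ ball x₀ ρ, ‖fderiv ℂ (φ n) x‖ ≤ C := by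
  obtain ⟨r, hr, hball⟩ := Metric.nhds_basis_closedBall.mem_iff.1 (hW.mem_nhds hx₀)
  have hr2 : 2 * (r / 2) = r := by ring
  have hK : IsCompact (closedBall x₀ r) := isCompact_closedBall x₀ r
  obtain ⟨C, hC⟩ := hK.exists_bound_of_continuousOn (hψ.continuousOn.mono hball)
  have hC0 : 0 ≤ C := (norm_nonneg _).trans (hC x₀ (mem_closedBall_self hr.le))
  refine ⟨r / 2, by positivity, 2 * (C + 1) / (r / 2), ?_, ?_⟩
  · exact (ball_subset_closedBall.trans (closedBall_subset_closedBall (by linarith))).trans hball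
  filter_upwards [Metric.tendstoUniformlyOn_iff.1 (hconv _ hball hK) 1 one_pos] with n hn x hx
  refine norm_fderiv_le_of_norm_le_on_closedBall (by positivity)
    (by rw [hr2]; exact (hφ n).mono hball) ?_ hx
  intro y hy
  rw [hr2] at hy
  have h1 := hn y hy
  rw [dist_eq_norm'] at h1
  have h2 := norm_le_norm_add_norm_sub' (φ n y) (ψ y)
  linarith [hC y hy]

lemma tendsto_fderiv_of_tendstoUniformlyOn (hW : IsOpen W)
    (hφ : ∀ n, DifferentiableOn ℂ (φ n) W) (hψ : DifferentiableOn ℂ ψ W)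
    (hconv : ∀ K ⊆ W, IsCompact K → TendstoUniformlyOn φ ψ atTop K) {x₀ : E} (hx₀ : x₀ ∈ W) :
    Tendsto (fun n => fderiv ℂ (φ n) x₀) atTop (𝓝 (fderiv ℂ ψ x₀)) := by
  obtain ⟨r, hr, hball⟩ := Metric.nhds_basis_closedBall.mem_iff.1 (hW.mem_nhds hx₀)
  have hr2 : 2 * (r / 2) = r := by ring
  rw [Metric.tendsto_atTop']
  intro ε hε
  have hδ : 0 < ε * r / 8 := by positivity
  obtain ⟨N, hN⟩ := eventually_atTop.1
    (Metric.tendstoUniformlyOn_iff.1 (hconv _ hball (isCompact_closedBall x₀ r)) _ hδ)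
  refine ⟨N, fun n hn => ?_⟩
  have h1 : fderiv ℂ (φ n) x₀ - fderiv ℂ ψ x₀ = fderiv ℂ (φ n - ψ) x₀ :=
    (fderiv_sub ((hφ n).differentiableAt (hW.mem_nhds hx₀))
      (hψ.differentiableAt (hW.mem_nhds hx₀))).symm
  rw [dist_eq_norm, h1]
  refine (norm_fderiv_le_of_norm_le_on_closedBall (x₀ := x₀) (ρ := r / 2) (C := ε * r / 8)
    (by positivity) ?_ ?_ (mem_ball_self (by positivity))).trans_lt ?_
  · rw [hr2]
    exact ((hφ n).sub hψ).mono hball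
  · intro y hy
    rw [hr2] at hy
    have := hN n hn.le y hy
    rw [dist_eq_norm'] at this
    exact this.le
  · have : 2 * (ε * r / 8) / (r / 2) = ε / 2 := by field_simp; norm_num
    linarith

end Derivatives

section Conjugation

lemma mul_mul_adjugate_apply_zero (q : M2) :
    (q * !![0, 1; 0, 0] * q.adjugate : M2) 0 1 = q 0 0 ^ 2 ∧
    (q * !![0, 1; 0, 0] * q.adjugate : M2) 1 0 = -q 1 0 ^ 2 ∧
    (q * !![0, 0; 1, 0] * q.adjugate : M2) 0 1 = -q 0 1 ^ 2 ∧
    (q * !![0, 0; 1, 0] * q.adjugate : M2) 1 0 = q 1 1 ^ 2 := by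
  simp [Matrix.mul_apply, Fin.sum_univ_two, Matrix.adjugate_fin_two]
  refine ⟨?_, ?_, ?_, ?_⟩ <;> ring

/-- The entries of `q` are controlled by the conjugates of the two off-diagonal elementary
matrices. -/
lemma exists_norm_apply_le (C : ℝ) : ∃ C', ∀ q : M2,
    (∀ e ∈ ({!![0, 1; 0, 0], !![0, 0; 1, 0]} : Set M2), ‖q * e * q.adjugate‖ ≤ C) →
      ∀ i j, ‖q i j‖ ≤ C' := by
  refine ⟨C + 1, fun q hq i j => ?_⟩
  suffices h : ‖q i j‖ ^ 2 ≤ C by nlinarith [norm_nonneg (q i j)]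
  have h0 := hq !![0, 1; 0, 0] (by simp)
  have h1 := hq !![0, 0; 1, 0] (by simp)
  obtain ⟨e0, e1, e2, e3⟩ := mul_mul_adjugate_apply_zero q
  have k0 := (Matrix.norm_entry_le_entrywise_sup_norm _ (i := 0) (j := 1)).trans h0
  have k1 := (Matrix.norm_entry_le_entrywise_sup_norm _ (i := 1) (j := 0)).trans h0
  have k2 := (Matrix.norm_entry_le_entrywise_sup_norm _ (i := 0) (j := 1)).trans h1
  have k3 := (Matrix.norm_entry_le_entrywise_sup_norm _ (i := 1) (j := 0)).trans h1
  rw [e0] at k0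
  rw [e1] at k1
  rw [e2] at k2
  rw [e3] at k3
  simp only [norm_neg, norm_pow] at k0 k1 k2 k3
  fin_cases i <;> fin_cases j <;> assumption

variable {W : Set M2} {p : M2 → M2}

lemma differentiableOn_conj (hp : DifferentiableOn ℂ p W) (hpdet : ∀ x ∈ W, (p x).det = 1) :
    DifferentiableOn ℂ (fun x => p x * x * (p x)⁻¹) W := by
  refine (differentiableOn_matrix_mul (differentiableOn_matrix_mul hp differentiableOn_id)
    (differentiableOn_matrix_adjugate hp)).congr fun x hx => ?_
  simp [inv_eq_adjugate_of_det_eq_one (hpdet x hx)]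

/-- The derivative of `x ↦ p x * x * (p x)⁻¹` at a scalar matrix is conjugation by the value of
`p`. -/
lemma fderiv_conj_smul_one (hW : IsOpen W) (hp : DifferentiableOn ℂ p W)
    (hpdet : ∀ x ∈ W, (p x).det = 1) {l : ℂ} (hl : l • (1 : M2) ∈ W) (e : M2) :
    fderiv ℂ (fun x => p x * x * (p x)⁻¹) (l • 1) e =
      p (l • 1) * e * (p (l • 1)).adjugate := by
  have hline : Tendsto (fun t : ℂ => l • (1 : M2) + t • e) (𝓝 0) (𝓝 (l • 1)) := by
    have : Continuous (fun t : ℂ => l • (1 : M2) + t • e) := by fun_prop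
    simpa using this.tendsto 0
  let G : ℂ → M2 := fun t => p (l • 1 + t • e) * e * (p (l • 1 + t • e)).adjugate
  have hG : ContinuousAt G 0 := by
    have h1 : DifferentiableOn ℂ (fun x => p x * e * (p x).adjugate) W :=
      differentiableOn_matrix_mul (differentiableOn_matrix_mul hp (differentiableOn_const e))
        (differentiableOn_matrix_adjugate hp)
    have h2 : Tendsto (fun x => p x * e * (p x).adjugate) (𝓝 (l • 1))
      (𝓝 (p (l • 1) * e * (p (l • 1)).adjugate)) :=
      h1.continuousOn.continuousAt (hW.mem_nhds hl)
    have h3 := h2.comp hline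
    simpa [ContinuousAt, G] using! h3
  have h4 := (hasDerivAt_id_smul_zero hG).const_add (l • (1 : M2))
  have h5 : (fun t : ℂ => p (l • 1 + t • e) * (l • 1 + t • e) * (p (l • 1 + t • e))⁻¹) =ᶠ[𝓝 0]
      fun t => l • (1 : M2) + t • G t := by
    filter_upwards [hline.eventually (hW.mem_nhds hl)] with t ht
    have hdet := hpdet _ ht
    have h6 : p (l • 1 + t • e) * (p (l • 1 + t • e)).adjugate = 1 := by
      rw [Matrix.mul_adjugate, hdet, one_smul]
    rw [inv_eq_adjugate_of_det_eq_one hdet]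
    simp only [Matrix.mul_add, Matrix.add_mul, Matrix.mul_smul, Matrix.smul_mul, Matrix.mul_one,
      h6, G]
  have h7 := h4.congr_of_eventuallyEq h5
  have h8 : HasFDerivAt (fun x => p x * x * (p x)⁻¹)
      (fderiv ℂ (fun x => p x * x * (p x)⁻¹) (l • 1)) (l • (1 : M2) + (0 : ℂ) • e) := by
    rw [zero_smul, add_zero]
    exact ((differentiableOn_conj hp hpdet).differentiableAt (hW.mem_nhds hl)).hasFDerivAt
  have h9 : HasDerivAt (fun t : ℂ => l • (1 : M2) + t • e) e 0 := by
    have h := ((hasDerivAt_id (0 : ℂ)).smul_const e).const_add (l • (1 : M2))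
    rwa [one_smul] at h
  have h10 := h8.comp_hasDerivAt (0 : ℂ) h9
  have h11 := h10.unique h7
  simp [G] at h11
  exact h11

end Conjugation

section Limit

variable {W : Set M2} {p : ℕ → M2 → M2} {ψ : M2 → M2}

lemma smul_one_mem_nonCyclic {l : ℂ} (hl : l ∈ ball (0 : ℂ) 1) : l • (1 : M2) ∈ NonCyclic :=
  ⟨l, by simpa using hl, rfl⟩

lemma continuous_smul_one : Continuous fun l : ℂ => l • (1 : M2) := by fun_prop

/-- The derivative of the limit at scalar matrices is conjugation by a holomorphic map. -/
lemma exists_fderiv_eq_conj (hW : IsOpen W) (hTW : NonCyclic ⊆ W)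
    (hp : ∀ n, DifferentiableOn ℂ (p n) W) (hpdet : ∀ n, ∀ x ∈ W, (p n x).det = 1)
    (hψ : DifferentiableOn ℂ ψ W)
    (hconv : ∀ K ⊆ W, IsCompact K →
      TendstoUniformlyOn (fun n x => p n x * x * (p n x)⁻¹) ψ atTop K) :
    ∃ a : ℂ → M2, DifferentiableOn ℂ a (ball 0 1) ∧ (∀ l ∈ ball (0 : ℂ) 1, (a l).det = 1) ∧
      ∀ l ∈ ball (0 : ℂ) 1, ∀ e, fderiv ℂ ψ (l • 1) e = a l * e * (a l).adjugate := by
  have : ProperSpace M2 := FiniteDimensional.proper ℂ M2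
  have hmem : ∀ l ∈ ball (0 : ℂ) 1, l • (1 : M2) ∈ W := fun l hl =>
    hTW (smul_one_mem_nonCyclic hl)
  have hφ : ∀ n, DifferentiableOn ℂ (fun x => p n x * x * (p n x)⁻¹) W := fun n =>
    differentiableOn_conj (hp n) (hpdet n)
  let L : Ultrafilter ℕ := hyperfilter ℕ
  have hL : (L : Filter ℕ) ≤ atTop := Nat.hyperfilter_le_atTop
  have hdiff : ∀ n i j, DifferentiableOn ℂ (fun l : ℂ => p n (l • 1) i j) (ball 0 1) := by
    intro n i j
    exact (differentiableOn_matrix_iff.1 (hp n) i j).comp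
      (by fun_prop : Differentiable ℂ fun l : ℂ => l • (1 : M2)).differentiableOn hmem
  have hbd : ∀ z ∈ ball (0 : ℂ) 1, ∃ ρ > 0, ∃ C, ∀ᶠ n in L, ∀ w ∈ ball z ρ,
      ∀ i j, ‖p n (w • 1) i j‖ ≤ C := by
    intro z hz
    obtain ⟨ρ, hρ, C, hball, hC⟩ := eventually_norm_fderiv_le hW hφ hψ hconv (hmem z hz)
    have hnhds : (fun l : ℂ => l • (1 : M2)) ⁻¹' ball (z • 1) ρ ∈ 𝓝 z :=
      continuous_smul_one.continuousAt (ball_mem_nhds _ hρ)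
    obtain ⟨δ, hδ, hδρ⟩ := Metric.mem_nhds_iff.1 hnhds
    obtain ⟨C', hC'⟩ := exists_norm_apply_le
      (C * max ‖(!![0, 1; 0, 0] : M2)‖ ‖(!![0, 0; 1, 0] : M2)‖)
    refine ⟨δ, hδ, C', ?_⟩
    filter_upwards [hL hC] with n hn w hw
    refine hC' _ fun e he => ?_
    have hwρ : w • (1 : M2) ∈ ball (z • (1 : M2)) ρ := hδρ hw
    have h1 := hn _ hwρ
    rw [← fderiv_conj_smul_one hW (hp n) (hpdet n) (hball hwρ) e]
    refine (ContinuousLinearMap.le_of_opNorm_le _ h1 e).trans ?_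
    have hC0 := (norm_nonneg _).trans h1
    gcongr
    rcases he with rfl | rfl
    exacts [le_max_left _ _, le_max_right _ _]
  have hex := fun i j => exists_differentiableOn_tendsto_ultrafilter isOpen_ball L
    (fun n => hdiff n i j) fun z hz => by
      obtain ⟨ρ, hρ, C, hC⟩ := hbd z hz
      exact ⟨ρ, hρ, C, hC.mono fun n hn w hw => hn w hw i j⟩
  choose a ha hlim using hex
  have hlim' : ∀ l ∈ ball (0 : ℂ) 1,
      Tendsto (fun n => p n (l • 1)) L (𝓝 (Matrix.of fun i j => a i j l)) := by
    intro l hl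
    exact tendsto_pi_nhds.2 fun i => tendsto_pi_nhds.2 fun j => hlim i j l hl
  refine ⟨fun l => Matrix.of fun i j => a i j l, differentiableOn_matrix_iff.2 ha, ?_, ?_⟩
  · intro l hl
    have h1 := ((continuous_id.matrix_det.tendsto (Matrix.of fun i j => a i j l)).comp
      (hlim' l hl))
    refine tendsto_nhds_unique h1 (tendsto_const_nhds.congr fun n => ?_)
    exact (hpdet n _ (hmem l hl)).symm
  · intro l hl e
    have hc : Continuous fun q : M2 => q * e * q.adjugate :=
      (continuous_id.matrix_mul continuous_const).matrix_mul continuous_id.matrix_adjugate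
    have h1 := (hc.tendsto _).comp (hlim' l hl)
    have h2 := (tendsto_fderiv_of_tendstoUniformlyOn hW hφ hψ hconv (hmem l hl)).mono_left hL
    have h3 := ((ContinuousLinearMap.apply ℂ M2 e).continuous.tendsto _).comp h2
    refine tendsto_nhds_unique h3 (h1.congr fun n => ?_)
    exact (fderiv_conj_smul_one hW (hp n) (hpdet n) (hmem l hl) e).symm

lemma tendsto_conj {x : M2} (hx : x ∈ W)
    (hconv : ∀ K ⊆ W, IsCompact K →
      TendstoUniformlyOn (fun n x => p n x * x * (p n x)⁻¹) ψ atTop K) :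
    Tendsto (fun n => p n x * x * (p n x)⁻¹) atTop (𝓝 (ψ x)) :=
  (hconv {x} (by simpa using hx) isCompact_singleton).tendsto_at (mem_singleton x)

/-- A limit of conjugations agrees with the identity under any continuous conjugation-invariant
function. -/
lemma apply_eq_of_conj_invariant {X : Type*} [TopologicalSpace X] [T2Space X] {g : M2 → X}
    (hg : Continuous g) {x : M2} (hx : x ∈ W) (hpdet : ∀ n, ∀ x ∈ W, (p n x).det = 1)
    (hconv : ∀ K ⊆ W, IsCompact K →
      TendstoUniformlyOn (fun n x => p n x * x * (p n x)⁻¹) ψ atTop K)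
    (hinv : ∀ q : M2, IsUnit q.det → g (q * x * q⁻¹) = g x) : g (ψ x) = g x := by
  refine tendsto_nhds_unique ((hg.tendsto _).comp (tendsto_conj hx hconv))
    (tendsto_const_nhds.congr fun n => ?_)
  exact (hinv _ (by simp [hpdet n x hx])).symm

lemma trace_limit_conj {x : M2} (hx : x ∈ W) (hpdet : ∀ n, ∀ x ∈ W, (p n x).det = 1)
    (hconv : ∀ K ⊆ W, IsCompact K →
      TendstoUniformlyOn (fun n x => p n x * x * (p n x)⁻¹) ψ atTop K) :
    (ψ x).trace = x.trace :=
  apply_eq_of_conj_invariant continuous_id.matrix_trace hx hpdet hconv fun q hq => by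
    rw [id, Matrix.mul_assoc, Matrix.trace_mul_comm, Matrix.mul_assoc,
      Matrix.nonsing_inv_mul _ hq, Matrix.mul_one, id]

lemma det_limit_conj {x : M2} (hx : x ∈ W) (hpdet : ∀ n, ∀ x ∈ W, (p n x).det = 1)
    (hconv : ∀ K ⊆ W, IsCompact K →
      TendstoUniformlyOn (fun n x => p n x * x * (p n x)⁻¹) ψ atTop K) :
    (ψ x).det = x.det :=
  apply_eq_of_conj_invariant continuous_id.matrix_det hx hpdet hconv fun q hq =>
    Matrix.det_conj ((Matrix.isUnit_iff_isUnit_det q).2 hq) x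

lemma limit_conj_smul_one {l : ℂ} (hx : l • (1 : M2) ∈ W)
    (hpdet : ∀ n, ∀ x ∈ W, (p n x).det = 1)
    (hconv : ∀ K ⊆ W, IsCompact K →
      TendstoUniformlyOn (fun n x => p n x * x * (p n x)⁻¹) ψ atTop K) :
    ψ (l • 1) = l • 1 :=
  apply_eq_of_conj_invariant continuous_id hx hpdet hconv fun q hq => by
    simp [Matrix.mul_nonsing_inv _ hq]

end Limit

section Coordinates

/-- Half the trace, as a continuous linear map. -/
def halfTrace : M2 →L[ℂ] ℂ :=
  LinearMap.toContinuousLinearMap ((1 / 2 : ℂ) • Matrix.traceLinearMap (Fin 2) ℂ ℂ)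

/-- The coordinates `(x₀₀ - x₁₁) / 2`, `x₀₁`, `x₁₀` of the traceless part of a matrix. -/
def tracelessCoord : Fin 3 → M2 →L[ℂ] ℂ := fun i => LinearMap.toContinuousLinearMap
  ((![(1 / 2 : ℂ) • (Matrix.entryLinearMap ℂ ℂ 0 0 - Matrix.entryLinearMap ℂ ℂ 1 1),
    Matrix.entryLinearMap ℂ ℂ 0 1, Matrix.entryLinearMap ℂ ℂ 1 0] : Fin 3 → M2 →ₗ[ℂ] ℂ) i)

/-- The basis of traceless matrices dual to `tracelessCoord`. -/
def tracelessBasis : Fin 3 → M2 := ![!![1, 0; 0, -1], !![0, 1; 0, 0], !![0, 0; 1, 0]]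

lemma halfTrace_apply (x : M2) : halfTrace x = (x 0 0 + x 1 1) / 2 := by
  simp [halfTrace, Matrix.trace_fin_two]
  ring

lemma tracelessCoord_zero (x : M2) : tracelessCoord 0 x = (x 0 0 - x 1 1) / 2 := by
  simp [tracelessCoord]
  ring

lemma tracelessCoord_one (x : M2) : tracelessCoord 1 x = x 0 1 := by
  simp [tracelessCoord]

lemma tracelessCoord_two (x : M2) : tracelessCoord 2 x = x 1 0 := by
  simp [tracelessCoord]

lemma tracelessCoord_basis (i j : Fin 3) :
    tracelessCoord i (tracelessBasis j) = if i = j then 1 else 0 := by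
  fin_cases i <;> fin_cases j <;>
    simp [tracelessCoord_zero, tracelessCoord_one, tracelessCoord_two, tracelessBasis]

lemma halfTrace_basis (j : Fin 3) : halfTrace (tracelessBasis j) = 0 := by
  fin_cases j <;> simp [halfTrace_apply, tracelessBasis]

lemma halfTrace_smul_one (l : ℂ) : halfTrace (l • 1) = l := by
  simp [halfTrace_apply]

lemma tracelessCoord_smul_one (l : ℂ) (i : Fin 3) : tracelessCoord i (l • 1) = 0 := by
  fin_cases i <;> simp [tracelessCoord_zero, tracelessCoord_one, tracelessCoord_two]

lemma eq_halfTrace_smul_one_add (x : M2) : x = halfTrace x • (1 : M2) +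
    !![tracelessCoord 0 x, tracelessCoord 1 x; tracelessCoord 2 x, -tracelessCoord 0 x] := by
  ext i j
  fin_cases i <;> fin_cases j <;>
    simp [tracelessCoord_zero, tracelessCoord_one, tracelessCoord_two, halfTrace_apply] <;> ring

lemma eq_halfTrace_smul_one {x : M2} (h : ∀ i, tracelessCoord i x = 0) :
    x = halfTrace x • (1 : M2) := by
  have h1 := eq_halfTrace_smul_one_add x
  have h2 : (!![0, 0; 0, -0] : M2) = 0 := by
    ext i j
    fin_cases i <;> fin_cases j <;> simp
  rwa [h 0, h 1, h 2, h2, add_zero] at h1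

/-- Every neighborhood of the scalar matrices of norm less than one contains an open neighborhood
that is stable under setting any coordinate of the traceless part to zero. -/
lemma exists_open_stable {W : Set M2} (hW : IsOpen W) (hTW : NonCyclic ⊆ W) :
    ∃ D : Set M2, IsOpen D ∧ NonCyclic ⊆ D ∧ D ⊆ W ∧ (∀ x ∈ D, halfTrace x ∈ ball (0 : ℂ) 1) ∧
      ∀ i, ∀ x ∈ D, x - tracelessCoord i x • tracelessBasis i ∈ D := by
  let P : ℂ → ℝ → Set M2 := fun l r =>
    {x | ‖halfTrace x - l‖ < r ∧ ∀ i, ‖tracelessCoord i x‖ < r}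
  let S : Set M2 := W ∩ halfTrace ⁻¹' ball 0 1
  have hPo : ∀ l r, IsOpen (P l r) := by
    intro l r
    refine (isOpen_lt (halfTrace.continuous.sub continuous_const).norm continuous_const).and ?_
    rw [ofPred_forall]
    exact isOpen_iInter_of_finite fun i =>
      isOpen_lt (tracelessCoord i).continuous.norm continuous_const
  refine ⟨{x | ∃ l r, P l r ⊆ S ∧ x ∈ P l r}, ?_, ?_, ?_, ?_, ?_⟩
  · rw [isOpen_iff_mem_nhds]
    rintro x ⟨l, r, hS, hx⟩
    filter_upwards [(hPo l r).mem_nhds hx] with y hy using ⟨l, r, hS, hy⟩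
  · rintro x ⟨l, hl, rfl⟩
    have hlW : l • (1 : M2) ∈ W := hTW ⟨l, hl, rfl⟩
    obtain ⟨ε, hε, hball⟩ := Metric.isOpen_iff.1 hW _ hlW
    let r := min (ε / 2) (1 - ‖l‖)
    have hr : 0 < r := lt_min (by positivity) (by linarith)
    have hr1 : r ≤ ε / 2 := min_le_left _ _
    have hr2 : r ≤ 1 - ‖l‖ := min_le_right _ _
    refine ⟨l, r, ?_, ?_⟩
    · rintro y ⟨h0, h1⟩
      constructor
      · apply hball
        have e0 := h1 0
        have e1 := h1 1
        have e2 := h1 2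
        rw [tracelessCoord_zero] at e0
        rw [tracelessCoord_one] at e1
        rw [tracelessCoord_two] at e2
        rw [halfTrace_apply] at h0
        rw [mem_ball, dist_eq_norm, Matrix.norm_lt_iff hε]
        intro i j
        fin_cases i <;> fin_cases j
        · have h2 : y 0 0 - l = ((y 0 0 + y 1 1) / 2 - l) + (y 0 0 - y 1 1) / 2 := by ring
          have h3 := norm_add_le ((y 0 0 + y 1 1) / 2 - l) ((y 0 0 - y 1 1) / 2)
          rw [← h2] at h3
          simp
          linarith
        · simp
          linarith
        · simp
          linarith
        · have h2 : y 1 1 - l = ((y 0 0 + y 1 1) / 2 - l) - (y 0 0 - y 1 1) / 2 := by ring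
          have h3 := norm_sub_le ((y 0 0 + y 1 1) / 2 - l) ((y 0 0 - y 1 1) / 2)
          rw [← h2] at h3
          simp
          linarith
      · have h2 := norm_le_norm_add_norm_sub' (halfTrace y) l
        simp only [mem_preimage, mem_ball_zero_iff]
        linarith
    · refine ⟨?_, fun i => ?_⟩
      · rwa [halfTrace_smul_one, sub_self, norm_zero]
      · rwa [tracelessCoord_smul_one, norm_zero]
  · rintro x ⟨l, r, hS, hx⟩
    exact (hS hx).1
  · rintro x ⟨l, r, hS, hx⟩
    exact (hS hx).2
  · rintro i x ⟨l, r, hS, hx⟩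
    refine ⟨l, r, hS, ?_, fun j => ?_⟩
    · simpa [halfTrace_basis] using hx.1
    · rw [map_sub, map_smul, tracelessCoord_basis]
      split_ifs with h
      · subst h
        simpa using (norm_nonneg _).trans_lt hx.1
      · simpa using hx.2 j

end Coordinates

section Assembly

lemma mul_adjugate_cancel {a : M2} (ha : a.det = 1) : a * a.adjugate = 1 := by
  rw [Matrix.mul_adjugate, ha, one_smul]

lemma adjugate_mul_cancel {a : M2} (ha : a.det = 1) : a.adjugate * a = 1 := by
  rw [Matrix.adjugate_mul, ha, one_smul]

/-- A trace and determinant preserving holomorphic map that fixes the scalar matrices, and whose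
derivative there is conjugation by a holomorphic map, is a holomorphic conjugation near the scalar
matrices. -/
lemma exists_conj_of_fderiv_eq_conj {D : Set M2} (hD : IsOpen D) (hTD : NonCyclic ⊆ D)
    (hDtr : ∀ x ∈ D, halfTrace x ∈ ball (0 : ℂ) 1)
    (hDs : ∀ i, ∀ x ∈ D, x - tracelessCoord i x • tracelessBasis i ∈ D)
    {ψ : M2 → M2} (hψ : DifferentiableOn ℂ ψ D) (htr : ∀ x ∈ D, (ψ x).trace = x.trace)
    (hdet : ∀ x ∈ D, (ψ x).det = x.det)
    (hfix : ∀ l : ℂ, l • (1 : M2) ∈ D → ψ (l • 1) = l • 1)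
    {a : ℂ → M2} (ha : DifferentiableOn ℂ a (ball 0 1))
    (hadet : ∀ l ∈ ball (0 : ℂ) 1, (a l).det = 1)
    (hader : ∀ l ∈ ball (0 : ℂ) 1, ∀ e, fderiv ℂ ψ (l • 1) e = a l * e * (a l).adjugate) :
    ∃ U : Set M2, IsOpen U ∧ NonCyclic ⊆ U ∧ U ⊆ D ∧
      ∃ u : M2 → M2, DifferentiableOn ℂ u U ∧
        ∀ x ∈ U, IsUnit (u x) ∧ ψ x = u x * x * (u x)⁻¹ := by
  let A : M2 → M2 := fun x => a (halfTrace x)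
  have hA : DifferentiableOn ℂ A D :=
    ha.comp halfTrace.differentiable.differentiableOn hDtr
  have hAdet : ∀ x ∈ D, (A x).det = 1 := fun x hx => hadet _ (hDtr x hx)
  let H : M2 → M2 := fun x => (A x).adjugate * (ψ x - halfTrace x • 1) * A x
  have hH : DifferentiableOn ℂ H D := by
    refine differentiableOn_matrix_mul (differentiableOn_matrix_mul
      (differentiableOn_matrix_adjugate hA) (hψ.sub ?_)) hA
    exact (halfTrace.differentiable.smul_const (1 : M2)).differentiableOn
  have hHtr : ∀ x ∈ D, H x 1 1 = -H x 0 0 := by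
    intro x hx
    have h1 : (H x).trace = 0 := by
      simp only [H]
      rw [Matrix.mul_assoc, Matrix.trace_mul_comm, Matrix.mul_assoc,
        mul_adjugate_cancel (hAdet x hx), Matrix.mul_one, Matrix.trace_sub, htr x hx,
        Matrix.trace_smul, halfTrace_apply]
      simp [Matrix.trace_fin_two]
    rw [Matrix.trace_fin_two] at h1
    linear_combination h1
  have hHdet : ∀ x ∈ D, (H x).det = (x - halfTrace x • 1).det := by
    intro x hx
    have h1 : (A x).adjugate.det = 1 := by simp [Matrix.det_adjugate, hAdet x hx]
    simp only [H, Matrix.det_mul, h1, hAdet x hx, one_mul, mul_one]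
    have h2 := hdet x hx
    have h3 := htr x hx
    simp only [Matrix.det_fin_two, Matrix.trace_fin_two] at h2 h3
    simp [Matrix.det_fin_two, halfTrace_apply]
    linear_combination h2 - (x 0 0 + x 1 1) / 2 * h3
  have hψH : ∀ x ∈ D, ψ x = halfTrace x • 1 + A x * H x * (A x).adjugate := by
    intro x hx
    have h1 : A x * H x * (A x).adjugate =
        (A x * (A x).adjugate) * (ψ x - halfTrace x • 1) * (A x * (A x).adjugate) := by
      simp only [H, Matrix.mul_assoc]
    rw [h1, mul_adjugate_cancel (hAdet x hx), Matrix.one_mul, Matrix.mul_one]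
    abel
  let η : Fin 3 → M2 → ℂ := ![fun x => H x 0 0, fun x => H x 0 1, fun x => H x 1 0]
  have hη : ∀ i, DifferentiableOn ℂ (η i) D := by
    have := differentiableOn_matrix_iff.1 hH
    intro i
    fin_cases i
    exacts [this 0 0, this 0 1, this 1 0]
  have hHη : ∀ x ∈ D, H x = !![η 0 x, η 1 x; η 2 x, -η 0 x] := by
    intro x hx
    ext i j
    fin_cases i <;> fin_cases j
    exacts [rfl, rfl, rfl, hHtr x hx]
  have hηcoord : ∀ x ∈ D, ∀ i, η i x = tracelessCoord i (H x) := by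
    intro x hx i
    fin_cases i
    · change H x 0 0 = tracelessCoord 0 (H x)
      rw [tracelessCoord_zero, hHtr x hx]
      ring
    · change H x 0 1 = tracelessCoord 1 (H x)
      rw [tracelessCoord_one]
    · change H x 1 0 = tracelessCoord 2 (H x)
      rw [tracelessCoord_two]
  have hQ : ∀ x ∈ D, η 0 x ^ 2 + η 1 x * η 2 x =
      tracelessCoord 0 x ^ 2 + tracelessCoord 1 x * tracelessCoord 2 x := by
    intro x hx
    have h1 := hHdet x hx
    rw [hHη x hx, Matrix.det_fin_two_of] at h1
    simp [Matrix.det_fin_two, halfTrace_apply] at h1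
    rw [tracelessCoord_zero, tracelessCoord_one, tracelessCoord_two]
    linear_combination -h1
  have hz : ∀ x ∈ D, (∀ i, tracelessCoord i x = 0) → ∀ i, η i x = 0 := by
    intro x hx h i
    have h1 := eq_halfTrace_smul_one h
    have h2 : ψ x = halfTrace x • 1 :=
      (congrArg ψ h1).trans (hfix (halfTrace x) (by rwa [← h1]))
    rw [hηcoord x hx]
    simp [H, h2]
  have hder : ∀ x ∈ D, (∀ i, tracelessCoord i x = 0) → ∀ i j,
      HasDerivAt (fun t : ℂ => η i (x + t • tracelessBasis j)) (if i = j then 1 else 0) 0 := by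
    intro x hx h i j
    have hl := hDtr x hx
    have hd := hadet _ hl
    have h1 := eq_halfTrace_smul_one h
    have hline : HasDerivAt (fun t : ℂ => x + t • tracelessBasis j) (tracelessBasis j) 0 := by
      have h := ((hasDerivAt_id (0 : ℂ)).smul_const (tracelessBasis j)).const_add x
      rwa [one_smul] at h
    have h2 : HasFDerivAt ψ (fderiv ℂ ψ x) (x + (0 : ℂ) • tracelessBasis j) := by
      rw [zero_smul, add_zero]
      exact (hψ.differentiableAt (hD.mem_nhds hx)).hasFDerivAt
    have h4 : fderiv ℂ ψ x (tracelessBasis j) =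
        A x * tracelessBasis j * (A x).adjugate := by
      have := hader _ hl (tracelessBasis j)
      rwa [← h1] at this
    have h3 := (h2.comp_hasDerivAt (0 : ℂ) hline).congr_deriv h4
    let T : M2 →L[ℂ] ℂ := (tracelessCoord i).comp (LinearMap.toContinuousLinearMap
      ((LinearMap.mulRight ℂ (A x)).comp (LinearMap.mulLeft ℂ (A x).adjugate)))
    have hT : ∀ y, T y = tracelessCoord i ((A x).adjugate * y * A x) := fun y => rfl
    have h5 := T.hasFDerivAt.comp_hasDerivAt (0 : ℂ) (h3.sub_const (halfTrace x • (1 : M2)))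
    have h6 : T (A x * tracelessBasis j * (A x).adjugate) = if i = j then 1 else 0 := by
      have : (A x).adjugate * (A x * tracelessBasis j * (A x).adjugate) * A x =
          ((A x).adjugate * A x) * tracelessBasis j * ((A x).adjugate * A x) := by
        simp only [Matrix.mul_assoc]
      rw [hT, this, adjugate_mul_cancel hd, Matrix.one_mul, Matrix.mul_one,
        tracelessCoord_basis]
    refine (h5.congr_deriv h6).congr_of_eventuallyEq ?_
    have hmem : ∀ᶠ t in 𝓝 (0 : ℂ), x + t • tracelessBasis j ∈ D :=
      hline.continuousAt.eventually (hD.mem_nhds (by simpa using hx))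
    filter_upwards [hmem] with t ht
    have h7 : halfTrace (x + t • tracelessBasis j) = halfTrace x := by
      simp [halfTrace_basis]
    rw [hηcoord _ ht]
    simp only [H, A, h7, Function.comp_apply, hT]
  obtain ⟨d, s, hd, hs, h0, hint⟩ :=
    exists_intertwiner hD hη tracelessCoord_basis hDs hQ hz hder
  let V : M2 → M2 := fun x => !![d x + s 0 x, s 1 x; s 2 x, d x - s 0 x]
  have hV : DifferentiableOn ℂ V D := by
    refine differentiableOn_matrix_iff.2 fun i j => ?_
    fin_cases i <;> fin_cases j
    exacts [hd.add (hs 0), hs 1, hs 2, hd.sub (hs 0)]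
  have hVdet : ContinuousOn (fun x => (V x).det) D := by
    simp only [V, Matrix.det_fin_two_of]
    exact ((hd.add (hs 0)).continuousOn.mul (hd.sub (hs 0)).continuousOn).sub
      ((hs 1).continuousOn.mul (hs 2).continuousOn)
  refine ⟨D ∩ (fun x => d x * (V x).det) ⁻¹' {0}ᶜ,
    (hd.continuousOn.mul hVdet).isOpen_inter_preimage hD isOpen_compl_singleton, ?_,
    inter_subset_left, fun x => A x * V x,
    (differentiableOn_matrix_mul hA hV).mono inter_subset_left, ?_⟩
  · intro x hx
    refine ⟨hTD hx, ?_⟩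
    have hx' := hTD hx
    obtain ⟨l, -, rfl⟩ := hx
    obtain ⟨e0, e1⟩ := h0 _ hx' (tracelessCoord_smul_one l)
    simp [V, Matrix.det_fin_two_of, e0, e1]
  · rintro x ⟨hx, hne⟩
    have hne' : d x * (V x).det ≠ 0 := hne
    have hd0 : d x ≠ 0 := left_ne_zero_of_mul hne'
    have hVu : IsUnit (V x).det := (right_ne_zero_of_mul hne').isUnit
    have hu : IsUnit (A x * V x).det := by
      rwa [Matrix.det_mul, hAdet x hx, one_mul]
    refine ⟨(Matrix.isUnit_iff_isUnit_det _).2 hu, ?_⟩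
    have hHV : H x * V x = V x * (x - halfTrace x • 1) := by
      have h1 := hint x hx hd0
      rw [← hHη x hx] at h1
      have h2 := sub_eq_iff_eq_add'.2 (eq_halfTrace_smul_one_add x)
      exact h1.trans (congrArg (fun y => V x * y) h2.symm)
    have hcomm : ψ x * (A x * V x) = A x * V x * x := by
      calc ψ x * (A x * V x)
          = halfTrace x • (A x * V x) + A x * H x * ((A x).adjugate * A x) * V x := by
            rw [hψH x hx, Matrix.add_mul, Matrix.smul_mul, Matrix.one_mul]
            simp only [Matrix.mul_assoc]
        _ = halfTrace x • (A x * V x) + A x * (H x * V x) := by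
            rw [adjugate_mul_cancel (hAdet x hx), Matrix.mul_one, Matrix.mul_assoc]
        _ = A x * V x * x := by
            rw [hHV, ← Matrix.mul_assoc, Matrix.mul_sub, Matrix.mul_smul, Matrix.mul_one]
            abel
    rw [← hcomm, Matrix.mul_assoc, Matrix.mul_nonsing_inv _ hu, Matrix.mul_one]

end Assembly

/-- A locally uniform limit (on a neighborhood `W` of `𝒯`) of conjugations
`x ↦ pₙ(x) x pₙ(x)⁻¹` with `det pₙ = 1` is a holomorphic conjugation on a neighborhood
of `𝒯`. -/
theorem limit_of_conjugations_is_conjugation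
    (W : Set M2) (hWopen : IsOpen W) (hTW : NonCyclic ⊆ W) (hWΩ : W ⊆ SpectralBall)
    (p : ℕ → M2 → M2)
    (hp : ∀ n, DifferentiableOn ℂ (p n) W)
    (hpdet : ∀ n, ∀ x ∈ W, (p n x).det = 1)
    (ψ : M2 → M2) (hψ : DifferentiableOn ℂ ψ W) (hψΩ : MapsTo ψ W SpectralBall)
    (hconv : ∀ K ⊆ W, IsCompact K →
      TendstoUniformlyOn (fun n x => p n x * x * (p n x)⁻¹) ψ Filter.atTop K) :
    ∃ U : Set M2, IsOpen U ∧ NonCyclic ⊆ U ∧ U ⊆ W ∧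
      ∃ u : M2 → M2, DifferentiableOn ℂ u U ∧
        ∀ x ∈ U, IsUnit (u x) ∧ ψ x = u x * x * (u x)⁻¹ := by
  obtain ⟨a, ha, hadet, hader⟩ := exists_fderiv_eq_conj hWopen hTW hp hpdet hψ hconv
  obtain ⟨D, hD, hTD, hDW, hDtr, hDs⟩ := exists_open_stable hWopen hTW
  obtain ⟨U, hU, hTU, hUD, hu⟩ := exists_conj_of_fderiv_eq_conj hD hTD hDtr hDs
    (hψ.mono hDW) (fun x hx => trace_limit_conj (hDW hx) hpdet hconv)
    (fun x hx => det_limit_conj (hDW hx) hpdet hconv)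
    (fun l hl => limit_conj_smul_one (hDW hl) hpdet hconv) ha hadet hader
  exact ⟨U, hU, hTU, hUD.trans hDW, hu⟩
end
end

section
/- Let a : Ω → ℂ∗ be a holomorphic nowhere-vanishing function and suppose that the diagonal conjugation D̃_a : x ↦ d(x) x d(x)⁻¹, where d(x) = diag(a(x), a(x)⁻¹), is an automorphism of Ω. Then a depends only on the entries x₁₁, x₂₂ and the product x₁₂x₂₁: for all x, y ∈ Ω with x₁₁ = y₁₁, x₂₂ = y₂₂ and x₁₂x₂₁ = y₁₂y₂₁ one has a(x) = a(y). -/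
open Matrix Set

attribute [local instance] Matrix.normedAddCommGroup Matrix.normedSpace

noncomputable section

/-- `f` is an automorphism of the domain `D`. -/
def IsAutomorphismOn {E : Type*} [NormedAddCommGroup E] [NormedSpace ℂ E]
    (D : Set E) (f : E → E) : Prop :=
  DifferentiableOn ℂ f D ∧ MapsTo f D D ∧
    ∃ g : E → E, DifferentiableOn ℂ g D ∧ MapsTo g D D ∧
      (∀ x ∈ D, g (f x) = x) ∧ (∀ x ∈ D, f (g x) = x)

/-- The diagonal matrix `diag (a, a⁻¹)`. -/
def DiagMat (a : ℂ) : M2 := Matrix.diagonal ![a, a⁻¹]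

open Complex in
/-- A continuous logarithm of an entire function is entire. -/
theorem differentiable_of_differentiable_exp {H : ℂ → ℂ} (hc : Continuous H)
    (hd : Differentiable ℂ fun w => exp (H w)) : Differentiable ℂ H := by
  intro w₀
  have hlog : DifferentiableAt ℂ (fun w => H w₀ + log (exp (H w) / exp (H w₀))) w₀ := by
    refine (differentiableAt_const _).add (((hd w₀).div_const _).clog ?_)
    rw [div_self (exp_ne_zero _)]
    exact one_mem_slitPlane
  refine hlog.congr_of_eventuallyEq ?_
  have hcont : Continuous fun w => |(H w - H w₀).im| := by fun_prop
  have hsmall : ∀ᶠ w in nhds w₀, |(H w - H w₀).im| < Real.pi :=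
    hcont.continuousAt.eventually_lt_const (by simpa using Real.pi_pos)
  filter_upwards [hsmall] with w hw
  rw [← exp_sub, log_exp (abs_lt.1 hw).1 (abs_lt.1 hw).2.le]
  ring

open Filter in
/-- A bijective entire function tends to infinity at infinity. -/
theorem tendsto_cocompact_of_bijective_entire {G : ℂ → ℂ} (hd : Differentiable ℂ G)
    (hG : Function.Bijective G) : Tendsto G (cocompact ℂ) (cocompact ℂ) := by
  have hopen : IsOpenMap G := by
    refine (hd.differentiableOn.analyticOnNhd isOpen_univ).is_constant_or_isOpenMap.resolve_left ?_
    rintro ⟨c, hc⟩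
    exact zero_ne_one (hG.1 ((hc 0).trans (hc 1).symm))
  exact ((Equiv.ofBijective G hG).toHomeomorphOfContinuousOpen
    hd.continuous hopen).isClosedEmbedding.tendsto_cocompact

open Filter in
/-- A bijective entire function is affine. -/
theorem exists_affine_of_bijective_entire {G : ℂ → ℂ} (hd : Differentiable ℂ G)
    (hG : Function.Bijective G) : ∃ c d : ℂ, ∀ w, G w = c * w + d := by
  obtain ⟨w₀, hw₀⟩ : ∃ w₀, deriv G w₀ ≠ 0 := by
    by_contra! h
    exact zero_ne_one (hG.1 (is_const_of_deriv_eq_zero hd h 0 1))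
  have entire_dslope : ∀ f : ℂ → ℂ, Differentiable ℂ f → Differentiable ℂ (dslope f w₀) := by
    intro f hf
    rw [← differentiableOn_univ] at hf ⊢
    exact (Complex.differentiableOn_dslope univ_mem).2 hf
  have hq : ∀ w, dslope G w₀ w ≠ 0 := by
    intro w
    rcases eq_or_ne w w₀ with rfl | hw
    · rwa [dslope_same]
    · rw [dslope_of_ne _ hw, slope_def_field]
      exact div_ne_zero (sub_ne_zero.2 (hG.1.ne hw)) (sub_ne_zero.2 hw)
  set r : ℂ → ℂ := fun w => (dslope G w₀ w)⁻¹ with hr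
  have hrd : Differentiable ℂ r := (entire_dslope G hd).inv hq
  have hshift : ∀ c : ℂ, Tendsto (fun w : ℂ => (w - c)⁻¹) (cocompact ℂ) (nhds 0) := by
    intro c
    rw [← Metric.cobounded_eq_cocompact]
    refine tendsto_inv₀_cobounded.comp ?_
    rw [Metric.cobounded_eq_cocompact]
    exact (Homeomorph.subRight c).isClosedEmbedding.tendsto_cocompact
  have hlim : Tendsto (dslope r w₀) (cocompact ℂ) (nhds 0) := by
    have h := ((hshift (G w₀)).comp (tendsto_cocompact_of_bijective_entire hd hG)).sub
      ((hshift w₀).mul_const (r w₀))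
    rw [zero_mul, sub_zero] at h
    refine h.congr' ?_
    have hne : ∀ᶠ w in cocompact ℂ, w ≠ w₀ := 
      (isCompact_singleton (x := w₀)).compl_mem_cocompact
    filter_upwards [hne] with w hw
    have h1 := sub_ne_zero.2 hw
    have h2 := sub_ne_zero.2 (hG.1.ne hw)
    have h3 : r w = (w - w₀) / (G w - G w₀) := by
      rw [hr]
      simp only
      rw [dslope_of_ne _ hw, slope_def_field, inv_div]
    rw [dslope_of_ne _ hw, slope_def_field, h3]
    simp only [Function.comp_apply]
    field_simp
  have hconst : ∀ w, r w = r w₀ := by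
    intro w
    have h := sub_smul_dslope r w₀ w
    rw [(entire_dslope r hrd).apply_eq_of_tendsto_cocompact w hlim, smul_zero] at h
    exact (sub_eq_zero.1 h.symm)
  refine ⟨(r w₀)⁻¹, G w₀ - (r w₀)⁻¹ * w₀, fun w => ?_⟩
  have h := sub_smul_dslope G w₀ w
  rw [← inv_inv (dslope G w₀ w), show (dslope G w₀ w)⁻¹ = r w₀ from hconst w, smul_eq_mul] at h
  linear_combination -h

open Complex in
/-- An entire function `H` of period `2πi` for which `w ↦ w + 2 H w` is bijective is constant. -/
theorem eq_of_bijective_add_periodic {H : ℂ → ℂ} (hd : Differentiable ℂ H)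
    (hper : ∀ w, H (w + 2 * Real.pi * I) = H w)
    (hbij : Function.Bijective fun w => w + 2 * H w) (w w' : ℂ) : H w = H w' := by
  obtain ⟨c, d, hcd⟩ := exists_affine_of_bijective_entire
    (differentiable_id.add (hd.const_mul 2)) hbij
  simp only [id_eq, Pi.add_apply] at hcd
  have hc : c = 1 := by
    have h0 := hcd 0
    have h1 := hcd (0 + 2 * Real.pi * I)
    rw [hper] at h1
    apply mul_right_cancel₀ two_pi_I_ne_zero
    linear_combination h0 - h1
  subst hc
  linear_combination (hcd w - hcd w') / 2

theorem mem_spectralBall_iff (x : M2) :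
    x ∈ SpectralBall ↔
      ∀ w ∈ Metric.closedBall (0 : ℂ) 1, 1 - w * x.trace + w ^ 2 * x.det ≠ 0 := by
  have hspec : ∀ z, z ∈ spectrum ℂ x ↔ z ^ 2 - x.trace * z + x.det = 0 := by
    intro z
    rw [Matrix.mem_spectrum_iff_isRoot_charpoly, Matrix.charpoly_fin_two]
    simp
  simp only [SpectralBall, mem_ofPred_eq, hspec, mem_closedBall_zero_iff]
  constructor
  · intro h w hw h0
    have hw0 : w ≠ 0 := by
      rintro rfl
      simp at h0
    have hlt := h w⁻¹ (by field_simp; linear_combination h0)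
    rw [norm_inv] at hlt
    exact hlt.not_ge ((one_le_inv₀ (norm_pos_iff.2 hw0)).2 hw)
  · intro h z hz
    by_contra! hz1
    have hz0 : z ≠ 0 := norm_pos_iff.1 (zero_lt_one.trans_le hz1)
    refine h z⁻¹ ?_ ?_
    · rw [norm_inv]
      exact inv_le_one_of_one_le₀ hz1
    · field_simp
      linear_combination hz

theorem isOpen_spectralBall : IsOpen SpectralBall := by
  rw [isOpen_iff_eventually]
  intro x hx
  simp only [mem_spectralBall_iff] at hx ⊢
  refine (isCompact_closedBall (0 : ℂ) 1).eventually_forall_of_forall_eventually fun w hw => ?_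
  have hcont : Continuous fun q : M2 × ℂ => 1 - q.2 * q.1.trace + q.2 ^ 2 * q.1.det := by
    fun_prop
  exact hcont.continuousAt.eventually_ne (hx w hw)

theorem starConvex_spectralBall : StarConvex ℝ 0 SpectralBall := by
  rw [starConvex_zero_iff]
  intro x hx t ht0 ht1
  rw [mem_spectralBall_iff] at hx ⊢
  intro w hw
  have h := hx (t * w) (by
    rw [mem_closedBall_zero_iff] at hw ⊢
    rw [norm_mul, Complex.norm_real, Real.norm_of_nonneg ht0]
    exact mul_le_one₀ ht1 (norm_nonneg _) hw)
  intro h0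
  apply h
  rw [← h0, Matrix.trace_fin_two, Matrix.det_fin_two, Matrix.trace_fin_two, Matrix.det_fin_two]
  simp only [Matrix.smul_apply, Complex.real_smul]
  ring

theorem isSimplyConnected_spectralBall : IsSimplyConnected SpectralBall := by
  have hne : SpectralBall.Nonempty := ⟨0, (mem_spectralBall_iff 0).2 (by simp)⟩
  have := starConvex_spectralBall.contractibleSpace hne
  exact SimplyConnectedSpace.ofContractible SpectralBall

/-- Membership in the spectral ball depends only on the diagonal and the product of the
off-diagonal entries. -/
theorem mem_spectralBall_congr {x y : M2} (h0 : x 0 0 = y 0 0) (h1 : x 1 1 = y 1 1)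
    (hp : x 0 1 * x 1 0 = y 0 1 * y 1 0) : x ∈ SpectralBall ↔ y ∈ SpectralBall := by
  simp only [mem_spectralBall_iff, Matrix.trace_fin_two, Matrix.det_fin_two, h0, h1, hp]

theorem diagMat_conj (b : ℂ) (hb : b ≠ 0) (x : M2) :
    DiagMat b * x * (DiagMat b)⁻¹ =
      !![x 0 0, b ^ 2 * x 0 1; (b ^ 2)⁻¹ * x 1 0, x 1 1] := by
  have hinv : (DiagMat b)⁻¹ = DiagMat b⁻¹ := by
    apply Matrix.inv_eq_right_inv
    ext i j
    fin_cases i <;> fin_cases j <;> simp [DiagMat, hb]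
  rw [hinv]
  ext i j
  fin_cases i <;> fin_cases j <;> simp [DiagMat] <;> field_simp

/-- The exponential parametrization of the matrices with given diagonal `u, v`, given product `p`
of the off-diagonal entries, and nonzero upper right entry. -/
def fiberCurve (u v p w : ℂ) : M2 := !![u, Complex.exp w; p * Complex.exp (-w), v]

theorem fiberCurve_eq_iff {u v p w w' : ℂ} :
    fiberCurve u v p w = fiberCurve u v p w' ↔ Complex.exp w = Complex.exp w' := by
  constructor
  · intro h
    simpa [fiberCurve] using congrFun (congrFun h 0) 1
  · intro h
    simp only [fiberCurve, Complex.exp_neg, h]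

theorem differentiable_fiberCurve (u v p : ℂ) : Differentiable ℂ (fiberCurve u v p) := by
  refine differentiable_pi.2 fun i => differentiable_pi.2 fun j => ?_
  fin_cases i <;> fin_cases j <;> simp [fiberCurve] <;> fun_prop

theorem eq_fiberCurve (x : M2) (hx : x 0 1 ≠ 0) :
    x = fiberCurve (x 0 0) (x 1 1) (x 0 1 * x 1 0) (Complex.log (x 0 1)) := by
  ext i j
  fin_cases i <;> fin_cases j
  all_goals simp [fiberCurve, Complex.exp_neg, Complex.exp_log hx]
  field_simp

open Complex in
/-- The coefficient of a diagonal conjugation automorphism is constant along each fiber curve. -/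
theorem coefficient_eq_on_fiberCurve
    (a : M2 → ℂ) (ha : DifferentiableOn ℂ a SpectralBall)
    (ha0 : ∀ x ∈ SpectralBall, a x ≠ 0)
    (haut : IsAutomorphismOn SpectralBall
      (fun x => DiagMat (a x) * x * (DiagMat (a x))⁻¹))
    {u v p : ℂ} (hmem : ∀ w, fiberCurve u v p w ∈ SpectralBall) (w w' : ℂ) :
    a (fiberCurve u v p w) = a (fiberCurve u v p w') := by
  obtain ⟨-, -, g, -, hgm, hgf, hfg⟩ := haut
  have : LocallyPathConnectedSpace M2 :=
    inferInstanceAs (LocallyPathConnectedSpace (Fin 2 → Fin 2 → ℂ))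
  obtain ⟨h, hhc, hh⟩ := exists_continuousOn_eqOn_exp_comp isSimplyConnected_spectralBall
    isOpen_spectralBall ha.continuousOn (by rintro ⟨x, hx, h⟩; exact ha0 x hx h)
  have hexp : ∀ x ∈ SpectralBall, exp (h x) = a x := hh
  set M := fiberCurve u v p with hM
  have hMd : Differentiable ℂ M := differentiable_fiberCurve u v p
  set H : ℂ → ℂ := fun w => h (M w) with hH
  have hHc : Continuous H := hhc.comp_continuous hMd.continuous hmem
  have hHa : ∀ w, exp (H w) = a (M w) := fun w => hexp _ (hmem w)
  have hHd : Differentiable ℂ H := by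
    refine differentiable_of_differentiable_exp hHc ?_
    simp only [hHa]
    intro w
    exact (ha.differentiableAt (isOpen_spectralBall.mem_nhds (hmem w))).comp w (hMd w)
  have hHM : ∀ {w w'}, exp w = exp w' → H w = H w' := fun h => by
    simp only [hH, hM, fiberCurve_eq_iff.2 h]
  have hf : ∀ w, DiagMat (a (M w)) * M w * (DiagMat (a (M w)))⁻¹ = M (w + 2 * H w) := by
    intro w
    have hsq : a (M w) ^ 2 = exp (2 * H w) := by rw [← hHa, ← exp_nat_mul]; norm_cast
    rw [diagMat_conj _ (ha0 _ (hmem w)), hsq, ← exp_neg]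
    simp only [hM, fiberCurve, exp_add, neg_add]
    ext i j
    fin_cases i <;> fin_cases j <;> simp <;> ring
  have hbij : Function.Bijective fun w => w + 2 * H w := by
    constructor
    · intro w w' hww
      have h1 : M w = M w' := by
        rw [← hgf _ (hmem w), ← hgf _ (hmem w')]
        simp only [hf]
        exact congrArg (fun z => g (M z)) hww
      have h2 := hHM (fiberCurve_eq_iff.1 h1)
      simp only [h2] at hww
      exact add_right_cancel hww
    · intro z
      have hy := hgm (hmem z)
      have hfy := hfg _ (hmem z)
      set y := g (M z)
      have hne := ha0 y hy
      simp only [diagMat_conj _ hne, hM, fiberCurve] at hfy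
      have e00 : y 0 0 = u := by simpa using congrFun (congrFun hfy 0) 0
      have e01 : a y ^ 2 * y 0 1 = exp z := by simpa using congrFun (congrFun hfy 0) 1
      have e10 : (a y ^ 2)⁻¹ * y 1 0 = p * exp (-z) := by
        simpa using congrFun (congrFun hfy 1) 0
      have e11 : y 1 1 = v := by simpa using congrFun (congrFun hfy 1) 1
      have hy01 : y 0 1 ≠ 0 := fun h0 => exp_ne_zero z (by rw [← e01, h0, mul_zero])
      have hp : y 0 1 * y 1 0 = p := by
        calc y 0 1 * y 1 0 = (a y ^ 2 * y 0 1) * ((a y ^ 2)⁻¹ * y 1 0) := by field_simp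
          _ = p := by rw [e01, e10, exp_neg]; field_simp
      have hyM := eq_fiberCurve y hy01
      rw [e00, e11, hp] at hyM
      have hz : exp z = exp (log (y 0 1) + 2 * H (log (y 0 1))) := by
        refine (fiberCurve_eq_iff (u := u) (v := v) (p := p)).1 ?_
        rw [← hM, ← hf, hM, ← hyM]
        exact (hfg _ (hmem z)).symm
      obtain ⟨n, hn⟩ := exp_eq_exp_iff_exists_int.1 hz
      refine ⟨log (y 0 1) + n * (2 * Real.pi * I), ?_⟩
      have := hHM (exp_eq_exp_iff_exists_int.2 ⟨n, rfl⟩ :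
        exp (log (y 0 1) + n * (2 * Real.pi * I)) = exp (log (y 0 1)))
      simp only [this, hn]
      ring
  rw [← hHa, ← hHa, eq_of_bijective_add_periodic hHd (fun w => hHM (exp_periodic w)) hbij w w']

/-- A matrix whose off-diagonal entries have product zero is a limit of matrices with the same
diagonal whose off-diagonal entries have product `δ ^ 2`. -/
theorem exists_offDiag_perturbation (x : M2) (hx : x 0 1 * x 1 0 = 0) :
    ∃ c : ℂ → M2, Continuous c ∧ c 0 = x ∧
      ∀ δ, c δ 0 0 = x 0 0 ∧ c δ 1 1 = x 1 1 ∧ c δ 0 1 * c δ 1 0 = δ ^ 2 := by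
  obtain ⟨s, t, hs, ht, hs0, ht0, hst⟩ : ∃ s t : ℂ → ℂ, Continuous s ∧ Continuous t ∧
      s 0 = x 0 1 ∧ t 0 = x 1 0 ∧ ∀ δ, s δ * t δ = δ ^ 2 := by
    by_cases h01 : x 0 1 = 0
    · by_cases h10 : x 1 0 = 0
      · exact ⟨id, id, continuous_id, continuous_id, h01.symm, h10.symm, fun δ => (sq δ).symm⟩
      · refine ⟨fun δ => δ ^ 2 / x 1 0, fun _ => x 1 0, by fun_prop, by fun_prop, by simp [h01],
          rfl, fun δ => by field_simp⟩
    · refine ⟨fun _ => x 0 1, fun δ => δ ^ 2 / x 0 1, by fun_prop, by fun_prop, rfl, ?_,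
        fun δ => by field_simp⟩
      simp [(mul_eq_zero.1 hx).resolve_left h01]
  refine ⟨fun δ => !![x 0 0, s δ; t δ, x 1 1], ?_, ?_, fun δ => by simp [hst]⟩
  · refine continuous_matrix fun i j => ?_
    fin_cases i <;> fin_cases j <;> simp <;> fun_prop
  · ext i j
    fin_cases i <;> fin_cases j <;> simp [hs0, ht0]

/-- If the diagonal conjugation `x ↦ diag(a(x), a(x)⁻¹) x diag(a(x), a(x)⁻¹)⁻¹` is an
automorphism of the spectral ball, then `a` depends only on `x₁₁`, `x₂₂` and `x₁₂x₂₁`. -/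
theorem diagonal_conjugation_coefficient_depends
    (a : M2 → ℂ) (ha : DifferentiableOn ℂ a SpectralBall)
    (ha0 : ∀ x ∈ SpectralBall, a x ≠ 0)
    (haut : IsAutomorphismOn SpectralBall
      (fun x => DiagMat (a x) * x * (DiagMat (a x))⁻¹)) :
    ∀ x ∈ SpectralBall, ∀ y ∈ SpectralBall,
      x 0 0 = y 0 0 → x 1 1 = y 1 1 → x 0 1 * x 1 0 = y 0 1 * y 1 0 → a x = a y := by
  have key : ∀ x ∈ SpectralBall, ∀ y ∈ SpectralBall, x 0 0 = y 0 0 → x 1 1 = y 1 1 →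
      x 0 1 * x 1 0 = y 0 1 * y 1 0 → x 0 1 * x 1 0 ≠ 0 → a x = a y := by
    intro x hx y hy h0 h1 hp hne
    have ex := eq_fiberCurve x (left_ne_zero_of_mul hne)
    have ey := eq_fiberCurve y (left_ne_zero_of_mul (hp ▸ hne))
    rw [← h0, ← h1, ← hp] at ey
    rw [ex, ey]
    refine coefficient_eq_on_fiberCurve a ha ha0 haut (fun w => ?_) _ _
    refine (mem_spectralBall_congr ?_ ?_ ?_).2 hx <;> simp [fiberCurve, Complex.exp_neg]
    field_simp
  intro x hx y hy h0 h1 hp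
  by_cases hne : x 0 1 * x 1 0 = 0
  · obtain ⟨c, hc, hc0, hcx⟩ := exists_offDiag_perturbation x hne
    obtain ⟨d, hd, hd0, hdy⟩ := exists_offDiag_perturbation y (hp ▸ hne)
    have tendsto_along : ∀ (z : M2) (_ : z ∈ SpectralBall) (e : ℂ → M2) (_ : Continuous e)
        (_ : e 0 = z), (∀ᶠ δ in nhdsWithin 0 {0}ᶜ, e δ ∈ SpectralBall) ∧
          Filter.Tendsto (fun δ => a (e δ)) (nhdsWithin 0 {0}ᶜ) (nhds (a z)) := by
      rintro z hz e he rfl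
      have hnhds := isOpen_spectralBall.mem_nhds hz
      refine ⟨(he.continuousAt.eventually hnhds).filter_mono nhdsWithin_le_nhds, ?_⟩
      exact ((ha.continuousOn.continuousAt hnhds).tendsto.comp he.continuousAt.tendsto).mono_left
        nhdsWithin_le_nhds
    obtain ⟨hcm, hct⟩ := tendsto_along x hx c hc hc0
    obtain ⟨hdm, hdt⟩ := tendsto_along y hy d hd hd0
    refine tendsto_nhds_unique (hct.congr' ?_) hdt
    filter_upwards [hcm, hdm, self_mem_nhdsWithin] with δ hcδ hdδ hδ
    obtain ⟨c0, c1, cp⟩ := hcx δ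
    obtain ⟨d0, d1, dp⟩ := hdy δ
    refine key _ hcδ _ hdδ (by rw [c0, d0, h0]) (by rw [c1, d1, h1]) (by rw [cp, dp]) ?_
    rw [cp]
    exact pow_ne_zero 2 hδ
  · exact key x hx y hy h0 h1 hp hne
end
end
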